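/- Let d ≥ 1 and define the weight w₁(z,t) = |z| (1+|z|²)^{−1/2} (1 + (|z|⁴+t²)^{1/2})^{−1}. There exists a constant C > 0 depending only on d with the following property (Kato-type local smoothing for the Schrödinger flow of the sublaplacian): if u : ℝ × ℝ^{2d+1} → ℂ is such that u(τ,·) ∈ 𝒮(ℝ^{2d+1}) for every τ ∈ ℝ, the map τ ↦ u(τ,·) is continuously differentiable as an L²(ℝ^{2d+1})-valued map, and i ∂_τ u(τ,·) = −Δ_H u(τ,·) for all τ, then ∫_ℝ ∫_{ℝ^{2d+1}} w₁(z,t)² |u(τ,z,t)|² dz dt dτ ≤ C ∫_{ℝ^{2d+1}} |u(0,z,t)|² dz dt. -/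

import Mathlib

noncomputable section

open MeasureTheory ENNReal

/-- The Heisenberg group ℍ^d modeled on ℝ^d × ℝ^d × ℝ. -/
abbrev Hd (d : ℕ) : Type := EuclideanSpace ℝ (Fin d) × EuclideanSpace ℝ (Fin d) × ℝ

/-- The left-invariant vector field `X_j = ∂_{x_j} + 2 y_j ∂_t`. -/
def Xop (d : ℕ) (j : Fin d) (f : Hd d → ℂ) (p : Hd d) : ℂ :=
  fderiv ℝ f p (EuclideanSpace.single j 1, 0, 2 * p.2.1 j)

/-- The left-invariant vector field `Y_j = ∂_{y_j} - 2 x_j ∂_t`. -/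
def Yop (d : ℕ) (j : Fin d) (f : Hd d → ℂ) (p : Hd d) : ℂ :=
  fderiv ℝ f p (0, EuclideanSpace.single j 1, -(2 * p.1 j))

/-- The vertical derivative `T = ∂_t`. -/
def Tder (d : ℕ) (f : Hd d → ℂ) (p : Hd d) : ℂ :=
  fderiv ℝ f p (0, 0, 1)

/-- The rotation operator `N = Σ_j (y_j ∂_{x_j} - x_j ∂_{y_j})`. -/
def Nop (d : ℕ) (f : Hd d → ℂ) (p : Hd d) : ℂ :=
  fderiv ℝ f p (p.2.1, -p.1, 0)

/-- The sublaplacian `Δ_H = Σ_j (X_j² + Y_j²)`. -/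
def subLap (d : ℕ) (f : Hd d → ℂ) (p : Hd d) : ℂ :=
  ∑ j : Fin d, (Xop d j (Xop d j f) p + Yop d j (Yop d j f) p)

/-- Squared length of the horizontal gradient: `|∇_H f|² = Σ_j (|X_j f|² + |Y_j f|²)`. -/
def gradHsq (d : ℕ) (f : Hd d → ℂ) (p : Hd d) : ℝ :=
  ∑ j : Fin d, (‖Xop d j f p‖ ^ 2 + ‖Yop d j f p‖ ^ 2)

/-- `|z|² = |x|² + |y|²`. -/
def zsq (d : ℕ) (p : Hd d) : ℝ := ‖p.1‖ ^ 2 + ‖p.2.1‖ ^ 2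

/-- `|z|`. -/
def zn (d : ℕ) (p : Hd d) : ℝ := Real.sqrt (zsq d p)

/-- The weight `w₁(z,t) = |z| (1+|z|²)^{-1/2} (1 + (|z|⁴+t²)^{1/2})⁻¹`. -/
def w1 (d : ℕ) (p : Hd d) : ℝ :=
  zn d p / Real.sqrt (1 + zn d p ^ 2) / (1 + Real.sqrt (zn d p ^ 4 + p.2.2 ^ 2))

/-- The weight `w₂(z,t) = (1+|z|²+t²)^{-1/2}`. -/
def w2 (d : ℕ) (p : Hd d) : ℝ :=
  (Real.sqrt (1 + zsq d p + p.2.2 ^ 2))⁻¹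

/-- The weight `w₄(z,t) = |z| (|z|⁴+t²)^{-1/2}`. -/
def w4 (d : ℕ) (p : Hd d) : ℝ :=
  zn d p / Real.sqrt (zn d p ^ 4 + p.2.2 ^ 2)

open SchwartzMap
open scoped LineDeriv ComplexConjugate

set_option linter.unusedSectionVars false

section Operators

variable {Z : Type*} [NormedAddCommGroup Z] [NormedSpace ℝ Z]

/-- Multiplication of a Schwartz function by a real linear form. -/
def mulLin (l : Z × ℝ →L[ℝ] ℝ) : 𝓢(Z × ℝ, ℂ) →L[ℂ] 𝓢(Z × ℝ, ℂ) :=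
  smulLeftCLM ℂ (fun p => ((l p : ℝ) : ℂ))

lemma hasTemperateGrowth_ofReal_clm (l : Z × ℝ →L[ℝ] ℝ) :
    (fun p => ((l p : ℝ) : ℂ)).HasTemperateGrowth :=
  Function.Complex.hasTemperateGrowth_ofReal.comp l.hasTemperateGrowth

@[simp] lemma mulLin_apply (l : Z × ℝ →L[ℝ] ℝ) (v : 𝓢(Z × ℝ, ℂ)) (p : Z × ℝ) :
    mulLin l v p = (l p : ℂ) * v p := by
  simp [mulLin, smulLeftCLM_apply_apply (hasTemperateGrowth_ofReal_clm l)]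

/-- Multiplication by the vertical coordinate. -/
def mulT : 𝓢(Z × ℝ, ℂ) →L[ℂ] 𝓢(Z × ℝ, ℂ) := mulLin (ContinuousLinearMap.snd ℝ Z ℝ)

/-- Multiplication by a linear form of the horizontal variable. -/
def mulZ (c : Z →L[ℝ] ℝ) : 𝓢(Z × ℝ, ℂ) →L[ℂ] 𝓢(Z × ℝ, ℂ) :=
  mulLin (c.comp (ContinuousLinearMap.fst ℝ Z ℝ))

@[simp] lemma mulT_apply (v : 𝓢(Z × ℝ, ℂ)) (p : Z × ℝ) : mulT v p = (p.2 : ℂ) * v p := by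
  simp [mulT]

@[simp] lemma mulZ_apply (c : Z →L[ℝ] ℝ) (v : 𝓢(Z × ℝ, ℂ)) (p : Z × ℝ) :
    mulZ c v p = (c p.1 : ℂ) * v p := by
  simp [mulZ]

/-- The vertical derivative. -/
def vT (v : 𝓢(Z × ℝ, ℂ)) : 𝓢(Z × ℝ, ℂ) := ∂_{((0 : Z), (1 : ℝ))} v

lemma vT_apply (v : 𝓢(Z × ℝ, ℂ)) (p : Z × ℝ) : vT v p = fderiv ℝ v p (0, 1) :=
  lineDerivOp_apply_eq_fderiv _ _ _

/-- The left-invariant field in the horizontal direction `ξ` for the symplectic form `ω`. -/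
def hX (ω : Z →L[ℝ] Z →L[ℝ] ℝ) (ξ : Z) (v : 𝓢(Z × ℝ, ℂ)) : 𝓢(Z × ℝ, ℂ) :=
  ∂_{(ξ, (0 : ℝ))} v + (2 : ℂ) • mulZ (ω ξ) (vT v)

lemma hX_apply (ω : Z →L[ℝ] Z →L[ℝ] ℝ) (ξ : Z) (v : 𝓢(Z × ℝ, ℂ)) (p : Z × ℝ) :
    hX ω ξ v p = fderiv ℝ v p (ξ, 2 * ω ξ p.1) := by
  have h : ((ξ, 2 * ω ξ p.1) : Z × ℝ) = (ξ, (0 : ℝ)) + (2 * ω ξ p.1) • ((0 : Z), (1 : ℝ)) := by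
    simp
  rw [h, map_add, map_smul]
  simp [hX, vT_apply, lineDerivOp_apply_eq_fderiv, mul_assoc]

lemma hX_apply' (ω : Z →L[ℝ] Z →L[ℝ] ℝ) (ξ : Z) (v : 𝓢(Z × ℝ, ℂ)) (p : Z × ℝ) :
    hX ω ξ v p = (∂_{(ξ, (0 : ℝ))} v) p + 2 * (ω ξ p.1 * vT v p) := by
  simp [hX]

/-- The sublaplacian attached to the frame `b`. -/
def hLap {ι : Type*} [Fintype ι] (ω : Z →L[ℝ] Z →L[ℝ] ℝ) (b : ι → Z) (v : 𝓢(Z × ℝ, ℂ)) :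
    𝓢(Z × ℝ, ℂ) :=
  ∑ i, hX ω (b i) (hX ω (b i) v)

lemma fderiv_hX (ω : Z →L[ℝ] Z →L[ℝ] ℝ) (η : Z) (v : 𝓢(Z × ℝ, ℂ)) (p m : Z × ℝ) :
    fderiv ℝ (hX ω η v) p m =
      fderiv ℝ (fderiv ℝ v) p m (η, 2 * ω η p.1) + fderiv ℝ v p (0, 2 * ω η m.1) := by
  have e : ⇑(hX ω η v) = fun p => fderiv ℝ v p (η, 2 * ω η p.1) := funext (hX_apply ω η v)
  have h1 : HasFDerivAt (fderiv ℝ v) (fderiv ℝ (fderiv ℝ v) p) p :=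
    (((v.smooth 2).fderiv_right (m := 1) (by norm_num)).differentiable (by norm_num) p).hasFDerivAt
  have h2 : HasFDerivAt (fun p : Z × ℝ => ((η, 2 * ω η p.1) : Z × ℝ))
      (ContinuousLinearMap.prod 0 ((2 : ℝ) • (ω η).comp (ContinuousLinearMap.fst ℝ Z ℝ))) p := by
    refine (hasFDerivAt_const η p).prodMk ?_
    exact (((ω η).comp (ContinuousLinearMap.fst ℝ Z ℝ)).hasFDerivAt).const_mul 2
  have h3 := h1.clm_apply h2
  rw [e, h3.fderiv]
  simp [add_comm]

lemma hX_comm (ω : Z →L[ℝ] Z →L[ℝ] ℝ) (hω : ∀ ξ η, ω ξ η = -ω η ξ) (ξ η : Z)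
    (v : 𝓢(Z × ℝ, ℂ)) :
    hX ω ξ (hX ω η v) - hX ω η (hX ω ξ v) = (-4 * ω ξ η : ℂ) • vT v := by
  ext p
  have hs : IsSymmSndFDerivAt ℝ v p :=
    (v.contDiffAt 2).isSymmSndFDerivAt (by simp)
  simp only [sub_apply, smul_apply, hX_apply, fderiv_hX, vT_apply]
  rw [hs.eq (ξ, 2 * ω ξ p.1) (η, 2 * ω η p.1)]
  have e1 : ((0 : Z), 2 * ω η ξ) = (2 * ω η ξ) • ((0 : Z), (1 : ℝ)) := by simp
  have e2 : ((0 : Z), 2 * ω ξ η) = (2 * ω ξ η) • ((0 : Z), (1 : ℝ)) := by simp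
  rw [e1, e2, map_smul, map_smul, hω η ξ]
  simp only [Complex.real_smul, smul_eq_mul]
  push_cast
  ring

lemma fderiv_mulZ (c : Z →L[ℝ] ℝ) (v : 𝓢(Z × ℝ, ℂ)) (p m : Z × ℝ) :
    fderiv ℝ (mulZ c v) p m = c m.1 * v p + c p.1 * fderiv ℝ v p m := by
  have e : ⇑(mulZ c v) = fun p => ((c p.1 : ℝ) : ℂ) * v p := funext (mulZ_apply c v)
  have h1 : HasFDerivAt (fun p : Z × ℝ => ((c p.1 : ℝ) : ℂ))
      (Complex.ofRealCLM.comp (c.comp (ContinuousLinearMap.fst ℝ Z ℝ))) p :=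
    (Complex.ofRealCLM.comp (c.comp (ContinuousLinearMap.fst ℝ Z ℝ))).hasFDerivAt
  have h := h1.fun_mul (v.hasFDerivAt p)
  rw [e, h.fderiv]
  simp
  ring

lemma hX_mulZ (ω : Z →L[ℝ] Z →L[ℝ] ℝ) (ξ : Z) (c : Z →L[ℝ] ℝ) (v : 𝓢(Z × ℝ, ℂ))
    (p : Z × ℝ) : hX ω ξ (mulZ c v) p = c ξ * v p + c p.1 * hX ω ξ v p := by
  rw [hX_apply, hX_apply, fderiv_mulZ]

/-- The real bilinear pairing `(a, b) ↦ a * conj b`. -/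
def mulConj : ℂ →L[ℝ] ℂ →L[ℝ] ℂ :=
  (ContinuousLinearMap.compL ℝ ℂ ℂ ℂ).flip (Complex.conjCLE : ℂ →L[ℝ] ℂ) ∘L
    ContinuousLinearMap.mul ℝ ℂ

@[simp] lemma mulConj_apply (a b : ℂ) : mulConj a b = a * conj b := by
  simp [mulConj]

end Operators

section Ibp

variable {Z : Type*} [NormedAddCommGroup Z] [NormedSpace ℝ Z] [FiniteDimensional ℝ Z]
  [MeasureSpace Z] [BorelSpace Z] [(volume : Measure Z).IsAddHaarMeasure]

instance isAddHaarMeasure_volume_prod_real :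
    (volume : Measure (Z × ℝ)).IsAddHaarMeasure :=
  inferInstanceAs (Measure.prod volume volume : Measure (Z × ℝ)).IsAddHaarMeasure

lemma SchwartzMap.integrable_mul_conj {D : Type*} [NormedAddCommGroup D] [NormedSpace ℝ D]
    [FiniteDimensional ℝ D] [MeasurableSpace D] [BorelSpace D] (μ : Measure D)
    [μ.HasTemperateGrowth] (f g : 𝓢(D, ℂ)) :
    Integrable (fun x => f x * conj (g x)) μ := by
  have := (SchwartzMap.pairing (𝕜 := ℝ) mulConj f g).integrable (μ := μ)
  refine this.congr (Filter.Eventually.of_forall fun x => ?_)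
  simp [SchwartzMap.pairing_apply_apply]

lemma integral_lineDeriv_mul_conj (f g : 𝓢(Z × ℝ, ℂ)) (m : Z × ℝ) :
    ∫ p, (∂_{m} f) p * conj (g p) = -∫ p, f p * conj ((∂_{m} g) p) := by
  have := integral_bilinear_lineDerivOp_right_eq_neg_left (μ := volume) f g mulConj m
  simp only [mulConj_apply] at this
  rw [this, neg_neg]

lemma integral_hX_mul_conj (ω : Z →L[ℝ] Z →L[ℝ] ℝ) (ξ : Z) (f g : 𝓢(Z × ℝ, ℂ)) :
    ∫ p, hX ω ξ f p * conj (g p) = -∫ p, f p * conj (hX ω ξ g p) := by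
  have h1 := integral_lineDeriv_mul_conj f g (ξ, 0)
  have h2 := integral_lineDeriv_mul_conj f (mulZ (ω ξ) g) (0, 1)
  have h3 : ∀ p, (∂_{((0 : Z), (1 : ℝ))} (mulZ (ω ξ) g)) p = ω ξ p.1 * vT g p := by
    intro p
    rw [lineDerivOp_apply_eq_fderiv, vT_apply, fderiv_mulZ]
    simp
  have e1 : ∀ p, hX ω ξ f p * conj (g p) =
      (∂_{(ξ, (0 : ℝ))} f) p * conj (g p) + 2 * (vT f p * conj (mulZ (ω ξ) g p)) := by
    intro p; rw [hX_apply', mulZ_apply]; simp; ring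
  have e2 : ∀ p, f p * conj (hX ω ξ g p) = f p * conj ((∂_{(ξ, (0 : ℝ))} g) p) +
      2 * (f p * conj ((∂_{((0 : Z), (1 : ℝ))} (mulZ (ω ξ) g)) p)) := by
    intro p; rw [hX_apply', h3]; simp only [map_add, map_mul, Complex.conj_ofReal, Complex.conj_ofNat]; ring
  simp_rw [e1, e2]
  rw [integral_add (integrable_mul_conj _ _ _) ((integrable_mul_conj _ _ _).const_mul _),
    integral_add (integrable_mul_conj _ _ _) ((integrable_mul_conj _ _ _).const_mul _),
    integral_const_mul, integral_const_mul, h1]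
  unfold vT
  rw [h2]
  ring

end Ibp

section PartialFourier

/-- The unit complex number `exp (2πix)`. -/
def unitPhase (x : ℝ) : ℂ := Complex.exp (((2 * Real.pi * x : ℝ) : ℂ) * Complex.I)

@[simp] lemma norm_unitPhase (x : ℝ) : ‖unitPhase x‖ = 1 := Complex.norm_exp_ofReal_mul_I _

lemma unitPhase_zero : unitPhase 0 = 1 := by simp [unitPhase]

@[fun_prop] lemma continuous_unitPhase : Continuous unitPhase := by
  unfold unitPhase; fun_prop

lemma hasDerivAt_unitPhase (x : ℝ) :
    HasDerivAt unitPhase (2 * Real.pi * Complex.I * unitPhase x) x := by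
  have h : HasDerivAt (fun x : ℝ => (((2 * Real.pi * x : ℝ) : ℂ) * Complex.I))
      (2 * Real.pi * Complex.I) x := by
    have := ((hasDerivAt_id x).const_mul (2 * Real.pi)).ofReal_comp.mul_const Complex.I
    refine this.congr_deriv ?_
    push_cast; ring
  exact h.cexp.congr_deriv (by rw [unitPhase]; ring)

variable {Z : Type*} [NormedAddCommGroup Z] [NormedSpace ℝ Z]

/-- Partial Fourier transform in the vertical variable. -/
def pft (v : 𝓢(Z × ℝ, ℂ)) (z : Z) (l : ℝ) : ℂ := ∫ t, unitPhase (-(t * l)) * v (z, t)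

lemma SchwartzMap.exists_decay {F : Type*} [NormedAddCommGroup F] [NormedSpace ℝ F]
    (v : 𝓢(Z × ℝ, F)) (N : ℕ) :
    ∃ C, 0 ≤ C ∧ ∀ z t, ‖v (z, t)‖ ≤ C * ((1 + ‖z‖) ^ N)⁻¹ * (1 + t ^ 2)⁻¹ := by
  obtain ⟨C, hC⟩ : ∃ C, ∀ p, (1 + ‖p‖) ^ (N + 2) * ‖v p‖ ≤ C := by
    have := fun p => one_add_le_sup_seminorm_apply (𝕜 := ℝ) (m := (N + 2, 0)) (k := N + 2) (n := 0)
      le_rfl le_rfl v p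
    simp_rw [norm_iteratedFDeriv_zero] at this
    exact ⟨_, this⟩
  refine ⟨C, (by positivity : (0 : ℝ) ≤ _).trans (hC 0), fun z t => ?_⟩
  have h1 : (1 + ‖z‖) ^ N * (1 + t ^ 2) ≤ (1 + ‖(z, t)‖) ^ (N + 2) := by
    rw [pow_add]
    have hz : ‖z‖ ≤ ‖(z, t)‖ := norm_fst_le (z, t)
    have ht : |t| ≤ ‖(z, t)‖ := norm_snd_le (z, t)
    have : 1 + t ^ 2 ≤ (1 + ‖(z, t)‖) ^ 2 := by
      rw [← sq_abs]; nlinarith [abs_nonneg t, norm_nonneg (z, t)]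
    gcongr
  have h2 : 0 < (1 + ‖z‖) ^ N * (1 + t ^ 2) := by positivity
  rw [mul_assoc, ← mul_inv, ← div_eq_mul_inv, le_div_iff₀ h2, mul_comm]
  exact (mul_le_mul_of_nonneg_right h1 (norm_nonneg _)).trans (hC _)

lemma SchwartzMap.exists_decay_real {F : Type*} [NormedAddCommGroup F] [NormedSpace ℝ F]
    (v : 𝓢(Z × ℝ, F)) :
    ∃ C, 0 ≤ C ∧ ∀ z t, ‖v (z, t)‖ ≤ C * (1 + t ^ 2)⁻¹ := by
  obtain ⟨C, h0, hC⟩ := v.exists_decay 0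
  exact ⟨C, h0, fun z t => by simpa using hC z t⟩

/-- The restriction of a Schwartz function to a vertical line. -/
def vslice (v : 𝓢(Z × ℝ, ℂ)) (z : Z) : 𝓢(ℝ, ℂ) :=
  compCLMOfAntilipschitz ℂ (K := 1) (g := fun t : ℝ => (z, t))
    (by
      have : (fun t : ℝ => (z, t)) =
          (fun _ => (z, (0 : ℝ))) + ⇑(ContinuousLinearMap.inr ℝ Z ℝ) := by ext <;> simp
      rw [this]
      exact (Function.HasTemperateGrowth.const _).add (ContinuousLinearMap.hasTemperateGrowth _))
    (AntilipschitzWith.of_le_mul_dist fun s t => by simp [Prod.dist_eq]) v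

@[simp] lemma vslice_apply (v : 𝓢(Z × ℝ, ℂ)) (z : Z) (t : ℝ) : vslice v z t = v (z, t) := rfl

lemma pft_eq_fourier (v : 𝓢(Z × ℝ, ℂ)) (z : Z) (l : ℝ) :
    pft v z l = FourierTransform.fourier (vslice v z) l := by
  rw [fourier_coe, Real.fourier_real_eq_integral_exp_smul]
  refine integral_congr_ae (Filter.Eventually.of_forall fun t => ?_)
  simp only [vslice_apply, smul_eq_mul, unitPhase]
  congr 3; push_cast; ring

lemma integral_norm_sq_pft (v : 𝓢(Z × ℝ, ℂ)) (z : Z) :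
    ∫ l, ‖pft v z l‖ ^ 2 = ∫ t, ‖v (z, t)‖ ^ 2 := by
  simp_rw [pft_eq_fourier]
  exact integral_norm_sq_fourier (vslice v z)

lemma integral_pft_mul_conj (v w : 𝓢(Z × ℝ, ℂ)) (z : Z) :
    ∫ l, pft v z l * conj (pft w z l) = ∫ t, v (z, t) * conj (w (z, t)) := by
  simp_rw [pft_eq_fourier]
  simpa [mul_comm] using integral_inner_fourier_fourier (vslice w z) (vslice v z)

lemma integrable_pft_integrand (v : 𝓢(Z × ℝ, ℂ)) (z : Z) (l : ℝ) :
    Integrable (fun t => unitPhase (-(t * l)) * v (z, t)) :=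
  (vslice v z).integrable.bdd_mul (c := 1) (by fun_prop) (by simp)

lemma pft_add (v w : 𝓢(Z × ℝ, ℂ)) (z : Z) (l : ℝ) : pft (v + w) z l = pft v z l + pft w z l := by
  unfold pft
  rw [← integral_add (integrable_pft_integrand v z l) (integrable_pft_integrand w z l)]
  simp [mul_add]

lemma pft_smul (c : ℂ) (v : 𝓢(Z × ℝ, ℂ)) (z : Z) (l : ℝ) : pft (c • v) z l = c * pft v z l := by
  unfold pft
  rw [← integral_const_mul]
  refine integral_congr_ae (Filter.Eventually.of_forall fun t => ?_)
  simp; ring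

lemma pft_mulZ (c : Z →L[ℝ] ℝ) (v : 𝓢(Z × ℝ, ℂ)) (z : Z) (l : ℝ) :
    pft (mulZ c v) z l = c z * pft v z l := by
  unfold pft
  rw [← integral_const_mul]
  refine integral_congr_ae (Filter.Eventually.of_forall fun t => ?_)
  simp; ring

lemma pft_vT (v : 𝓢(Z × ℝ, ℂ)) (z : Z) (l : ℝ) :
    pft (vT v) z l = 2 * Real.pi * Complex.I * l * pft v z l := by
  have h : ∀ t, HasDerivAt (vslice v z) (vslice (vT v) z t) t := by
    intro t
    have h1 : HasDerivAt (fun t : ℝ => (z, t)) ((0 : Z), (1 : ℝ)) t :=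
      (hasDerivAt_const t z).prodMk (hasDerivAt_id t)
    have := (v.hasFDerivAt (z, t)).comp_hasDerivAt t h1
    rw [vslice_apply, vT_apply]
    exact this
  have hd : deriv (vslice v z) = vslice (vT v) z := funext fun t => (h t).deriv
  rw [pft_eq_fourier, pft_eq_fourier, fourier_coe, ← hd,
    Real.fourier_deriv (vslice v z).integrable (fun t => (h t).differentiableAt)
      (hd ▸ (vslice (vT v) z).integrable)]
  simp [fourier_coe]

lemma pft_bound (v : 𝓢(Z × ℝ, ℂ)) (N : ℕ) :
    ∃ C, 0 ≤ C ∧ ∀ z l, ‖pft v z l‖ ≤ C * ((1 + ‖z‖) ^ N)⁻¹ := by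
  obtain ⟨C, h0, hC⟩ := v.exists_decay N
  refine ⟨C * Real.pi, by positivity, fun z l => ?_⟩
  have h := norm_integral_le_of_norm_le (integrable_inv_one_add_sq.const_mul (C * ((1 + ‖z‖) ^ N)⁻¹))
    (f := fun t => unitPhase (-(t * l)) * v (z, t))
    (Filter.Eventually.of_forall fun t => by simpa using hC z t)
  rw [integral_const_mul, integral_univ_inv_one_add_sq] at h
  calc _ ≤ _ := h
    _ = _ := by ring

lemma pft_decay (v : 𝓢(Z × ℝ, ℂ)) (N K : ℕ) :
    ∃ C, 0 ≤ C ∧ ∀ z l, ‖pft v z l‖ ≤ C * ((1 + ‖z‖) ^ N)⁻¹ * ((1 + |l|) ^ K)⁻¹ := by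
  induction K generalizing v with
  | zero => simpa using pft_bound v N
  | succ K ih =>
    obtain ⟨C1, h1, hC1⟩ := ih v
    obtain ⟨C2, h2, hC2⟩ := ih (vT v)
    refine ⟨C1 + C2, by positivity, fun z l => ?_⟩
    have e : ‖pft (vT v) z l‖ = 2 * Real.pi * |l| * ‖pft v z l‖ := by
      rw [pft_vT]; simp [abs_of_pos Real.pi_pos]
    have h3 := hC2 z l
    rw [e] at h3
    have h4 : |l| * ‖pft v z l‖ ≤ C2 * ((1 + ‖z‖) ^ N)⁻¹ * ((1 + |l|) ^ K)⁻¹ := by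
      refine le_trans ?_ h3
      have : (1 : ℝ) ≤ 2 * Real.pi := by linarith [Real.pi_gt_three]
      nlinarith [mul_nonneg (abs_nonneg l) (norm_nonneg (pft v z l))]
    have h5 : (1 + |l|) * ‖pft v z l‖ ≤
        (C1 + C2) * ((1 + ‖z‖) ^ N)⁻¹ * ((1 + |l|) ^ K)⁻¹ := by
      have := hC1 z l
      calc _ = ‖pft v z l‖ + |l| * ‖pft v z l‖ := by ring
        _ ≤ _ := add_le_add this h4
        _ = _ := by ring
    have h6 : (0 : ℝ) < 1 + |l| := by positivity
    rw [pow_succ, mul_inv, ← mul_assoc, ← div_eq_mul_inv _ (1 + |l|), le_div_iff₀ h6, mul_comm]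
    exact h5

lemma hasFDerivAt_pft (v : 𝓢(Z × ℝ, ℂ)) (q : Z × ℝ) :
    ∃ L : Z × ℝ →L[ℝ] ℂ, HasFDerivAt (fun q : Z × ℝ => pft v q.1 q.2) L q ∧
      ∀ m, L m = pft (∂_{(m.1, (0 : ℝ))} v) q.1 q.2 +
        m.2 * pft ((-(2 * Real.pi * Complex.I)) • mulT v) q.1 q.2 := by
  obtain ⟨C1, h1, hC1⟩ := (fderivCLM ℝ (Z × ℝ) ℂ v).exists_decay_real
  obtain ⟨C2, h2, hC2⟩ := (mulT v).exists_decay_real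
  let F' : Z × ℝ → ℝ → Z × ℝ →L[ℝ] ℂ := fun q t =>
    unitPhase (-(t * q.2)) • (fderiv ℝ v (q.1, t)).comp
      ((ContinuousLinearMap.inl ℝ Z ℝ).comp (ContinuousLinearMap.fst ℝ Z ℝ)) +
    (v (q.1, t)) • ((ContinuousLinearMap.snd ℝ Z ℝ).smulRight
      ((-t : ℂ) * (2 * Real.pi * Complex.I * unitPhase (-(t * q.2)))))
  have hF' : ∀ q t, HasFDerivAt (fun q : Z × ℝ => unitPhase (-(t * q.2)) * v (q.1, t)) (F' q t) q := by
    intro q t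
    have hv : HasFDerivAt (fun q : Z × ℝ => v (q.1, t)) ((fderiv ℝ v (q.1, t)).comp
      ((ContinuousLinearMap.inl ℝ Z ℝ).comp (ContinuousLinearMap.fst ℝ Z ℝ))) q := by
      have h0 : HasFDerivAt (fun q : Z × ℝ => (q.1, t))
          ((ContinuousLinearMap.inl ℝ Z ℝ).comp (ContinuousLinearMap.fst ℝ Z ℝ)) q :=
        ((hasFDerivAt_fst (𝕜 := ℝ) (p := q)).prodMk (hasFDerivAt_const t q)).congr_fderiv
          (by ext <;> simp)
      exact HasFDerivAt.comp q (v.hasFDerivAt (q.1, t)) h0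
    have hp : HasFDerivAt (fun q : Z × ℝ => unitPhase (-(t * q.2)))
        ((ContinuousLinearMap.snd ℝ Z ℝ).smulRight
          ((-t : ℂ) * (2 * Real.pi * Complex.I * unitPhase (-(t * q.2))))) q := by
      have a : HasDerivAt (fun l : ℝ => unitPhase (-(t * l)))
          ((-t : ℂ) * (2 * Real.pi * Complex.I * unitPhase (-(t * q.2)))) q.2 := by
        have h0 : HasDerivAt (fun l : ℝ => -(t * l)) (-t) q.2 := by
          simpa using ((hasDerivAt_id q.2).const_mul t).fun_neg
        have := (hasDerivAt_unitPhase (-(t * q.2))).scomp q.2 h0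
        exact this.congr_deriv (by simp)
      have := a.hasFDerivAt.comp q (hasFDerivAt_snd (𝕜 := ℝ) (p := q))
      exact this.congr_fderiv (by ext <;> simp)
    exact hp.fun_mul hv
  have hb : ∀ q t, ‖F' q t‖ ≤ (C1 + 2 * Real.pi * C2) * (1 + t ^ 2)⁻¹ := by
    intro q t
    refine (norm_add_le _ _).trans ?_
    rw [add_mul]
    refine add_le_add ?_ ?_
    · rw [norm_smul, norm_unitPhase, one_mul]
      refine le_trans ?_ (hC1 q.1 t)
      rw [fderivCLM_apply]
      refine ContinuousLinearMap.opNorm_le_bound _ (norm_nonneg _) fun m => ?_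
      refine ((fderiv ℝ v (q.1, t)).le_opNorm _).trans ?_
      gcongr
      simp [Prod.norm_def]
    · have h3 := hC2 q.1 t
      rw [mulT_apply] at h3
      rw [norm_smul, ContinuousLinearMap.norm_smulRight_apply]
      have h4 : ‖ContinuousLinearMap.snd ℝ Z ℝ‖ ≤ 1 := ContinuousLinearMap.norm_snd_le ..
      have h5 : ‖(-t : ℂ) * (2 * Real.pi * Complex.I * unitPhase (-(t * q.2)))‖ =
          2 * Real.pi * |t| := by simp [abs_of_pos Real.pi_pos]; ring
      rw [h5]
      rw [norm_mul, Complex.norm_real, Real.norm_eq_abs] at h3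
      calc ‖v (q.1, t)‖ * (‖ContinuousLinearMap.snd ℝ Z ℝ‖ * (2 * Real.pi * |t|))
          ≤ ‖v (q.1, t)‖ * (1 * (2 * Real.pi * |t|)) := by gcongr
        _ = 2 * Real.pi * (|t| * ‖v (q.1, t)‖) := by ring
        _ ≤ 2 * Real.pi * (C2 * (1 + t ^ 2)⁻¹) := by gcongr
        _ = _ := by ring
  have hcont : Continuous fun t => F' q t := by
    have : Continuous (fun p => fderiv ℝ v p) := (fderivCLM ℝ (Z × ℝ) ℂ v).continuous
    have : Continuous (fun t : ℝ => fderiv ℝ v (q.1, t)) := this.comp (by fun_prop)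
    have hv := v.continuous
    have c1 : Continuous fun t : ℝ => unitPhase (-(t * q.2)) := by fun_prop
    have c2 : Continuous fun t : ℝ => v (q.1, t) := hv.comp (by fun_prop)
    have c3 : Continuous fun t : ℝ => (ContinuousLinearMap.snd ℝ Z ℝ).smulRight
        ((-t : ℂ) * (2 * Real.pi * Complex.I * unitPhase (-(t * q.2)))) :=
      ((ContinuousLinearMap.smulRightL ℝ (Z × ℝ) ℂ
        (ContinuousLinearMap.snd ℝ Z ℝ)).continuous).comp (by fun_prop)
    exact (c1.smul (this.clm_comp continuous_const)).add (c2.smul c3)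
  have hi : Integrable (fun t => F' q t) :=
    (integrable_inv_one_add_sq.const_mul _).mono' hcont.aestronglyMeasurable
      (Filter.Eventually.of_forall fun t => hb q t)
  refine ⟨∫ t, F' q t, ?_, fun m => ?_⟩
  · exact hasFDerivAt_integral_of_dominated_of_fderiv_le (s := Set.univ) Filter.univ_mem
      (Filter.Eventually.of_forall fun q => (integrable_pft_integrand v q.1 q.2).aestronglyMeasurable)
      (integrable_pft_integrand v q.1 q.2) hcont.aestronglyMeasurable
      (Filter.Eventually.of_forall fun t q _ => hb q t)
      (integrable_inv_one_add_sq.const_mul _)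
      (Filter.Eventually.of_forall fun t q _ => hF' q t)
  · rw [ContinuousLinearMap.integral_apply hi]
    unfold pft
    rw [← integral_const_mul, ← integral_add (integrable_pft_integrand _ _ _)
      ((integrable_pft_integrand _ _ _).const_mul _)]
    refine integral_congr_ae (Filter.Eventually.of_forall fun t => ?_)
    simp [F', lineDerivOp_apply_eq_fderiv]
    ring

lemma continuous_pft (v : 𝓢(Z × ℝ, ℂ)) : Continuous (fun q : Z × ℝ => pft v q.1 q.2) :=
  continuous_iff_continuousAt.2 fun q => by
    obtain ⟨L, hL, -⟩ := hasFDerivAt_pft v q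
    exact hL.continuousAt

end PartialFourier

section Scaled

variable {Z : Type*} [NormedAddCommGroup Z] [NormedSpace ℝ Z]

/-- A continuous family of functions, rapidly decaying in both variables on `[δ, ∞) × Z`. -/
structure RapidFamily (δ : ℝ) (g : ℝ → Z → ℂ) : Prop where
  cont : Continuous (fun q : ℝ × Z => g q.1 q.2)
  decay : ∀ N K : ℕ, ∃ C, 0 ≤ C ∧ ∀ l, δ ≤ l → ∀ z,
    ‖g l z‖ ≤ C * ((1 + ‖z‖) ^ N)⁻¹ * ((1 + l) ^ K)⁻¹

/-- A continuous rapidly decaying function. -/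
structure RapidFun (f : Z → ℂ) : Prop where
  cont : Continuous f
  decay : ∀ N : ℕ, ∃ C, 0 ≤ C ∧ ∀ z, ‖f z‖ ≤ C * ((1 + ‖z‖) ^ N)⁻¹

/-- `F` is the twisted derivative `∂_ξ f + 4πi ω(ξ, ·) f` of `f`. -/
def TwistedDeriv (ω : Z →L[ℝ] Z →L[ℝ] ℝ) (ξ : Z) (f F : Z → ℂ) : Prop :=
  ∀ z, HasLineDerivAt ℝ f (F z - 4 * Real.pi * Complex.I * ω ξ z * f z) z ξ

/-- The square root of the frequency, clamped from below. -/
def rtc (δ l : ℝ) : ℝ := √(max δ l)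

lemma rtc_pos {δ : ℝ} (hδ : 0 < δ) (l : ℝ) : 0 < rtc δ l :=
  Real.sqrt_pos.2 (lt_max_of_lt_left hδ)

lemma rtc_sq {δ : ℝ} (hδ : 0 < δ) (l : ℝ) : rtc δ l ^ 2 = max δ l :=
  Real.sq_sqrt (hδ.le.trans (le_max_left _ _))

lemma rtc_sq_of_le {δ l : ℝ} (hδ : 0 < δ) (hl : δ ≤ l) : rtc δ l ^ 2 = l := by
  rw [rtc_sq hδ, max_eq_right hl]

@[fun_prop] lemma continuous_rtc (δ : ℝ) : Continuous (rtc δ) := by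
  unfold rtc; fun_prop

lemma rtc_le {δ l : ℝ} (hδ : 0 < δ) (hl : δ ≤ l) : rtc δ l ≤ 1 + l := by
  nlinarith [rtc_sq_of_le hδ hl, rtc_pos hδ l, sq_nonneg (rtc δ l - 1)]

lemma RapidFamily.mul_real {δ : ℝ} (hδ : 0 < δ) {g : ℝ → Z → ℂ} (hg : RapidFamily δ g)
    {k : ℝ → ℝ} (hk : Continuous k) {c : ℝ} (hc : 0 ≤ c) (hb : ∀ l, δ ≤ l → |k l| ≤ c * (1 + l)) :
    RapidFamily δ (fun l z => (k l : ℂ) * g l z) := by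
  refine ⟨?_, fun N K => ?_⟩
  · have := hg.cont
    fun_prop
  · obtain ⟨C, h0, hC⟩ := hg.decay N (K + 1)
    refine ⟨c * C, by positivity, fun l hl z => ?_⟩
    have hl0 : 0 < 1 + l := by linarith
    rw [norm_mul, Complex.norm_real, Real.norm_eq_abs]
    calc |k l| * ‖g l z‖ ≤ (c * (1 + l)) * (C * ((1 + ‖z‖) ^ N)⁻¹ * ((1 + l) ^ (K + 1))⁻¹) :=
          mul_le_mul (hb l hl) (hC l hl z) (norm_nonneg _) (by positivity)
      _ = _ := by field_simp; ring

lemma RapidFamily.rtc_mul {δ : ℝ} (hδ : 0 < δ) {g : ℝ → Z → ℂ} (hg : RapidFamily δ g) :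
    RapidFamily δ (fun l z => (rtc δ l : ℂ) * g l z) :=
  hg.mul_real hδ (continuous_rtc δ) zero_le_one fun l hl => by
    rw [abs_of_pos (rtc_pos hδ l), one_mul]; exact rtc_le hδ hl

lemma abs_rtc_inv_le {δ l : ℝ} (hδ : 0 < δ) : |(rtc δ l)⁻¹| ≤ (√δ)⁻¹ := by
  have h := rtc_pos hδ l
  rw [abs_of_pos (inv_pos.2 h)]
  exact inv_anti₀ (Real.sqrt_pos.2 hδ) (Real.sqrt_le_sqrt (le_max_left _ _))

lemma RapidFamily.rtc_inv_mul {δ : ℝ} (hδ : 0 < δ) {g : ℝ → Z → ℂ} (hg : RapidFamily δ g) :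
    RapidFamily δ (fun l z => ((rtc δ l)⁻¹ : ℂ) * g l z) := by
  have := hg.mul_real hδ (k := fun l => (rtc δ l)⁻¹)
    ((continuous_rtc δ).inv₀ fun l => (rtc_pos hδ l).ne') (c := (√δ)⁻¹) (by positivity)
    fun l hl => (abs_rtc_inv_le hδ).trans
      (le_mul_of_one_le_right (by positivity) (by linarith))
  simpa using this

/-- The partial Fourier transform, with the horizontal variable rescaled by the frequency. -/
def til (δ : ℝ) (v : 𝓢(Z × ℝ, ℂ)) (l : ℝ) (z : Z) : ℂ :=
  pft v ((rtc δ l)⁻¹ • z) (max δ l)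

lemma til_add (δ : ℝ) (v w : 𝓢(Z × ℝ, ℂ)) (l : ℝ) (z : Z) :
    til δ (v + w) l z = til δ v l z + til δ w l z := pft_add _ _ _ _

lemma til_smul (δ : ℝ) (c : ℂ) (v : 𝓢(Z × ℝ, ℂ)) (l : ℝ) (z : Z) :
    til δ (c • v) l z = c * til δ v l z := pft_smul _ _ _ _

lemma til_sum (δ : ℝ) {ι : Type*} (s : Finset ι) (v : ι → 𝓢(Z × ℝ, ℂ)) (l : ℝ) (z : Z) :
    til δ (∑ i ∈ s, v i) l z = ∑ i ∈ s, til δ (v i) l z := by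
  classical
  induction s using Finset.induction_on with
  | empty => simpa using til_smul δ 0 (0 : 𝓢(Z × ℝ, ℂ)) l z
  | insert a s ha ih => rw [Finset.sum_insert ha, Finset.sum_insert ha, til_add, ih]

lemma til_vT (δ : ℝ) (v : 𝓢(Z × ℝ, ℂ)) (l : ℝ) (z : Z) :
    til δ (vT v) l z = 2 * Real.pi * Complex.I * (max δ l : ℝ) * til δ v l z := pft_vT _ _ _

lemma continuous_til {δ : ℝ} (hδ : 0 < δ) (v : 𝓢(Z × ℝ, ℂ)) :
    Continuous (fun q : ℝ × Z => til δ v q.1 q.2) := by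
  have h : Continuous fun q : ℝ × Z => (rtc δ q.1)⁻¹ :=
    ((continuous_rtc δ).comp continuous_fst).inv₀ fun q => (rtc_pos hδ q.1).ne'
  exact (continuous_pft v).comp
    (f := fun q : ℝ × Z => ((rtc δ q.1)⁻¹ • q.2, max δ q.1)) (by fun_prop)

lemma rapidFamily_til {δ : ℝ} (hδ : 0 < δ) (v : 𝓢(Z × ℝ, ℂ)) : RapidFamily δ (til δ v) := by
  refine ⟨continuous_til hδ v, fun N K => ?_⟩
  obtain ⟨C, h0, hC⟩ := pft_decay v N (K + N)
  refine ⟨C, h0, fun l hl z => ?_⟩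
  have hl0 : 0 < l := hδ.trans_le hl
  have h := hC ((rtc δ l)⁻¹ • z) (max δ l)
  rw [max_eq_right hl, abs_of_pos hl0] at h
  rw [til, max_eq_right hl]
  refine h.trans ?_
  rw [mul_assoc, mul_assoc]
  refine mul_le_mul_of_nonneg_left ?_ h0
  have hs := rtc_pos hδ l
  set w := ‖(rtc δ l)⁻¹ • z‖ with hw
  have hz : ‖z‖ = rtc δ l * w := by
    rw [hw, norm_smul, norm_inv, Real.norm_eq_abs, abs_of_pos hs]; field_simp
  have hw0 : 0 ≤ w := norm_nonneg _
  have h1 : 1 + ‖z‖ ≤ (1 + w) * (1 + l) := by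
    rw [hz]; nlinarith [mul_le_mul_of_nonneg_right (rtc_le hδ hl) hw0]
  rw [← mul_inv, ← mul_inv]
  refine inv_anti₀ (by positivity) ?_
  calc (1 + ‖z‖) ^ N * (1 + l) ^ K ≤ ((1 + w) * (1 + l)) ^ N * (1 + l) ^ K := by gcongr
    _ = _ := by rw [mul_pow]; ring

lemma twistedDeriv_til {δ : ℝ} (hδ : 0 < δ) (ω : Z →L[ℝ] Z →L[ℝ] ℝ) (ξ : Z)
    (v : 𝓢(Z × ℝ, ℂ)) (l : ℝ) :
    TwistedDeriv ω ξ (til δ v l) (fun z => ((rtc δ l)⁻¹ : ℂ) * til δ (hX ω ξ v) l z) := by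
  intro z
  obtain ⟨L, hL, hLm⟩ := hasFDerivAt_pft v ((rtc δ l)⁻¹ • z, max δ l)
  set s := rtc δ l with hs
  have hs0 : (s : ℂ) ≠ 0 := by exact_mod_cast (rtc_pos hδ l).ne'
  have hs2 : ((max δ l : ℝ) : ℂ) = (s : ℂ) ^ 2 := by rw [hs, ← rtc_sq hδ]; push_cast; rfl
  have hc : HasDerivAt (fun t : ℝ => ((s⁻¹ • (z + t • ξ), max δ l) : Z × ℝ)) (s⁻¹ • ξ, 0) 0 := by
    refine HasDerivAt.prodMk ?_ (hasDerivAt_const _ _)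
    have := (((hasDerivAt_id (0 : ℝ)).smul_const ξ).const_add z).fun_const_smul s⁻¹
    exact this.congr_deriv (by simp)
  have hL' : HasFDerivAt (fun q : Z × ℝ => pft v q.1 q.2) L
      (s⁻¹ • (z + (0 : ℝ) • ξ), max δ l) := by simpa using hL
  have := hL'.comp_hasDerivAt (0 : ℝ) hc
  refine HasDerivAt.congr_deriv (f := fun t : ℝ => til δ v l (z + t • ξ)) this ?_
  rw [hLm]
  have e1 : hX ω ξ v = ∂_{(ξ, (0 : ℝ))} v + (2 : ℂ) • mulZ (ω ξ) (vT v) := rfl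
  have e2 : (∂_{((s⁻¹ • ξ, (0 : ℝ)) : Z × ℝ)} v) = ((s⁻¹ : ℝ) : ℂ) • ∂_{(ξ, (0 : ℝ))} v := by
    ext p
    have : ((s⁻¹ • ξ, (0 : ℝ)) : Z × ℝ) = s⁻¹ • (ξ, (0 : ℝ)) := by simp
    rw [lineDerivOp_apply_eq_fderiv, this, map_smul, smul_apply, lineDerivOp_apply_eq_fderiv]
    simp
  simp only [e2, e1, til_add, til_smul, pft_smul]
  unfold til
  rw [pft_mulZ, pft_vT, map_smul, ← hs, hs2, smul_eq_mul]
  push_cast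
  field_simp
  ring

end Scaled

section Dilation

variable {Z : Type*} [NormedAddCommGroup Z] [NormedSpace ℝ Z] [FiniteDimensional ℝ Z]
  {ι : Type*} [Fintype ι]

/-- Coordinates as continuous linear forms. -/
def crd (b : Module.Basis ι ℝ Z) (i : ι) : Z →L[ℝ] ℝ := LinearMap.toContinuousLinearMap (b.coord i)

lemma crd_self (b : Module.Basis ι ℝ Z) (i : ι) : crd b i (b i) = 1 := by
  simp [crd]

lemma sum_crd_smul (b : Module.Basis ι ℝ Z) (z : Z) : ∑ i, crd b i z • b i = z := by
  simp [crd, b.sum_repr]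

/-- The divergence form `∑ X_i (z_i Φ)`. -/
def hDiv (ω : Z →L[ℝ] Z →L[ℝ] ℝ) (b : Module.Basis ι ℝ Z) (v : 𝓢(Z × ℝ, ℂ)) : 𝓢(Z × ℝ, ℂ) :=
  ∑ i, hX ω (b i) (mulZ (crd b i) v)

lemma hDiv_apply (ω : Z →L[ℝ] Z →L[ℝ] ℝ) (hω : ∀ ξ η, ω ξ η = -ω η ξ)
    (b : Module.Basis ι ℝ Z) (v : 𝓢(Z × ℝ, ℂ)) (p : Z × ℝ) :
    hDiv ω b v p = Fintype.card ι * v p + fderiv ℝ v p (p.1, 0) := by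
  have h0 : ω p.1 p.1 = 0 := by linarith [hω p.1 p.1]
  have h1 : ((p.1, 0) : Z × ℝ) = ∑ i, crd b i p.1 • (b i, 2 * ω (b i) p.1) := by
    have a : ∑ i, crd b i p.1 * ω (b i) p.1 = 0 := by
      have := congrArg (fun w => ω w p.1) (sum_crd_smul b p.1)
      simpa [h0] using this
    ext1
    · simp [Prod.fst_sum, sum_crd_smul]
    · simp only [Prod.snd_sum, Prod.smul_snd, smul_eq_mul]
      rw [← mul_zero 2, ← a, Finset.mul_sum]
      exact Finset.sum_congr rfl fun i _ => by ring
  rw [h1, map_sum, hDiv, sum_apply]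
  simp_rw [hX_mulZ, crd_self, map_smul]
  rw [Finset.sum_add_distrib]
  simp [hX_apply]

lemma hasDerivAt_til {δ l : ℝ} (hδ : 0 < δ) (hl : δ < l) (ω : Z →L[ℝ] Z →L[ℝ] ℝ)
    (hω : ∀ ξ η, ω ξ η = -ω η ξ) (b : Module.Basis ι ℝ Z) (v : 𝓢(Z × ℝ, ℂ)) (z : Z) :
    HasDerivAt (fun l => til δ v l z)
      (til δ ((-(2 * Real.pi * Complex.I)) • mulT v) l z -
        (2 * l : ℂ)⁻¹ * (til δ (hDiv ω b v) l z - Fintype.card ι * til δ v l z)) l := by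
  have hl0 : 0 < l := hδ.trans hl
  have hm : max δ l = l := max_eq_right hl.le
  have hr : rtc δ l = √l := by rw [rtc, hm]
  obtain ⟨L, hL, hLm⟩ := hasFDerivAt_pft v ((√l)⁻¹ • z, l)
  have hs0 : √l ≠ 0 := (Real.sqrt_pos.2 hl0).ne'
  have hc : HasDerivAt (fun l : ℝ => (((√l)⁻¹ • z, l) : Z × ℝ)) ((-(2 * l)⁻¹) • (√l)⁻¹ • z, 1) l := by
    refine HasDerivAt.prodMk ?_ (hasDerivAt_id _)
    have := ((Real.hasDerivAt_sqrt hl0.ne').fun_inv hs0).smul_const z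
    refine this.congr_deriv ?_
    rw [smul_smul]
    congr 1
    rw [Real.sq_sqrt hl0.le]
    field_simp
  have hev : (fun l => til δ v l z) =ᶠ[nhds l] fun l => pft v ((√l)⁻¹ • z) l := by
    filter_upwards [lt_mem_nhds hl] with a ha
    rw [til, rtc, max_eq_right ha.le]
  have := HasFDerivAt.comp_hasDerivAt (f := fun l : ℝ => (((√l)⁻¹ • z, l) : Z × ℝ)) l hL hc
  refine (this.congr_deriv ?_).congr_of_eventuallyEq hev
  rw [hLm]
  unfold til
  rw [hm, hr]
  set w := (√l)⁻¹ • z with hw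
  have e1 : pft (∂_{(((-(2 * l)⁻¹) • w, (0 : ℝ)) : Z × ℝ)} v) w l =
      -(2 * l : ℂ)⁻¹ * (pft (hDiv ω b v) w l - Fintype.card ι * pft v w l) := by
    unfold pft
    rw [← integral_const_mul, ← integral_sub (integrable_pft_integrand _ _ _)
      ((integrable_pft_integrand _ _ _).const_mul _), ← integral_const_mul]
    refine integral_congr_ae (Filter.Eventually.of_forall fun t => ?_)
    have : (((-(2 * l)⁻¹) • w, (0 : ℝ)) : Z × ℝ) = (-(2 * l)⁻¹) • (w, (0 : ℝ)) := by simp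
    simp only
    rw [lineDerivOp_apply_eq_fderiv, this, map_smul, hDiv_apply ω hω]
    simp
    ring
  simp only [e1]
  push_cast
  ring

variable [MeasureSpace Z] [BorelSpace Z] [(volume : Measure Z).IsAddHaarMeasure]

lemma integral_comp_rtc_inv_smul {F : Type*} [NormedAddCommGroup F] [NormedSpace ℝ F]
    {δ l : ℝ} (hδ : 0 < δ) (hl : δ ≤ l) {d : ℕ} (hZ : Module.finrank ℝ Z = 2 * d) (f : Z → F) :
    ∫ z, f ((rtc δ l)⁻¹ • z) = l ^ d • ∫ z, f z := by
  have hs := rtc_pos hδ l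
  rw [Measure.integral_comp_smul, hZ, inv_pow, inv_inv, pow_mul, rtc_sq_of_le hδ hl,
    abs_of_nonneg (by have := hδ.trans_le hl; positivity)]

lemma integral_til_mul_conj {δ l : ℝ} (hδ : 0 < δ) (hl : δ ≤ l) {d : ℕ}
    (hZ : Module.finrank ℝ Z = 2 * d) (v w : 𝓢(Z × ℝ, ℂ)) :
    ∫ z, til δ v l z * conj (til δ w l z) = (l : ℂ) ^ d * ∫ z, pft v z l * conj (pft w z l) := by
  have := integral_comp_rtc_inv_smul hδ hl hZ (fun z => pft v z l * conj (pft w z l))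
  simp only [til, max_eq_right hl]
  rw [this]
  simp

lemma integral_norm_sq_til {δ l : ℝ} (hδ : 0 < δ) (hl : δ ≤ l) {d : ℕ}
    (hZ : Module.finrank ℝ Z = 2 * d) (v : 𝓢(Z × ℝ, ℂ)) :
    ∫ z, ‖til δ v l z‖ ^ 2 = l ^ d * ∫ z, ‖pft v z l‖ ^ 2 := by
  have := integral_comp_rtc_inv_smul hδ hl hZ (fun z => ‖pft v z l‖ ^ 2)
  simp only [til, max_eq_right hl]
  rw [this, smul_eq_mul]

end Dilation

section Oscillatory

lemma hasDerivAt_intervalIntegral_of_continuous {F F' : ℝ → ℝ → ℂ}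
    (hF : ∀ x, Continuous (F x)) (hF' : Continuous (fun q : ℝ × ℝ => F' q.1 q.2))
    (h : ∀ x l, HasDerivAt (fun x => F x l) (F' x l) x) (a b x : ℝ) :
    HasDerivAt (fun x => ∫ l in a..b, F x l) (∫ l in a..b, F' x l) x := by
  have hK : IsCompact (Metric.closedBall x 1 ×ˢ Set.uIcc a b) :=
    (isCompact_closedBall x 1).prod isCompact_uIcc
  obtain ⟨C, hC⟩ := hK.exists_bound_of_continuousOn hF'.continuousOn
  refine (intervalIntegral.hasDerivAt_integral_of_dominated_loc_of_deriv_le (bound := fun _ => C)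
    (Metric.closedBall_mem_nhds x one_pos)
    (Filter.Eventually.of_forall fun y => (hF y).aestronglyMeasurable)
    ((hF x).intervalIntegrable _ _)
    (hF'.comp (Continuous.prodMk_right x)).aestronglyMeasurable
    (Filter.Eventually.of_forall fun l hl y hy => hC (y, l) ⟨hy, Set.uIoc_subset_uIcc hl⟩)
    intervalIntegrable_const
    (Filter.Eventually.of_forall fun l _ y _ => h y l)).2

variable {Z : Type*} [NormedAddCommGroup Z] [NormedSpace ℝ Z]

/-- The truncated oscillatory integral `∫_δ^r exp(2πilt) exp(l - r) g_l(z) dl`. -/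
def osc (δ : ℝ) (g : ℝ → Z → ℂ) (r t : ℝ) (z : Z) : ℂ :=
  ∫ l in δ..r, unitPhase (l * t) * Real.exp (l - r) * g l z

lemma continuous_osc {δ : ℝ} {g : ℝ → Z → ℂ} (hg : Continuous (fun q : ℝ × Z => g q.1 q.2)) :
    Continuous (fun q : ℝ × ℝ × Z => osc δ g q.1 q.2.1 q.2.2) := by
  refine intervalIntegral.continuous_parametric_intervalIntegral_of_continuous
    (f := fun (q : ℝ × ℝ × Z) l => unitPhase (l * q.2.1) * Real.exp (l - q.1) * g l q.2.2) ?_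
    continuous_fst
  have : Continuous fun q : (ℝ × ℝ × Z) × ℝ => g q.2 q.1.2.2 :=
    hg.comp (f := fun q : (ℝ × ℝ × Z) × ℝ => (q.2, q.1.2.2)) (by fun_prop)
  unfold Function.uncurry
  fun_prop

lemma RapidFamily.intervalIntegrable {δ : ℝ} {g : ℝ → Z → ℂ} (hg : RapidFamily δ g)
    (t s : ℝ) (z : Z) (a b : ℝ) :
    IntervalIntegrable (fun l => unitPhase (l * t) * Real.exp (l - s) * g l z) volume a b := by
  have : Continuous fun l => g l z := hg.cont.comp (Continuous.prodMk_left z)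
  exact Continuous.intervalIntegrable (by fun_prop) _ _

lemma exp_mul_one_add_pow_le {l r : ℝ} (hl : 0 ≤ l) (hlr : l ≤ r) (K : ℕ) :
    Real.exp (l - r) * (1 + r) ^ K ≤ (K.factorial * Real.exp 1) * (1 + l) ^ K := by
  have h1 : (1 + r) ^ K ≤ (1 + l) ^ K * (1 + (r - l)) ^ K := by
    rw [← mul_pow]
    exact pow_le_pow_left₀ (by linarith) (by nlinarith [mul_nonneg hl (sub_nonneg.2 hlr)]) _
  have h2 : (1 + (r - l)) ^ K ≤ K.factorial * Real.exp (1 + (r - l)) := by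
    have := Real.pow_div_factorial_le_exp (1 + (r - l)) (by linarith) K
    rwa [div_le_iff₀ (by positivity), mul_comm] at this
  calc Real.exp (l - r) * (1 + r) ^ K
      ≤ Real.exp (l - r) * ((1 + l) ^ K * (K.factorial * Real.exp (1 + (r - l)))) := by
        gcongr; exact h1.trans (by gcongr)
    _ = (Real.exp (l - r) * Real.exp (r - l)) * ((K.factorial * Real.exp 1) * (1 + l) ^ K) := by
        rw [Real.exp_add]; ring
    _ = _ := by rw [← Real.exp_add]; simp

lemma RapidFamily.exists_osc_decay {δ : ℝ} (hδ : 0 < δ) {g : ℝ → Z → ℂ} (hg : RapidFamily δ g)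
    (N K : ℕ) : ∃ C, 0 ≤ C ∧ ∀ r, δ ≤ r → ∀ t z,
      ‖osc δ g r t z‖ ≤ C * ((1 + ‖z‖) ^ N)⁻¹ * ((1 + r) ^ K)⁻¹ := by
  obtain ⟨C, h0, hC⟩ := hg.decay N (K + 2)
  refine ⟨C * (K.factorial * Real.exp 1) * Real.pi, by positivity, fun r hr t z => ?_⟩
  have hr0 : 0 < 1 + r := by linarith
  set B := C * ((1 + ‖z‖) ^ N)⁻¹ * (K.factorial * Real.exp 1) * ((1 + r) ^ K)⁻¹ with hB
  have hB0 : 0 ≤ B := by positivity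
  have key : ∀ l ∈ Set.Ioc δ r, ‖unitPhase (l * t) * Real.exp (l - r) * g l z‖
      ≤ B * (1 + l ^ 2)⁻¹ := by
    intro l hl
    have hl0 : 0 < l := hδ.trans hl.1
    rw [norm_mul, norm_mul, norm_unitPhase, one_mul, Complex.norm_real, Real.norm_eq_abs,
      abs_of_pos (Real.exp_pos _)]
    have h1 := exp_mul_one_add_pow_le hl0.le hl.2 K
    have h2 : Real.exp (l - r) ≤ (K.factorial * Real.exp 1) * (1 + l) ^ K * ((1 + r) ^ K)⁻¹ := by
      rwa [← div_eq_mul_inv, le_div_iff₀ (by positivity)]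
    calc _ ≤ ((K.factorial * Real.exp 1) * (1 + l) ^ K * ((1 + r) ^ K)⁻¹) *
          (C * ((1 + ‖z‖) ^ N)⁻¹ * ((1 + l) ^ (K + 2))⁻¹) :=
          mul_le_mul h2 (hC l hl.1.le z) (norm_nonneg _) (by positivity)
      _ = B * ((1 + l) ^ 2)⁻¹ := by rw [hB, pow_add]; field_simp
      _ ≤ _ := by
        refine mul_le_mul_of_nonneg_left (inv_anti₀ (by positivity) ?_) hB0
        nlinarith
  have hi : Integrable (fun l : ℝ => B * (1 + l ^ 2)⁻¹) := integrable_inv_one_add_sq.const_mul _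
  have := intervalIntegral.norm_integral_le_of_norm_le hr
    (Filter.Eventually.of_forall key) hi.intervalIntegrable
  refine this.trans ?_
  rw [intervalIntegral.integral_of_le hr]
  refine (setIntegral_le_integral hi (Filter.Eventually.of_forall fun l => by positivity)).trans ?_
  rw [integral_const_mul, integral_univ_inv_one_add_sq, hB]
  apply le_of_eq; ring

lemma RapidFamily.osc {δ : ℝ} (hδ : 0 < δ) {g : ℝ → Z → ℂ} (hg : RapidFamily δ g) (t : ℝ) :
    RapidFamily δ (fun r z => osc δ g r t z) := by
  refine ⟨(continuous_osc hg.cont).comp (f := fun q : ℝ × Z => (q.1, t, q.2)) (by fun_prop),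
    fun N K => ?_⟩
  obtain ⟨C, h0, hC⟩ := hg.exists_osc_decay hδ N K
  exact ⟨C, h0, fun r hr z => hC r hr t z⟩

lemma RapidFamily.rapidFun {δ : ℝ} {g : ℝ → Z → ℂ} (hg : RapidFamily δ g)
    {l : ℝ} (hl : δ ≤ l) : RapidFun (g l) := by
  refine ⟨hg.cont.comp (Continuous.prodMk_right l), fun N => ?_⟩
  obtain ⟨C, h0, hC⟩ := hg.decay N 0
  exact ⟨C, h0, fun z => by simpa using hC l hl z⟩

lemma osc_congr {δ r : ℝ} (hr : δ ≤ r) {g h : ℝ → Z → ℂ} (t : ℝ) (z : Z)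
    (H : ∀ l, δ ≤ l → g l z = h l z) : osc δ g r t z = osc δ h r t z := by
  refine intervalIntegral.integral_congr fun l hl => ?_
  rw [Set.uIcc_of_le hr] at hl
  simp only [H l hl.1]

lemma osc_const_mul {δ r : ℝ} (c : ℂ) (g : ℝ → Z → ℂ) (t : ℝ) (z : Z) :
    osc δ (fun l z => c * g l z) r t z = c * osc δ g r t z := by
  rw [osc, osc, ← intervalIntegral.integral_const_mul]
  congr 1; ext l; ring

lemma osc_add {δ r : ℝ} {g h : ℝ → Z → ℂ} (hg : RapidFamily δ g) (hh : RapidFamily δ h)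
    (t : ℝ) (z : Z) :
    osc δ (fun l z => g l z + h l z) r t z = osc δ g r t z + osc δ h r t z := by
  rw [osc, osc, osc, ← intervalIntegral.integral_add (hg.intervalIntegrable t r z δ r)
    (hh.intervalIntegrable t r z δ r)]
  congr 1; ext l; ring

lemma hasDerivAt_osc_time {δ : ℝ} {g : ℝ → Z → ℂ}
    (hg : Continuous (fun q : ℝ × Z => g q.1 q.2)) (r t : ℝ) (z : Z) :
    HasDerivAt (fun t => osc δ g r t z)
      (2 * Real.pi * Complex.I * osc δ (fun l z => l * g l z) r t z) t := by
  have hgz : Continuous fun l => g l z := hg.comp (Continuous.prodMk_left z)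
  rw [osc, ← intervalIntegral.integral_const_mul]
  refine hasDerivAt_intervalIntegral_of_continuous
    (F := fun t l => unitPhase (l * t) * Real.exp (l - r) * g l z)
    (F' := fun t l => 2 * Real.pi * Complex.I *
      (unitPhase (l * t) * Real.exp (l - r) * (l * g l z)))
    (fun x => by fun_prop) (by fun_prop) (fun x l => ?_) δ r t
  have h1 : HasDerivAt (fun x : ℝ => l * x) l x := by
    simpa using (hasDerivAt_id x).const_mul l
  have := ((hasDerivAt_unitPhase (l * x)).scomp x h1).mul_const (Real.exp (l - r) : ℂ)
    |>.mul_const (g l z)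
  refine this.congr_deriv ?_
  rw [Complex.real_smul]; ring

lemma hasDerivAt_osc_radius {δ : ℝ} {g : ℝ → Z → ℂ}
    (hg : Continuous (fun q : ℝ × Z => g q.1 q.2)) (r t : ℝ) (z : Z) :
    HasDerivAt (fun r => osc δ g r t z) (unitPhase (r * t) * g r z - osc δ g r t z) r := by
  have hgz : Continuous fun l => g l z := hg.comp (Continuous.prodMk_left z)
  have hc : Continuous fun l : ℝ => unitPhase (l * t) * Real.exp l * g l z := by fun_prop
  have e : ∀ r, osc δ g r t z =
      (Real.exp (-r) : ℂ) * ∫ l in δ..r, unitPhase (l * t) * Real.exp l * g l z := by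
    intro r
    rw [osc, ← intervalIntegral.integral_const_mul]
    congr 1; ext l
    rw [sub_eq_add_neg, Real.exp_add]; push_cast; ring
  have h1 := intervalIntegral.integral_hasDerivAt_right (hc.intervalIntegrable δ r)
    (hc.stronglyMeasurableAtFilter _ _) hc.continuousAt
  have h2 : HasDerivAt (fun r : ℝ => (Real.exp (-r) : ℂ)) (-(Real.exp (-r) : ℂ)) r := by
    have := ((hasDerivAt_id r).neg.exp).ofReal_comp
    refine this.congr_deriv ?_
    simp
  have h3 : HasDerivAt (fun r => (Real.exp (-r) : ℂ) *
      ∫ l in δ..r, unitPhase (l * t) * Real.exp l * g l z) _ r := h2.fun_mul h1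
  simp_rw [e]
  refine h3.congr_deriv ?_
  have : (Real.exp (-r) : ℂ) * Real.exp r = 1 := by
    rw [← Complex.ofReal_mul, ← Real.exp_add]; simp
  linear_combination (unitPhase (r * t) * g r z) * this

lemma osc_self (δ : ℝ) (g : ℝ → Z → ℂ) (t : ℝ) (z : Z) : osc δ g δ t z = 0 := by simp [osc]

lemma TwistedDeriv.osc {δ : ℝ} {ω : Z →L[ℝ] Z →L[ℝ] ℝ} {ξ : Z} {f F : ℝ → Z → ℂ}
    (hf : Continuous (fun q : ℝ × Z => f q.1 q.2)) (hF : Continuous (fun q : ℝ × Z => F q.1 q.2))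
    (h : ∀ l, TwistedDeriv ω ξ (f l) (F l)) (r t : ℝ) :
    TwistedDeriv ω ξ (osc δ f r t) (osc δ F r t) := by
  intro z
  have hc : ∀ {g : ℝ → Z → ℂ}, Continuous (fun q : ℝ × Z => g q.1 q.2) →
      Continuous fun q : ℝ × ℝ => g q.2 (z + q.1 • ξ) := fun hg =>
    hg.comp (f := fun q : ℝ × ℝ => (q.2, z + q.1 • ξ)) (by fun_prop)
  have hcf := hc hf
  have hcF := hc hF
  have := hasDerivAt_intervalIntegral_of_continuous
    (F := fun x l => unitPhase (l * t) * Real.exp (l - r) * f l (z + x • ξ))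
    (F' := fun x l => unitPhase (l * t) * Real.exp (l - r) * (F l (z + x • ξ) -
      4 * Real.pi * Complex.I * ω ξ (z + x • ξ) * f l (z + x • ξ)))
    (fun x => by
      have : Continuous fun l => f l (z + x • ξ) := hf.comp (Continuous.prodMk_left _)
      fun_prop) (by fun_prop) (fun x l => ?_) δ r 0
  · refine HasDerivAt.congr_deriv
      (f := fun x : ℝ => _root_.osc δ f r t (z + x • ξ)) this ?_
    simp only [zero_smul, add_zero]
    rw [_root_.osc, _root_.osc, ← intervalIntegral.integral_const_mul,
      ← intervalIntegral.integral_sub]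
    · congr 1; ext l; ring
    · have : Continuous fun l => F l z := hF.comp (Continuous.prodMk_left _)
      exact Continuous.intervalIntegrable (by fun_prop) _ _
    · have : Continuous fun l => f l z := hf.comp (Continuous.prodMk_left _)
      exact Continuous.intervalIntegrable (by fun_prop) _ _
  · have h1 : HasDerivAt (fun y : ℝ => f l (z + x • ξ + y • ξ)) (F l (z + x • ξ) -
        4 * Real.pi * Complex.I * ω ξ (z + x • ξ) * f l (z + x • ξ)) (x - x) := by
      rw [sub_self]; exact h l (z + x • ξ)
    have h2 := h1.comp_sub_const x x
    refine HasDerivAt.const_mul _ (h2.congr_of_eventuallyEq (Filter.Eventually.of_forall ?_))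
    intro y
    simp only [add_assoc, ← add_smul]
    congr 3; ring

end Oscillatory

section RapidFunctions

variable {Z : Type*} [NormedAddCommGroup Z] [NormedSpace ℝ Z] [FiniteDimensional ℝ Z]
  [MeasureSpace Z] [BorelSpace Z] [(volume : Measure Z).IsAddHaarMeasure]

lemma RapidFun.mul_conj {f g : Z → ℂ} (hf : RapidFun f) (hg : RapidFun g) :
    RapidFun (fun z => f z * conj (g z)) := by
  have := hf.cont; have := hg.cont
  refine ⟨by fun_prop, fun N => ?_⟩
  obtain ⟨C, h0, hC⟩ := hf.decay N
  obtain ⟨D, h0', hD⟩ := hg.decay 0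
  refine ⟨C * D, by positivity, fun z => ?_⟩
  have h2 := hD z
  rw [pow_zero, inv_one, mul_one] at h2
  rw [norm_mul, RCLike.norm_conj, mul_right_comm]
  exact mul_le_mul (hC z) h2 (norm_nonneg _) (by positivity)

lemma integrable_one_add_norm_pow_inv :
    Integrable (fun z : Z => ((1 + ‖z‖) ^ (Module.finrank ℝ Z + 1))⁻¹) := by
  have := integrable_one_add_norm (E := Z) (μ := volume) (r := (Module.finrank ℝ Z + 1 : ℕ))
    (by push_cast; linarith)
  refine this.congr (Filter.Eventually.of_forall fun z => ?_)
  simp only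
  rw [Real.rpow_neg (by positivity), Real.rpow_natCast]

lemma RapidFun.integrable {f : Z → ℂ} (hf : RapidFun f) : Integrable f := by
  obtain ⟨C, h0, hC⟩ := hf.decay (Module.finrank ℝ Z + 1)
  exact (integrable_one_add_norm_pow_inv.const_mul C).mono' hf.cont.aestronglyMeasurable
    (Filter.Eventually.of_forall hC)

lemma RapidFun.integrable_norm_sq {f : Z → ℂ} (hf : RapidFun f) :
    Integrable (fun z => ‖f z‖ ^ 2) := by
  refine (hf.mul_conj hf).integrable.norm.congr (Filter.Eventually.of_forall fun z => ?_)
  simp [sq]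

lemma RapidFun.sub {f g : Z → ℂ} (hf : RapidFun f) (hg : RapidFun g) :
    RapidFun (fun z => f z - g z) := by
  have := hf.cont; have := hg.cont
  refine ⟨by fun_prop, fun N => ?_⟩
  obtain ⟨C, h0, hC⟩ := hf.decay N
  obtain ⟨D, h0', hD⟩ := hg.decay N
  refine ⟨C + D, by positivity, fun z => ?_⟩
  rw [add_mul]
  exact (norm_sub_le _ _).trans (add_le_add (hC z) (hD z))

lemma RapidFun.linear_mul {f : Z → ℂ} (hf : RapidFun f) (c : ℂ) (k : Z →L[ℝ] ℝ) :
    RapidFun (fun z => c * k z * f z) := by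
  have := hf.cont
  refine ⟨by fun_prop, fun N => ?_⟩
  obtain ⟨C, h0, hC⟩ := hf.decay (N + 1)
  refine ⟨‖c‖ * ‖k‖ * C, by positivity, fun z => ?_⟩
  have h1 : |k z| ≤ ‖k‖ * (1 + ‖z‖) :=
    (k.le_opNorm z).trans (mul_le_mul_of_nonneg_left (by linarith) (norm_nonneg _))
  rw [norm_mul, norm_mul, Complex.norm_real, Real.norm_eq_abs]
  calc _ ≤ ‖c‖ * (‖k‖ * (1 + ‖z‖)) * (C * ((1 + ‖z‖) ^ (N + 1))⁻¹) := by
        gcongr; exact hC z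
    _ = _ := by field_simp; ring

/-- Twisted derivatives are skew-adjoint. -/
lemma integral_twistedDeriv_mul_conj {ω : Z →L[ℝ] Z →L[ℝ] ℝ} {ξ : Z} {f F h H : Z → ℂ}
    (hf : RapidFun f) (hF : RapidFun F) (hh : RapidFun h) (hH : RapidFun H)
    (h1 : TwistedDeriv ω ξ f F) (h2 : TwistedDeriv ω ξ h H) :
    ∫ z, F z * conj (h z) = -∫ z, f z * conj (H z) := by
  set a : ℂ := 4 * Real.pi * Complex.I with ha
  have hac : conj a = -a := by simp [ha, Complex.conj_ofReal, Complex.conj_ofNat]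
  have hf1 : RapidFun (fun z => a * ω ξ z * f z) := hf.linear_mul a (ω ξ)
  have hh1 : RapidFun (fun z => a * ω ξ z * h z) := hh.linear_mul a (ω ξ)
  have := integral_bilinear_hasLineDerivAt_right_eq_neg_left_of_integrable (μ := volume)
    (B := mulConj) (v := ξ) (f := f) (g := h) (f' := fun z => F z - a * ω ξ z * f z)
    (g' := fun z => H z - a * ω ξ z * h z)
    (((hF.sub hf1).mul_conj hh).integrable) ((hf.mul_conj (hH.sub hh1)).integrable)
    ((hf.mul_conj hh).integrable) (fun z _ => h1 z) (fun z _ => h2 z)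
  simp only [mulConj_apply] at this
  simp only [map_sub, mul_sub, sub_mul] at this
  rw [integral_sub (hf.mul_conj hH).integrable (hf.mul_conj hh1).integrable,
    integral_sub (hF.mul_conj hh).integrable (hf1.mul_conj hh).integrable] at this
  have e : ∫ z, f z * conj (a * ω ξ z * h z) = -∫ z, a * ω ξ z * f z * conj (h z) := by
    rw [← integral_neg]
    congr 1; ext z
    simp only [map_mul, hac, Complex.conj_ofReal]; ring
  rw [e] at this
  linear_combination this

end RapidFunctions

section Plancherel
open scoped FourierTransform

/-- The Fourier integral of an integrable, square integrable function represents its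
`L²`-Fourier transform. -/
lemma fourier_toLp_ae_eq {f : ℝ → ℂ} (hf : Integrable f) (hf2 : MemLp f 2) :
    (𝓕 (hf2.toLp f) : Lp ℂ 2 (volume : Measure ℝ)) =ᵐ[volume] 𝓕 f := by
  have hc : Continuous (𝓕 f) :=
    VectorFourier.fourierIntegral_continuous Real.continuous_fourierChar (by fun_prop) hf
  refine ae_eq_of_integral_contDiff_smul_eq
    ((Lp.memLp _).locallyIntegrable (by norm_num)) hc.locallyIntegrable fun g hg hgc => ?_
  have h2 : HasCompactSupport fun x => (g x : ℂ) := hgc.comp_left (g := ((↑) : ℝ → ℂ)) rfl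
  set φ : 𝓢(ℝ, ℂ) := h2.toSchwartzMap (Complex.ofRealCLM.contDiff.comp hg) with hφ
  have hφa : ∀ x, φ x = g x := fun x => rfl
  have h3 := congrArg (fun T => T φ) (Lp.fourier_toTemperedDistribution_eq (hf2.toLp f))
  simp only [TemperedDistribution.fourier_apply, Lp.toTemperedDistribution_apply] at h3
  have h4 := VectorFourier.integral_fourierIntegral_smul_eq_flip (e := Real.fourierChar)
    (L := innerₗ ℝ) (μ := volume) (ν := volume) (f := (φ : ℝ → ℂ)) (g := f)
    Real.continuous_fourierChar (by fun_prop) φ.integrable hf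
  rw [flip_innerₗ] at h4
  have h5 : ∫ x, (𝓕 φ) x • (hf2.toLp f) x = ∫ x, (𝓕 φ) x • f x := by
    refine integral_congr_ae ?_
    filter_upwards [hf2.coeFn_toLp] with x hx
    rw [hx]
  have h6 : ∫ x, (𝓕 φ) x • f x = ∫ x, φ x • 𝓕 f x := h4
  calc ∫ x, g x • (𝓕 (hf2.toLp f) : Lp ℂ 2 (volume : Measure ℝ)) x
      = ∫ x, φ x • (𝓕 (hf2.toLp f) : Lp ℂ 2 (volume : Measure ℝ)) x := by
        simp [hφa, Complex.real_smul]
    _ = ∫ x, φ x • 𝓕 f x := by rw [← h3, h5, h6]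
    _ = _ := by simp [hφa, Complex.real_smul]

lemma memLp_fourier {f : ℝ → ℂ} (hf : Integrable f) (hf2 : MemLp f 2) : MemLp (𝓕 f) 2 :=
  (memLp_congr_ae (fourier_toLp_ae_eq hf hf2)).1 (Lp.memLp _)

lemma integral_norm_sq_fourier {f : ℝ → ℂ} (hf : Integrable f) (hf2 : MemLp f 2) :
    ∫ t, ‖𝓕 f t‖ ^ 2 = ∫ l, ‖f l‖ ^ 2 := by
  have h1 := Lp.norm_fourier_eq (hf2.toLp f)
  have key : ∀ {g : ℝ → ℂ} (G : Lp ℂ 2 (volume : Measure ℝ)), G =ᵐ[volume] g →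
      ‖G‖ ^ 2 = ∫ t, ‖g t‖ ^ 2 := by
    intro g G hG
    rw [← @inner_self_eq_norm_sq ℂ, L2.inner_def, ← integral_re (L2.integrable_inner G G)]
    refine integral_congr_ae ?_
    filter_upwards [hG] with x hx
    rw [inner_self_eq_norm_sq, hx]
  rw [← key _ (fourier_toLp_ae_eq hf hf2), h1, key _ hf2.coeFn_toLp]

variable {Z : Type*} [NormedAddCommGroup Z]

lemma osc_eq_fourier {δ r : ℝ} (hr : δ ≤ r) (g : ℝ → Z → ℂ) (t : ℝ) (z : Z) :
    osc δ g r t z =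
      𝓕 ((Set.Ioc δ r).indicator fun l => (Real.exp (l - r) : ℂ) * g l z) (-t) := by
  rw [Real.fourier_real_eq, osc, intervalIntegral.integral_of_le hr,
    ← integral_indicator measurableSet_Ioc]
  congr 1; ext l
  by_cases h : l ∈ Set.Ioc δ r
  · simp only [Set.indicator_of_mem h]
    rw [Circle.smul_def, Real.fourierChar_apply, smul_eq_mul, unitPhase, mul_assoc]
    congr 3; push_cast; ring
  · simp [h]

/-- Plancherel's identity for truncated oscillatory integrals. -/
lemma integral_norm_sq_osc {δ r : ℝ} (hr : δ ≤ r) {g : ℝ → Z → ℂ}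
    (hg : Continuous (fun q : ℝ × Z => g q.1 q.2)) (z : Z) :
    Integrable (fun t => ‖osc δ g r t z‖ ^ 2) ∧
    ∫ t, ‖osc δ g r t z‖ ^ 2 = ∫ l in Set.Ioc δ r, Real.exp (2 * (l - r)) * ‖g l z‖ ^ 2 := by
  have hgz : Continuous fun l => g l z := hg.comp (Continuous.prodMk_left z)
  have hc : Continuous fun l : ℝ => (Real.exp (l - r) : ℂ) * g l z := by fun_prop
  set f := (Set.Ioc δ r).indicator fun l => (Real.exp (l - r) : ℂ) * g l z with hf
  have hfin : volume (Set.Ioc δ r) ≠ ⊤ := measure_Ioc_lt_top.ne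
  obtain ⟨C, hC⟩ := isCompact_Icc.exists_bound_of_continuousOn (hc.continuousOn (s := Set.Icc δ r))
  have hf2 : ∀ p : ℝ≥0∞, MemLp f p := fun p => by
    rw [memLp_indicator_iff_restrict measurableSet_Ioc]
    have : IsFiniteMeasure ((volume : Measure ℝ).restrict (Set.Ioc δ r)) :=
      ⟨by rw [Measure.restrict_apply_univ]; exact hfin.lt_top⟩
    exact MemLp.of_bound hc.aestronglyMeasurable C
      ((ae_restrict_iff' measurableSet_Ioc).2 (Filter.Eventually.of_forall
        fun l hl => hC l (Set.Ioc_subset_Icc_self hl)))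
  have hf1 : Integrable f := memLp_one_iff_integrable.1 (hf2 1)
  have h1 := integral_norm_sq_fourier hf1 (hf2 2)
  have h3 : Integrable fun t => ‖𝓕 f t‖ ^ 2 := (memLp_fourier hf1 (hf2 2)).integrable_norm_pow (by norm_num)
  simp_rw [osc_eq_fourier hr, ← hf]
  refine ⟨h3.comp_neg, ?_⟩
  rw [integral_neg_eq_self (fun t => ‖𝓕 f t‖ ^ 2), h1, ← integral_indicator measurableSet_Ioc]
  congr 1; ext l
  by_cases h : l ∈ Set.Ioc δ r
  · simp only [hf, Set.indicator_of_mem h]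
    rw [norm_mul, Complex.norm_real, Real.norm_eq_abs, mul_pow, sq_abs, ← Real.exp_nat_mul]
    push_cast; rfl
  · simp [hf, h]

end Plancherel

section RadialWeight

/-- The radial weight `-½ exp(2 r) d/dr (r^{-d} exp(-2 r))`. -/
def radialWeight (d : ℕ) (r : ℝ) : ℝ := (1 + d / (2 * r)) / r ^ d

lemma radialWeight_nonneg (d : ℕ) {r : ℝ} (hr : 0 < r) : 0 ≤ radialWeight d r := by
  unfold radialWeight; positivity

lemma radialWeight_le {d : ℕ} {δ r : ℝ} (hδ : 0 < δ) (hr : δ ≤ r) :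
    radialWeight d r ≤ radialWeight d δ := by
  unfold radialWeight; gcongr

@[fun_prop] lemma measurable_radialWeight (d : ℕ) : Measurable (radialWeight d) := by
  unfold radialWeight; fun_prop

lemma hasDerivAt_radial (d : ℕ) {r : ℝ} (hr : 0 < r) :
    HasDerivAt (fun r : ℝ => -(2⁻¹ * Real.exp (-(2 * r)) / r ^ d))
      (radialWeight d r * Real.exp (-(2 * r))) r := by
  have h1 : HasDerivAt (fun r : ℝ => 2⁻¹ * Real.exp (-(2 * r))) (-Real.exp (-(2 * r))) r := by
    have := (((hasDerivAt_id r).const_mul 2).fun_neg.exp).const_mul (2⁻¹ : ℝ)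
    refine this.congr_deriv ?_
    simp
    ring
  have h2 := (h1.fun_div (hasDerivAt_pow d r) (by positivity)).fun_neg
  refine h2.congr_deriv ?_
  unfold radialWeight
  rcases d with _ | d
  · simp
  · simp only [Nat.add_sub_cancel]
    field_simp
    ring

lemma lintegral_radialWeight (d : ℕ) {l : ℝ} (hl : 0 < l) :
    ∫⁻ r in Set.Ioi l, ENNReal.ofReal (radialWeight d r * Real.exp (-(2 * r))) =
      ENNReal.ofReal (2⁻¹ * Real.exp (-(2 * l)) / l ^ d) := by
  have hd : ∀ r ∈ Set.Ici l, HasDerivAt (fun r : ℝ => -(2⁻¹ * Real.exp (-(2 * r)) / r ^ d))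
      (radialWeight d r * Real.exp (-(2 * r))) r := fun r hr => hasDerivAt_radial d (hl.trans_le hr)
  have hp : ∀ r ∈ Set.Ioi l, 0 ≤ radialWeight d r * Real.exp (-(2 * r)) := fun r hr =>
    mul_nonneg (radialWeight_nonneg d (hl.trans hr)) (Real.exp_pos _).le
  have ht : Filter.Tendsto (fun r : ℝ => -(2⁻¹ * Real.exp (-(2 * r)) / r ^ d)) Filter.atTop
      (nhds 0) := by
    have h0 : Filter.Tendsto (fun r : ℝ => Real.exp (-(2 * r)) / l ^ d) Filter.atTop (nhds 0) := by
      rw [← zero_div (l ^ d)]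
      refine Filter.Tendsto.div_const ?_ _
      exact Real.tendsto_exp_neg_atTop_nhds_zero.comp
        (Filter.tendsto_id.const_mul_atTop (by norm_num : (0 : ℝ) < 2))
    refine squeeze_zero_norm' ?_ h0
    filter_upwards [Filter.eventually_ge_atTop l] with r hr
    have hr0 := hl.trans_le hr
    rw [norm_neg, Real.norm_eq_abs, abs_of_nonneg (by positivity)]
    gcongr
    linarith [Real.exp_pos (-(2 * r))]
  have h1 := integral_Ioi_of_hasDerivAt_of_nonneg' hd hp ht
  rw [← ofReal_integral_eq_lintegral_ofReal (integrableOn_Ioi_deriv_of_nonneg' hd hp ht)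
    ((ae_restrict_iff' measurableSet_Ioi).2 (Filter.Eventually.of_forall hp)), h1]
  congr 1; ring

lemma lintegral_triangle_radialWeight (d : ℕ) {δ : ℝ} (hδ : 0 < δ) {m : ℝ → ℝ}
    (hm : Continuous m) (h0 : ∀ l, 0 ≤ m l) :
    ∫⁻ r in Set.Ioi δ, ENNReal.ofReal
      (radialWeight d r * ∫ l in Set.Ioc δ r, Real.exp (2 * (l - r)) * m l) =
    ∫⁻ l in Set.Ioi δ, ENNReal.ofReal (2⁻¹ * m l / l ^ d) := by
  set K : ℝ → ℝ → ℝ≥0∞ := fun r l => (Set.Iio r).indicator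
    (fun l => ENNReal.ofReal (radialWeight d r * Real.exp (-(2 * r))) *
      ENNReal.ofReal (Real.exp (2 * l) * m l)) l with hK
  have e1 : ∀ r ∈ Set.Ioi δ, ENNReal.ofReal
      (radialWeight d r * ∫ l in Set.Ioc δ r, Real.exp (2 * (l - r)) * m l) =
      ∫⁻ l in Set.Ioi δ, K r l := by
    intro r hr
    have hr0 : 0 < r := hδ.trans hr
    have hc : Continuous fun l => Real.exp (2 * l) * m l := by fun_prop
    have : radialWeight d r * ∫ l in Set.Ioc δ r, Real.exp (2 * (l - r)) * m l =
        (radialWeight d r * Real.exp (-(2 * r))) * ∫ l in Set.Ioc δ r, Real.exp (2 * l) * m l := by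
      rw [mul_assoc, ← integral_const_mul (Real.exp (-(2 * r)))]
      congr 1
      refine integral_congr_ae (.of_forall fun l => ?_)
      simp only
      rw [← mul_assoc, ← Real.exp_add]; ring_nf
    rw [this, ENNReal.ofReal_mul (mul_nonneg (radialWeight_nonneg d hr0) (Real.exp_pos _).le),
      ofReal_integral_eq_lintegral_ofReal, ← lintegral_const_mul _ (by fun_prop),
      lintegral_indicator measurableSet_Iio, Measure.restrict_restrict measurableSet_Iio]
    · rw [Set.inter_comm, Set.Ioi_inter_Iio]
      exact setLIntegral_congr Ioo_ae_eq_Ioc.symm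
    · exact (hc.integrableOn_Icc).mono_set Set.Ioc_subset_Icc_self
    · exact Filter.Eventually.of_forall fun l => mul_nonneg (Real.exp_pos _).le (h0 l)
  have e2 : ∀ l ∈ Set.Ioi δ, ∫⁻ r in Set.Ioi δ, K r l =
      ENNReal.ofReal (2⁻¹ * m l / l ^ d) := by
    intro l hl
    have hl0 : 0 < l := hδ.trans hl
    have : ∀ r, K r l = (Set.Ioi l).indicator (fun r =>
        ENNReal.ofReal (radialWeight d r * Real.exp (-(2 * r))) *
          ENNReal.ofReal (Real.exp (2 * l) * m l)) r := by
      intro r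
      by_cases h : l < r
      · simp [hK, h]
      · simp [hK, h]
    simp_rw [this]
    rw [lintegral_indicator measurableSet_Ioi, Measure.restrict_restrict measurableSet_Ioi,
      Set.Ioi_inter_Ioi, max_eq_left hl.le, lintegral_mul_const _ (by fun_prop),
      lintegral_radialWeight d hl0, ← ENNReal.ofReal_mul (by positivity)]
    congr 1
    have : Real.exp (-(2 * l)) * Real.exp (2 * l) = 1 := by rw [← Real.exp_add]; simp
    linear_combination (2⁻¹ * m l / l ^ d) * this
  rw [setLIntegral_congr_fun measurableSet_Ioi e1, ← setLIntegral_congr_fun measurableSet_Ioi e2]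
  refine lintegral_lintegral_swap (Measurable.aemeasurable ?_)
  have : (Function.uncurry K) = {q : ℝ × ℝ | q.2 < q.1}.indicator
      (fun q => ENNReal.ofReal (radialWeight d q.1 * Real.exp (-(2 * q.1))) *
        ENNReal.ofReal (Real.exp (2 * q.2) * m q.2)) := by
    ext ⟨r, l⟩
    by_cases h : l < r
    · simp [hK, h, Function.uncurry]
    · simp [hK, h, Function.uncurry]
  rw [this]
  refine Measurable.indicator ?_ (measurableSet_lt measurable_snd measurable_fst)
  have := hm.measurable
  fun_prop

end RadialWeight

section OscOperator

variable {Z : Type*} [NormedAddCommGroup Z] [NormedSpace ℝ Z] [FiniteDimensional ℝ Z]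
  [MeasureSpace Z] [BorelSpace Z] [(volume : Measure Z).IsAddHaarMeasure]

/-- The measure on `(δ, ∞) × (0, ∞) × Z`. -/
def oscMeasure (Z : Type*) [MeasureSpace Z] (δ : ℝ) : Measure (ℝ × ℝ × Z) :=
  (volume.restrict (Set.Ioi δ)).prod ((volume.restrict (Set.Ioi 0)).prod volume)

/-- The weighted sesquilinear density of two oscillatory integrals. -/
def oscPair (d : ℕ) (δ ε : ℝ) (g h : ℝ → Z → ℂ) (p : ℝ × ℝ × Z) : ℂ :=
  (radialWeight d p.1 * Real.exp (-(ε * p.2.1)) : ℝ) *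
    (osc δ g p.1 p.2.1 p.2.2 * conj (osc δ h p.1 p.2.1 p.2.2))

/-- The weighted oscillatory integral. -/
def oscFun (d : ℕ) (δ ε : ℝ) (g : ℝ → Z → ℂ) (p : ℝ × ℝ × Z) : ℂ :=
  (√(radialWeight d p.1) * Real.exp (-(ε * p.2.1) / 2) : ℝ) * osc δ g p.1 p.2.1 p.2.2

lemma ae_oscMeasure (δ : ℝ) : ∀ᵐ p ∂(oscMeasure Z δ), δ < p.1 ∧ 0 < p.2.1 := by
  have h1 := (Measure.quasiMeasurePreserving_fst (μ := (volume : Measure ℝ).restrict (Set.Ioi δ))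
    (ν := ((volume : Measure ℝ).restrict (Set.Ioi 0)).prod (volume : Measure Z))).ae
    (ae_restrict_mem measurableSet_Ioi)
  have h2 := (Measure.quasiMeasurePreserving_snd (μ := (volume : Measure ℝ).restrict (Set.Ioi δ))
    (ν := ((volume : Measure ℝ).restrict (Set.Ioi 0)).prod (volume : Measure Z))).ae
    ((Measure.quasiMeasurePreserving_fst (μ := (volume : Measure ℝ).restrict (Set.Ioi 0))
      (ν := (volume : Measure Z))).ae (ae_restrict_mem measurableSet_Ioi))
  filter_upwards [h1, h2] with p hp1 hp2 using ⟨hp1, hp2⟩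

lemma oscFun_mul_conj {d : ℕ} {δ ε : ℝ} (hδ : 0 < δ) (g h : ℝ → Z → ℂ) {p : ℝ × ℝ × Z}
    (hp : δ < p.1) : oscFun d δ ε g p * conj (oscFun d δ ε h p) = oscPair d δ ε g h p := by
  have h1 := Real.mul_self_sqrt (radialWeight_nonneg d (hδ.trans hp))
  have h2 : Real.exp (-(ε * p.2.1) / 2) * Real.exp (-(ε * p.2.1) / 2) =
      Real.exp (-(ε * p.2.1)) := by rw [← Real.exp_add]; ring_nf
  have h3 : √(radialWeight d p.1) * Real.exp (-(ε * p.2.1) / 2) *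
      (√(radialWeight d p.1) * Real.exp (-(ε * p.2.1) / 2)) =
      radialWeight d p.1 * Real.exp (-(ε * p.2.1)) := by
    rw [mul_mul_mul_comm, h1, h2]
  rw [oscFun, oscFun, oscPair, map_mul, Complex.conj_ofReal, ← h3, mul_mul_mul_comm,
    Complex.ofReal_mul (_ * _) (_ * _)]

lemma measurable_oscPair (d : ℕ) {δ ε : ℝ} {g h : ℝ → Z → ℂ} (hg : RapidFamily δ g)
    (hh : RapidFamily δ h) : Measurable (oscPair d δ ε g h) := by
  have h1 := (continuous_osc (δ := δ) hg.cont).measurable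
  have h2 := (continuous_osc (δ := δ) hh.cont).measurable
  have h3 : Measurable fun p : ℝ × ℝ × Z =>
      conj (osc δ h p.1 p.2.1 p.2.2) := Complex.continuous_conj.measurable.comp h2
  have h4 : Measurable fun p : ℝ × ℝ × Z =>
      ((radialWeight d p.1 * Real.exp (-(ε * p.2.1)) : ℝ) : ℂ) := by fun_prop
  exact h4.mul (h1.mul h3)

lemma measurable_oscFun (d : ℕ) {δ ε : ℝ} {g : ℝ → Z → ℂ} (hg : RapidFamily δ g) :
    Measurable (oscFun d δ ε g) := by
  have h1 := (continuous_osc (δ := δ) hg.cont).measurable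
  have h4 : Measurable fun p : ℝ × ℝ × Z =>
      ((√(radialWeight d p.1) * Real.exp (-(ε * p.2.1) / 2) : ℝ) : ℂ) := by fun_prop
  exact h4.mul h1

lemma integrable_oscPair (d : ℕ) {δ ε : ℝ} (hδ : 0 < δ) (hε : 0 < ε) {g h : ℝ → Z → ℂ}
    (hg : RapidFamily δ g) (hh : RapidFamily δ h) :
    Integrable (oscPair d δ ε g h) (oscMeasure Z δ) := by
  obtain ⟨C, hC0, hC⟩ := hg.exists_osc_decay hδ (Module.finrank ℝ Z + 1) 2
  obtain ⟨D, hD0, hD⟩ := hh.exists_osc_decay hδ 0 0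
  have i1 : Integrable (fun r : ℝ => radialWeight d δ * C * D * (1 + r ^ 2)⁻¹)
      (volume.restrict (Set.Ioi δ)) := (integrable_inv_one_add_sq.const_mul _).restrict
  have i2 : Integrable (fun t : ℝ => Real.exp (-(ε * t))) (volume.restrict (Set.Ioi 0)) := by
    have := exp_neg_integrableOn_Ioi 0 hε
    simp only [neg_mul] at this
    exact this
  have i3 := i1.mul_prod (i2.mul_prod (integrable_one_add_norm_pow_inv (Z := Z)))
  refine i3.mono' (measurable_oscPair d hg hh).aestronglyMeasurable ?_
  filter_upwards [ae_oscMeasure δ] with p hp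
  have hp0 := hδ.trans hp.1
  rw [oscPair, norm_mul, norm_mul, RCLike.norm_conj, Complex.norm_real, Real.norm_eq_abs,
    abs_of_nonneg (mul_nonneg (radialWeight_nonneg d hp0) (Real.exp_pos _).le)]
  have h1 := hC p.1 hp.1.le p.2.1 p.2.2
  have h2 := hD p.1 hp.1.le p.2.1 p.2.2
  rw [pow_zero, pow_zero, inv_one, mul_one, mul_one] at h2
  have h3 : ((1 + p.1) ^ 2)⁻¹ ≤ (1 + p.1 ^ 2)⁻¹ := inv_anti₀ (by positivity) (by nlinarith)
  have hw := radialWeight_le (d := d) hδ hp.1.le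
  have hw0 := radialWeight_nonneg d hp0
  have hwδ := radialWeight_nonneg d hδ
  calc _ ≤ (radialWeight d δ * Real.exp (-(ε * p.2.1))) *
        ((C * ((1 + ‖p.2.2‖) ^ (Module.finrank ℝ Z + 1))⁻¹ * (1 + p.1 ^ 2)⁻¹) * D) := by
        have := h1.trans (mul_le_mul_of_nonneg_left h3 (by positivity))
        gcongr
    _ = _ := by ring

lemma memLp_oscFun (d : ℕ) {δ ε : ℝ} (hδ : 0 < δ) (hε : 0 < ε) {g : ℝ → Z → ℂ}
    (hg : RapidFamily δ g) : MemLp (oscFun d δ ε g) 2 (oscMeasure Z δ) := by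
  rw [memLp_two_iff_integrable_sq_norm (measurable_oscFun d hg).aestronglyMeasurable]
  refine (integrable_oscPair d hδ hε hg hg).norm.congr ?_
  filter_upwards [ae_oscMeasure δ] with p hp
  rw [← oscFun_mul_conj hδ g g hp.1, norm_mul, RCLike.norm_conj, sq]

lemma lintegral_oscPair_le (d : ℕ) {δ ε : ℝ} (hδ : 0 < δ) (hε : 0 < ε) {g : ℝ → Z → ℂ}
    (hg : RapidFamily δ g) :
    ∫⁻ p, ENNReal.ofReal ‖oscPair d δ ε g g p‖ ∂(oscMeasure Z δ) ≤
      ∫⁻ l in Set.Ioi δ, ∫⁻ z, ENNReal.ofReal (2⁻¹ * ‖g l z‖ ^ 2 / l ^ d) := by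
  have hm : Measurable fun p => ENNReal.ofReal ‖oscPair d δ ε g g p‖ :=
    (measurable_oscPair d hg hg).norm.ennreal_ofReal
  have hgm := hg.cont.measurable
  rw [oscMeasure, lintegral_prod _ hm.aemeasurable]
  have e1 : ∀ r ∈ Set.Ioi δ,
      ∫⁻ q, ENNReal.ofReal ‖oscPair d δ ε g g (r, q)‖
        ∂(((volume : Measure ℝ).restrict (Set.Ioi 0)).prod (volume : Measure Z)) ≤
      ∫⁻ z, ENNReal.ofReal (radialWeight d r *
        ∫ l in Set.Ioc δ r, Real.exp (2 * (l - r)) * ‖g l z‖ ^ 2) := by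
    intro r hr
    have hr0 := hδ.trans hr
    have hw := radialWeight_nonneg d hr0
    rw [lintegral_prod_symm _ (Measurable.aemeasurable (f := fun q => ENNReal.ofReal ‖oscPair d δ ε g g (r, q)‖)
      (hm.comp measurable_prodMk_left))]
    refine lintegral_mono fun z => ?_
    obtain ⟨i1, i2⟩ := integral_norm_sq_osc (le_of_lt hr) hg.cont z
    rw [← i2, ENNReal.ofReal_mul hw, ofReal_integral_eq_lintegral_ofReal i1
      (Filter.Eventually.of_forall fun t => by positivity),
      ← lintegral_const_mul' _ _ ENNReal.ofReal_ne_top]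
    refine (setLIntegral_mono_ae' measurableSet_Ioi (Filter.Eventually.of_forall
      fun t ht => ?_)).trans (setLIntegral_le_lintegral (Set.Ioi 0) _)
    rw [← ENNReal.ofReal_mul hw]
    refine ENNReal.ofReal_le_ofReal ?_
    rw [oscPair, norm_mul, norm_mul, RCLike.norm_conj, Complex.norm_real, Real.norm_eq_abs,
      abs_of_nonneg (mul_nonneg hw (Real.exp_pos _).le), ← sq]
    have : Real.exp (-(ε * t)) ≤ 1 := Real.exp_le_one_iff.2 (by
      have := mul_pos hε (Set.mem_Ioi.1 ht); linarith)
    refine mul_le_mul_of_nonneg_right ?_ (by positivity)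
    exact mul_le_of_le_one_right hw this
  refine (setLIntegral_mono_ae' measurableSet_Ioi (Filter.Eventually.of_forall e1)).trans ?_
  rw [lintegral_lintegral_swap]
  · rw [lintegral_lintegral_swap (f := fun l z => ENNReal.ofReal (2⁻¹ * ‖g l z‖ ^ 2 / l ^ d))]
    swap
    · have h := hgm.norm
      have : Measurable fun q : ℝ × Z => 2⁻¹ * ‖g q.1 q.2‖ ^ 2 / q.1 ^ d := by fun_prop
      exact this.ennreal_ofReal.aemeasurable
    refine lintegral_mono fun z => ?_
    have hgz : Continuous fun l => g l z := hg.cont.comp (Continuous.prodMk_left z)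
    exact (lintegral_triangle_radialWeight d hδ (m := fun l => ‖g l z‖ ^ 2) (by fun_prop)
      fun l => by positivity).le
  · have hc : Continuous fun q : ℝ × Z =>
        ∫ l in δ..q.1, Real.exp (2 * (l - q.1)) * ‖g l q.2‖ ^ 2 := by
      refine intervalIntegral.continuous_parametric_intervalIntegral_of_continuous
        (f := fun (q : ℝ × Z) l => Real.exp (2 * (l - q.1)) * ‖g l q.2‖ ^ 2) ?_ continuous_fst
      have : Continuous fun q : (ℝ × Z) × ℝ => g q.2 q.1.2 :=
        hg.cont.comp (f := fun q : (ℝ × Z) × ℝ => (q.2, q.1.2)) (by fun_prop)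
      exact Continuous.mul (by fun_prop) (this.norm.pow 2)
    have h2 : Measurable fun q : ℝ × Z => ENNReal.ofReal (radialWeight d q.1 *
        ∫ l in δ..q.1, Real.exp (2 * (l - q.1)) * ‖g l q.2‖ ^ 2) := by
      have := hc.measurable
      fun_prop
    refine h2.aemeasurable.congr ?_
    have h1 := (Measure.quasiMeasurePreserving_fst
      (μ := (volume : Measure ℝ).restrict (Set.Ioi δ)) (ν := (volume : Measure Z))).ae
      (ae_restrict_mem measurableSet_Ioi)
    filter_upwards [h1] with q hq
    rw [Function.uncurry, intervalIntegral.integral_of_le (le_of_lt hq)]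

end OscOperator

section EnergyIdentity

variable {Z : Type*} [NormedAddCommGroup Z] [NormedSpace ℝ Z] [FiniteDimensional ℝ Z]
  [MeasureSpace Z] [BorelSpace Z] [(volume : Measure Z).IsAddHaarMeasure]

/-- The measure on `(δ, ∞) × Z`. -/
def radMeasure (Z : Type*) [MeasureSpace Z] (δ : ℝ) : Measure (ℝ × Z) :=
  (volume.restrict (Set.Ioi δ)).prod volume

lemma ae_radMeasure (δ : ℝ) : ∀ᵐ p ∂(radMeasure Z δ), δ < p.1 :=
  (Measure.quasiMeasurePreserving_fst (μ := (volume : Measure ℝ).restrict (Set.Ioi δ))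
    (ν := (volume : Measure Z))).ae (ae_restrict_mem measurableSet_Ioi)

instance (δ : ℝ) : SFinite (radMeasure Z δ) := by unfold radMeasure; infer_instance

/-- A product of a bounded radial factor and two rapid families is integrable. -/
lemma RapidFamily.integrable_mul_conj {δ : ℝ} (hδ : 0 < δ) {g h : ℝ → Z → ℂ}
    (hg : RapidFamily δ g) (hh : RapidFamily δ h) {k : ℝ → ℝ} (hk : Measurable k) {c : ℝ}
    (hc : ∀ r, δ < r → |k r| ≤ c) :
    Integrable (fun p : ℝ × Z => (k p.1 : ℂ) * (g p.1 p.2 * conj (h p.1 p.2)))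
      (radMeasure Z δ) := by
  obtain ⟨C, hC0, hC⟩ := hg.decay (Module.finrank ℝ Z + 1) 2
  obtain ⟨D, hD0, hD⟩ := hh.decay 0 0
  have hc0 : 0 ≤ c := (abs_nonneg _).trans (hc (δ + 1) (by linarith))
  have i1 : Integrable (fun r : ℝ => c * C * D * (1 + r ^ 2)⁻¹)
      (volume.restrict (Set.Ioi δ)) := (integrable_inv_one_add_sq.const_mul _).restrict
  have i3 := i1.mul_prod (integrable_one_add_norm_pow_inv (Z := Z))
  refine i3.mono' ?_ ?_
  · have h1 := hg.cont.measurable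
    have h2 : Measurable fun p : ℝ × Z => conj (h p.1 p.2) :=
      Complex.continuous_conj.measurable.comp hh.cont.measurable
    have h3 : Measurable fun p : ℝ × Z => (k p.1 : ℂ) := by fun_prop
    exact (h3.mul (h1.mul h2)).aestronglyMeasurable
  · filter_upwards [ae_radMeasure δ] with p hp
    have hp0 := hδ.trans hp
    rw [norm_mul, norm_mul, RCLike.norm_conj, Complex.norm_real, Real.norm_eq_abs]
    have h1 := hC p.1 hp.le p.2
    have h2 := hD p.1 hp.le p.2
    rw [pow_zero, pow_zero, inv_one, mul_one, mul_one] at h2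
    have h3 : ((1 + p.1) ^ 2)⁻¹ ≤ (1 + p.1 ^ 2)⁻¹ := inv_anti₀ (by positivity) (by nlinarith)
    have hw := hc p.1 hp
    calc _ ≤ c * ((C * ((1 + ‖p.2‖) ^ (Module.finrank ℝ Z + 1))⁻¹ * (1 + p.1 ^ 2)⁻¹) * D) := by
          have := h1.trans (mul_le_mul_of_nonneg_left h3 (by positivity))
          gcongr
      _ = _ := by ring

/-- The weighted energy of an oscillatory integral at time zero. -/
def oscEnergy (d : ℕ) (δ : ℝ) (g : ℝ → Z → ℂ) : ℝ :=
  ∫ p, radialWeight d p.1 * ‖osc δ g p.1 0 p.2‖ ^ 2 ∂(radMeasure Z δ)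

lemma integrable_oscEnergy (d : ℕ) {δ : ℝ} (hδ : 0 < δ) {g : ℝ → Z → ℂ} (hg : RapidFamily δ g) :
    Integrable (fun p : ℝ × Z => radialWeight d p.1 * ‖osc δ g p.1 0 p.2‖ ^ 2)
      (radMeasure Z δ) := by
  have := (hg.osc hδ 0).integrable_mul_conj hδ (hg.osc hδ 0) (measurable_radialWeight d)
    (c := radialWeight d δ) (fun r hr => by
      rw [abs_of_nonneg (radialWeight_nonneg d (hδ.trans hr))]
      exact radialWeight_le hδ hr.le)
  refine this.re.congr (.of_forall fun p => ?_)
  simp only [Complex.mul_conj', ← Complex.ofReal_pow, ← Complex.ofReal_mul]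
  rfl

lemma oscEnergy_nonneg (d : ℕ) {δ : ℝ} (hδ : 0 < δ) (g : ℝ → Z → ℂ) : 0 ≤ oscEnergy d δ g := by
  refine integral_nonneg_of_ae ?_
  filter_upwards [ae_radMeasure δ] with p hp
  exact mul_nonneg (radialWeight_nonneg d (hδ.trans hp)) (by positivity)

lemma oscPair_conj (d : ℕ) (δ ε : ℝ) (g h : ℝ → Z → ℂ) (p : ℝ × ℝ × Z) :
    conj (oscPair d δ ε g h p) = oscPair d δ ε h g p := by
  rw [oscPair, oscPair, map_mul, Complex.conj_ofReal, map_mul, Complex.conj_conj]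
  ring

lemma integral_oscPair_conj (d : ℕ) (δ ε : ℝ) (g h : ℝ → Z → ℂ) :
    conj (∫ p, oscPair d δ ε g h p ∂(oscMeasure Z δ)) =
      ∫ p, oscPair d δ ε h g p ∂(oscMeasure Z δ) := by
  rw [← integral_conj]
  simp_rw [oscPair_conj]

/-- The time integral of the derivative of the damped square modulus. -/
lemma integral_time_deriv {δ r ε : ℝ} (hδ : 0 < δ) (hε : 0 < ε) (hr : δ ≤ r) {g h : ℝ → Z → ℂ}
    (hg : RapidFamily δ g) (hh : RapidFamily δ h) (H : ∀ l, δ ≤ l → ∀ z, h l z = l * g l z)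
    (z : Z) :
    ∫ t in Set.Ioi (0 : ℝ), (Real.exp (-(ε * t)) : ℂ) *
      (2 * Real.pi * Complex.I * (osc δ h r t z * conj (osc δ g r t z) -
        osc δ g r t z * conj (osc δ h r t z)) -
        ε * (osc δ g r t z * conj (osc δ g r t z))) = -(‖osc δ g r 0 z‖ ^ 2 : ℝ) := by
  obtain ⟨C, hC0, hC⟩ := hg.exists_osc_decay hδ 0 0
  obtain ⟨D, hD0, hD⟩ := hh.exists_osc_decay hδ 0 0
  have hC' : ∀ t, ‖osc δ g r t z‖ ≤ C := fun t => by simpa using hC r hr t z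
  have hD' : ∀ t, ‖osc δ h r t z‖ ≤ D := fun t => by simpa using hD r hr t z
  have hcg : Continuous fun t => osc δ g r t z :=
    (continuous_osc (δ := δ) hg.cont).comp (f := fun t : ℝ => (r, t, z)) (by fun_prop)
  have hch : Continuous fun t => osc δ h r t z :=
    (continuous_osc (δ := δ) hh.cont).comp (f := fun t : ℝ => (r, t, z)) (by fun_prop)
  have hcgc : Continuous fun t => conj (osc δ g r t z) := Complex.continuous_conj.comp hcg
  have hchc : Continuous fun t => conj (osc δ h r t z) := Complex.continuous_conj.comp hch
  have hd : ∀ t : ℝ, HasDerivAt (fun t => (Real.exp (-(ε * t)) : ℂ) *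
      (osc δ g r t z * conj (osc δ g r t z))) ((Real.exp (-(ε * t)) : ℂ) *
      (2 * Real.pi * Complex.I * (osc δ h r t z * conj (osc δ g r t z) -
        osc δ g r t z * conj (osc δ h r t z)) -
        ε * (osc δ g r t z * conj (osc δ g r t z)))) t := by
    intro t
    have h1 : HasDerivAt (fun t => osc δ g r t z) (2 * Real.pi * Complex.I * osc δ h r t z) t := by
      refine (hasDerivAt_osc_time hg.cont r t z).congr_deriv ?_
      rw [osc_congr hr t z (g := h) (h := fun l z => l * g l z) fun l hl => H l hl z]
    have h2 : HasDerivAt (fun t => conj (osc δ g r t z))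
        (conj (2 * Real.pi * Complex.I * osc δ h r t z)) t := h1.star
    have h3 : HasDerivAt (fun t : ℝ => (Real.exp (-(ε * t)) : ℂ))
        ((Real.exp (-(ε * t)) * (-(ε * 1)) : ℝ) : ℂ) t :=
      (((hasDerivAt_id t).const_mul ε).fun_neg.exp).ofReal_comp
    refine (h3.fun_mul (h1.fun_mul h2)).congr_deriv ?_
    simp only [map_mul, Complex.conj_I, Complex.conj_ofReal, map_ofNat]
    push_cast
    ring
  have hexp : IntegrableOn (fun t : ℝ => Real.exp (-(ε * t))) (Set.Ioi 0) := by
    have := exp_neg_integrableOn_Ioi 0 hε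
    simp only [neg_mul] at this
    exact this
  have hint : IntegrableOn (fun t : ℝ => (Real.exp (-(ε * t)) : ℂ) *
      (2 * Real.pi * Complex.I * (osc δ h r t z * conj (osc δ g r t z) -
        osc δ g r t z * conj (osc δ h r t z)) -
        ε * (osc δ g r t z * conj (osc δ g r t z)))) (Set.Ioi 0) := by
    refine (hexp.mul_const (‖(2 * Real.pi * Complex.I : ℂ)‖ * (D * C + C * D) +
      ‖(ε : ℂ)‖ * (C * C))).mono' (by fun_prop) (.of_forall fun t => ?_)
    have := hC' t
    have := hD' t
    rw [norm_mul, Complex.norm_real, Real.norm_eq_abs, abs_of_pos (Real.exp_pos _)]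
    refine mul_le_mul_of_nonneg_left ((norm_sub_le _ _).trans ?_) (Real.exp_pos _).le
    rw [norm_mul, norm_mul (ε : ℂ), norm_mul (osc δ g r t z), RCLike.norm_conj]
    have h4 : ‖osc δ h r t z * conj (osc δ g r t z) - osc δ g r t z * conj (osc δ h r t z)‖ ≤
        D * C + C * D := by
      refine (norm_sub_le _ _).trans ?_
      rw [norm_mul, norm_mul, RCLike.norm_conj, RCLike.norm_conj]
      gcongr
    gcongr
  have hlim : Filter.Tendsto (fun t => (Real.exp (-(ε * t)) : ℂ) *
      (osc δ g r t z * conj (osc δ g r t z))) Filter.atTop (nhds 0) := by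
    have h0 : Filter.Tendsto (fun t => Real.exp (-(ε * t)) * (C * C)) Filter.atTop (nhds 0) := by
      rw [← zero_mul (C * C)]
      exact (Real.tendsto_exp_neg_atTop_nhds_zero.comp
        (Filter.tendsto_id.const_mul_atTop hε)).mul_const _
    refine squeeze_zero_norm (fun t => ?_) h0
    have := hC' t
    rw [norm_mul, Complex.norm_real, Real.norm_eq_abs, abs_of_pos (Real.exp_pos _), norm_mul,
      RCLike.norm_conj]
    gcongr
  rw [integral_Ioi_of_hasDerivAt_of_tendsto' (fun t _ => hd t) hint hlim]
  simp [RCLike.mul_conj]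

lemma integral_oscMeasure_time {δ : ℝ} {K : ℝ × ℝ × Z → ℂ} (hK : Integrable K (oscMeasure Z δ)) :
    ∫ p, K p ∂(oscMeasure Z δ) =
      ∫ r in Set.Ioi δ, ∫ z, ∫ t in Set.Ioi (0 : ℝ), K (r, t, z) := by
  unfold oscMeasure at hK ⊢
  rw [integral_prod _ hK]
  refine integral_congr_ae ?_
  filter_upwards [hK.prod_right_ae] with r hr
  exact integral_prod_symm _ hr

lemma integral_oscMeasure_space {δ : ℝ} {K : ℝ × ℝ × Z → ℂ} (hK : Integrable K (oscMeasure Z δ)) :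
    ∫ p, K p ∂(oscMeasure Z δ) =
      ∫ r in Set.Ioi δ, ∫ t in Set.Ioi (0 : ℝ), ∫ z, K (r, t, z) := by
  unfold oscMeasure at hK ⊢
  rw [integral_prod _ hK]
  refine integral_congr_ae ?_
  filter_upwards [hK.prod_right_ae] with r hr
  exact integral_prod _ hr

lemma oscEnergy_identity (d : ℕ) {δ ε : ℝ} (hδ : 0 < δ) (hε : 0 < ε) {g h : ℝ → Z → ℂ}
    (hg : RapidFamily δ g) (hh : RapidFamily δ h) (H : ∀ l, δ ≤ l → ∀ z, h l z = l * g l z) :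
    2 * Real.pi * Complex.I * (∫ p, oscPair d δ ε h g p ∂(oscMeasure Z δ) -
      ∫ p, oscPair d δ ε g h p ∂(oscMeasure Z δ)) - ε * ∫ p, oscPair d δ ε g g p ∂(oscMeasure Z δ) =
      -(oscEnergy d δ g : ℂ) := by
  have i1 := integrable_oscPair d hδ hε hh hg
  have i2 := integrable_oscPair d hδ hε hg hh
  have i3 := integrable_oscPair d hδ hε hg hg
  have i5 : Integrable (fun p => 2 * Real.pi * Complex.I *
      (oscPair d δ ε h g p - oscPair d δ ε g h p)) (oscMeasure Z δ) := (i1.sub i2).const_mul _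
  have i6 : Integrable (fun p => ε * oscPair d δ ε g g p) (oscMeasure Z δ) := i3.const_mul _
  rw [← integral_sub i1 i2, ← integral_const_mul, ← integral_const_mul,
    ← integral_sub i5 i6]
  have i7 : Integrable (fun p => 2 * Real.pi * Complex.I *
      (oscPair d δ ε h g p - oscPair d δ ε g h p) - ε * oscPair d δ ε g g p) (oscMeasure Z δ) :=
    i5.sub i6
  rw [integral_oscMeasure_time i7, oscEnergy,
    ← integral_complex_ofReal, ← integral_neg]
  have i4 : Integrable (fun p : ℝ × Z =>
      -((radialWeight d p.1 * ‖osc δ g p.1 0 p.2‖ ^ 2 : ℝ) : ℂ)) (radMeasure Z δ) :=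
    (integrable_oscEnergy d hδ hg).ofReal.neg
  unfold radMeasure at i4 ⊢
  rw [integral_prod _ i4]
  refine setIntegral_congr_fun measurableSet_Ioi fun r hr => ?_
  refine integral_congr_ae (.of_forall fun z => ?_)
  have := integral_time_deriv hδ hε (le_of_lt hr) hg hh H z
  simp only [Complex.ofReal_mul]
  rw [← mul_neg, ← this, ← integral_const_mul]
  refine integral_congr_ae (.of_forall fun t => ?_)
  simp only [oscPair]
  push_cast
  ring

end EnergyIdentity

section EnergyBound

variable {Z : Type*} [NormedAddCommGroup Z] [NormedSpace ℝ Z] [FiniteDimensional ℝ Z]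
  [MeasureSpace Z] [BorelSpace Z] [(volume : Measure Z).IsAddHaarMeasure]

/-- The squared `L²` norm. -/
def sqInt (v : 𝓢(Z × ℝ, ℂ)) : ℝ := ∫ p, ‖v p‖ ^ 2

lemma integrable_norm_sq_schwartz (v : 𝓢(Z × ℝ, ℂ)) : Integrable (fun p => ‖v p‖ ^ 2) := by
  refine (SchwartzMap.integrable_mul_conj volume v v).re.congr (.of_forall fun p => ?_)
  simp only [Complex.mul_conj', ← Complex.ofReal_pow]
  rfl

lemma sqInt_nonneg (v : 𝓢(Z × ℝ, ℂ)) : 0 ≤ sqInt v := integral_nonneg fun _ => by positivity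

/-- The twisted derivative of `til δ v`. -/
def tilX (δ : ℝ) (ω : Z →L[ℝ] Z →L[ℝ] ℝ) (ξ : Z) (v : 𝓢(Z × ℝ, ℂ)) (l : ℝ) (z : Z) : ℂ :=
  ((rtc δ l)⁻¹ : ℂ) * til δ (hX ω ξ v) l z

lemma rapidFamily_tilX {δ : ℝ} (hδ : 0 < δ) (ω : Z →L[ℝ] Z →L[ℝ] ℝ) (ξ : Z)
    (v : 𝓢(Z × ℝ, ℂ)) : RapidFamily δ (tilX δ ω ξ v) :=
  (rapidFamily_til hδ _).rtc_inv_mul hδ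

lemma TwistedDeriv.const_mul {ω : Z →L[ℝ] Z →L[ℝ] ℝ} {ξ : Z} {f F : Z → ℂ}
    (h : TwistedDeriv ω ξ f F) (c : ℂ) :
    TwistedDeriv ω ξ (fun z => c * f z) (fun z => c * F z) := by
  intro z
  have := HasDerivAt.const_mul c (h z)
  exact this.congr_deriv (by ring)

lemma twistedDeriv_rtc_mul_til {δ : ℝ} (hδ : 0 < δ) (ω : Z →L[ℝ] Z →L[ℝ] ℝ) (ξ : Z)
    (v : 𝓢(Z × ℝ, ℂ)) (l : ℝ) :
    TwistedDeriv ω ξ (fun z => (rtc δ l : ℂ) * til δ v l z) (til δ (hX ω ξ v) l) := by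
  have h := (twistedDeriv_til hδ ω ξ v l).const_mul (rtc δ l)
  have h0 : (rtc δ l : ℂ) ≠ 0 := by exact_mod_cast (rtc_pos hδ l).ne'
  simp_rw [mul_inv_cancel_left₀ h0] at h
  exact h

lemma integral_oscPair_twistedDeriv (d : ℕ) {δ ε : ℝ} (hδ : 0 < δ) (hε : 0 < ε)
    {ω : Z →L[ℝ] Z →L[ℝ] ℝ} {ξ : Z} {f F h H : ℝ → Z → ℂ}
    (hf : RapidFamily δ f) (hF : RapidFamily δ F) (hh : RapidFamily δ h) (hH : RapidFamily δ H)
    (h1 : ∀ l, TwistedDeriv ω ξ (f l) (F l)) (h2 : ∀ l, TwistedDeriv ω ξ (h l) (H l)) :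
    ∫ p, oscPair d δ ε F h p ∂(oscMeasure Z δ) = -∫ p, oscPair d δ ε f H p ∂(oscMeasure Z δ) := by
  rw [integral_oscMeasure_space (integrable_oscPair d hδ hε hF hh),
    integral_oscMeasure_space (integrable_oscPair d hδ hε hf hH), ← integral_neg]
  refine setIntegral_congr_fun measurableSet_Ioi fun r hr => ?_
  rw [← integral_neg]
  refine setIntegral_congr_fun measurableSet_Ioi fun t _ => ?_
  have hr' : δ ≤ r := le_of_lt hr
  have := integral_twistedDeriv_mul_conj ((hf.osc hδ t).rapidFun hr')
    ((hF.osc hδ t).rapidFun hr') ((hh.osc hδ t).rapidFun hr')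
    ((hH.osc hδ t).rapidFun hr') (TwistedDeriv.osc hf.cont hF.cont h1 r t)
    (TwistedDeriv.osc hh.cont hH.cont h2 r t)
  simp only [oscPair]
  rw [integral_const_mul, integral_const_mul, this, mul_neg]

lemma lintegral_til_le {δ : ℝ} (hδ : 0 < δ) {d : ℕ} (hZ : Module.finrank ℝ Z = 2 * d)
    (v : 𝓢(Z × ℝ, ℂ)) {g : ℝ → Z → ℂ} {c : ℝ} (hc : 0 ≤ c)
    (hg : ∀ l, δ ≤ l → ∀ z, ‖g l z‖ ^ 2 ≤ c * ‖til δ v l z‖ ^ 2) :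
    ∫⁻ l in Set.Ioi δ, ∫⁻ z, ENNReal.ofReal (2⁻¹ * ‖g l z‖ ^ 2 / l ^ d) ≤
      ENNReal.ofReal (c / 2 * sqInt v) := by
  have e1 : ∀ l ∈ Set.Ioi δ, ∫⁻ z, ENNReal.ofReal (2⁻¹ * ‖g l z‖ ^ 2 / l ^ d) ≤
      ENNReal.ofReal (c / 2) * ∫⁻ z, ENNReal.ofReal (‖pft v z l‖ ^ 2) := by
    intro l hl
    have hl0 : 0 < l := hδ.trans hl
    have hi := ((rapidFamily_til hδ v).rapidFun (le_of_lt hl)).integrable_norm_sq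
    have hp : Integrable fun z => ‖pft v z l‖ ^ 2 := by
      obtain ⟨C, hC0, hC⟩ := pft_bound v (Module.finrank ℝ Z + 1)
      obtain ⟨D, hD0, hD⟩ := pft_bound v 0
      have hcont : Continuous fun z => pft v z l :=
        (continuous_pft v).comp (f := fun z : Z => (z, l)) (by fun_prop)
      refine (integrable_one_add_norm_pow_inv.const_mul (C * D)).mono' (by fun_prop)
        (.of_forall fun z => ?_)
      rw [Real.norm_eq_abs, abs_of_nonneg (by positivity), sq]
      have h1 := hC z l
      have h2 := hD z l
      rw [pow_zero, inv_one, mul_one] at h2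
      calc _ ≤ _ := mul_le_mul h1 h2 (norm_nonneg _) (by positivity)
        _ = _ := by ring
    calc _ ≤ ∫⁻ z, ENNReal.ofReal (c / 2 / l ^ d * ‖til δ v l z‖ ^ 2) := by
          refine lintegral_mono fun z => ENNReal.ofReal_le_ofReal ?_
          have := hg l (le_of_lt hl) z
          calc _ ≤ 2⁻¹ * (c * ‖til δ v l z‖ ^ 2) / l ^ d := by gcongr
            _ = _ := by ring
      _ = ENNReal.ofReal (c / 2 * ∫ z, ‖pft v z l‖ ^ 2) := by
          rw [← ofReal_integral_eq_lintegral_ofReal (hi.const_mul _)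
            (.of_forall fun z => by positivity), integral_const_mul,
            integral_norm_sq_til hδ (le_of_lt hl) hZ]
          congr 1
          field_simp
      _ = _ := by
          rw [ENNReal.ofReal_mul (by positivity), ofReal_integral_eq_lintegral_ofReal hp
            (.of_forall fun z => by positivity)]
  refine (setLIntegral_mono_ae' measurableSet_Ioi (.of_forall e1)).trans ?_
  refine (setLIntegral_le_lintegral _ _).trans ?_
  have hm : Measurable fun q : ℝ × Z => ENNReal.ofReal (‖pft v q.2 q.1‖ ^ 2) := by
    have : Continuous fun q : ℝ × Z => pft v q.2 q.1 := (continuous_pft v).comp continuous_swap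
    have := this.measurable
    fun_prop
  rw [lintegral_const_mul' _ _ ENNReal.ofReal_ne_top,
    lintegral_lintegral_swap (f := fun l z => ENNReal.ofReal (‖pft v z l‖ ^ 2)) hm.aemeasurable,
    ENNReal.ofReal_mul (by positivity)]
  gcongr
  rw [sqInt, ofReal_integral_eq_lintegral_ofReal (integrable_norm_sq_schwartz v)
    (.of_forall fun z => by positivity), Measure.volume_eq_prod,
    lintegral_prod _ (by fun_prop)]
  refine lintegral_mono fun z => ?_
  have i1 : Integrable fun l => ‖pft v z l‖ ^ 2 := by
    obtain ⟨C, hC0, hC⟩ := pft_decay v 0 2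
    obtain ⟨D, hD0, hD⟩ := pft_bound v 0
    have hcont : Continuous fun l => pft v z l :=
      (continuous_pft v).comp (f := fun l : ℝ => (z, l)) (by fun_prop)
    refine (integrable_inv_one_add_sq.const_mul (C * D)).mono' (by fun_prop)
      (.of_forall fun l => ?_)
    rw [Real.norm_eq_abs, abs_of_nonneg (by positivity), sq]
    have h1 := hC z l
    have h2 := hD z l
    rw [pow_zero, inv_one, mul_one] at h1 h2
    have h3 : ((1 + |l|) ^ 2)⁻¹ ≤ (1 + l ^ 2)⁻¹ :=
      inv_anti₀ (by positivity) (by nlinarith [abs_nonneg l, sq_abs l])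
    have h4 := h1.trans (mul_le_mul_of_nonneg_left h3 hC0)
    calc _ ≤ _ := mul_le_mul h4 h2 (norm_nonneg _) (by positivity)
      _ = _ := by ring
  have i2 : Integrable fun t => ‖v (z, t)‖ ^ 2 := by
    refine (SchwartzMap.integrable_mul_conj volume (vslice v z) (vslice v z)).re.congr
      (.of_forall fun p => ?_)
    simp only [Complex.mul_conj', ← Complex.ofReal_pow]
    rfl
  rw [← ofReal_integral_eq_lintegral_ofReal i1 (.of_forall fun z => by positivity),
    ← ofReal_integral_eq_lintegral_ofReal i2 (.of_forall fun z => by positivity),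
    integral_norm_sq_pft]

lemma integral_norm_oscPair_le {δ ε : ℝ} (hδ : 0 < δ) (hε : 0 < ε) {d : ℕ}
    (hZ : Module.finrank ℝ Z = 2 * d)
    (v : 𝓢(Z × ℝ, ℂ)) {g : ℝ → Z → ℂ} (hgr : RapidFamily δ g) {c : ℝ} (hc : 0 ≤ c)
    (hg : ∀ l, δ ≤ l → ∀ z, ‖g l z‖ ^ 2 ≤ c * ‖til δ v l z‖ ^ 2) :
    ∫ p, ‖oscPair d δ ε g g p‖ ∂(oscMeasure Z δ) ≤ c / 2 * sqInt v := by
  have h := (lintegral_oscPair_le d hδ hε hgr).trans (lintegral_til_le hδ hZ v hc hg)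
  rw [← ofReal_integral_eq_lintegral_ofReal (integrable_oscPair d hδ hε hgr hgr).norm
    (.of_forall fun z => norm_nonneg _)] at h
  exact (ENNReal.ofReal_le_ofReal_iff (mul_nonneg (by positivity) (sqInt_nonneg v))).1 h

lemma oscEnergy_tilX_le {δ ε : ℝ} (hδ : 0 < δ) (hε : 0 < ε) {d : ℕ}
    (hZ : Module.finrank ℝ Z = 2 * d) (ω : Z →L[ℝ] Z →L[ℝ] ℝ) (ξ : Z) (v : 𝓢(Z × ℝ, ℂ)) :
    oscEnergy d δ (tilX δ ω ξ v) ≤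
      4 * Real.pi * (Complex.I * ∫ p, oscPair d δ ε (til δ (hX ω ξ (hX ω ξ v))) (til δ v) p
        ∂(oscMeasure Z δ)).re + ε * (δ⁻¹ / 2 * sqInt (hX ω ξ v)) := by
  have hg := rapidFamily_tilX hδ ω ξ v
  have hh := (rapidFamily_til hδ (hX ω ξ v)).rtc_mul hδ
  have hH : ∀ l, δ ≤ l → ∀ z, (rtc δ l : ℂ) * til δ (hX ω ξ v) l z = l * tilX δ ω ξ v l z := by
    intro l hl z
    have h0 : (rtc δ l : ℂ) ≠ 0 := by exact_mod_cast (rtc_pos hδ l).ne'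
    have h2 : (l : ℂ) = (rtc δ l : ℂ) ^ 2 := by exact_mod_cast (rtc_sq_of_le hδ hl).symm
    rw [tilX, h2]
    field_simp
  have hid := oscEnergy_identity d hδ hε hg hh hH
  rw [integral_oscPair_twistedDeriv d hδ hε hh (rapidFamily_til hδ _) (rapidFamily_til hδ _) hg
    (twistedDeriv_rtc_mul_til hδ ω ξ _) (twistedDeriv_til hδ ω ξ v)]
  have hb := integral_norm_oscPair_le hδ hε hZ (hX ω ξ v) hg (c := δ⁻¹) (by positivity) (by
    intro l hl z
    have h0 := rtc_pos hδ l
    rw [tilX, norm_mul, mul_pow, norm_inv, Complex.norm_real, Real.norm_eq_abs, abs_of_pos h0,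
      inv_pow, rtc_sq_of_le hδ hl]
    gcongr)
  rw [← integral_oscPair_conj d δ ε _ (tilX δ ω ξ v)] at hid
  set P := ∫ p, oscPair d δ ε (fun l z => (rtc δ l : ℂ) * til δ (hX ω ξ v) l z)
    (tilX δ ω ξ v) p ∂(oscMeasure Z δ)
  set Q := ∫ p, oscPair d δ ε (tilX δ ω ξ v) (tilX δ ω ξ v) p ∂(oscMeasure Z δ) with hQ
  have hQn : Q.re ≤ δ⁻¹ / 2 * sqInt (hX ω ξ v) :=
    ((Complex.re_le_norm _).trans (norm_integral_le_integral_norm _)).trans hb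
  have hre := congrArg Complex.re hid
  simp at hre ⊢
  have := mul_le_mul_of_nonneg_left hQn hε.le
  linarith

end EnergyBound

section OscOp

variable {Z : Type*} [NormedAddCommGroup Z] [NormedSpace ℝ Z] [FiniteDimensional ℝ Z]
  [MeasureSpace Z] [BorelSpace Z] [(volume : Measure Z).IsAddHaarMeasure]

/-- The weighted oscillatory integral as an operator into `L²`. -/
def oscOp (d : ℕ) {δ ε : ℝ} (hδ : 0 < δ) (hε : 0 < ε) :
    𝓢(Z × ℝ, ℂ) →ₗ[ℂ] Lp ℂ 2 (oscMeasure Z δ) where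
  toFun v := (memLp_oscFun d hδ hε (rapidFamily_til hδ v)).toLp
  map_add' v w := by
    rw [← MemLp.toLp_add]
    refine MemLp.toLp_congr _ _ (.of_forall fun p => ?_)
    have : til δ (v + w) = fun l z => til δ v l z + til δ w l z := by
      ext l z; exact til_add δ v w l z
    simp only [oscFun, Pi.add_apply]
    rw [this, osc_add (rapidFamily_til hδ v) (rapidFamily_til hδ w), mul_add]
  map_smul' c v := by
    rw [RingHom.id_apply, ← MemLp.toLp_const_smul]
    refine MemLp.toLp_congr _ _ (.of_forall fun p => ?_)
    have : til δ (c • v) = fun l z => c * til δ v l z := by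
      ext l z; exact til_smul δ c v l z
    simp only [oscFun, Pi.smul_apply, smul_eq_mul]
    rw [this, osc_const_mul]
    ring

lemma inner_oscOp (d : ℕ) {δ ε : ℝ} (hδ : 0 < δ) (hε : 0 < ε) (v w : 𝓢(Z × ℝ, ℂ)) :
    inner ℂ (oscOp d hδ hε v) (oscOp d hδ hε w) =
      ∫ p, oscPair d δ ε (til δ w) (til δ v) p ∂(oscMeasure Z δ) := by
  rw [L2.inner_def]
  refine integral_congr_ae ?_
  filter_upwards [(memLp_oscFun d hδ hε (rapidFamily_til hδ v)).coeFn_toLp,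
    (memLp_oscFun d hδ hε (rapidFamily_til hδ w)).coeFn_toLp, ae_oscMeasure δ] with p h1 h2 h3
  rw [← oscFun_mul_conj hδ _ _ h3.1, ← h1, ← h2]
  rfl

lemma norm_sq_oscOp_le {δ ε : ℝ} (hδ : 0 < δ) (hε : 0 < ε) {d : ℕ}
    (hZ : Module.finrank ℝ Z = 2 * d) (v : 𝓢(Z × ℝ, ℂ)) :
    ‖oscOp d hδ hε v‖ ^ 2 ≤ 2⁻¹ * sqInt v := by
  rw [← @inner_self_eq_norm_sq ℂ, inner_oscOp]
  refine ((RCLike.re_le_norm _).trans (norm_integral_le_integral_norm _)).trans ?_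
  refine (integral_norm_oscPair_le hδ hε hZ v (rapidFamily_til hδ v) zero_le_one
    fun l _ z => (one_mul _).ge).trans ?_
  norm_num

variable {ι : Type*} [Fintype ι]

lemma sum_sqInt_hX_le (ω : Z →L[ℝ] Z →L[ℝ] ℝ) (b : ι → Z) (v : 𝓢(Z × ℝ, ℂ)) :
    ∑ i, sqInt (hX ω (b i) v) ≤ sqInt v + sqInt (hLap ω b v) := by
  have h1 : ∀ i, (sqInt (hX ω (b i) v) : ℂ) =
      -∫ p, hX ω (b i) (hX ω (b i) v) p * conj (v p) := by
    intro i
    rw [integral_hX_mul_conj, neg_neg, sqInt, ← integral_complex_ofReal]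
    simp_rw [Complex.mul_conj', Complex.ofReal_pow]
  have h2 : ((∑ i, sqInt (hX ω (b i) v) : ℝ) : ℂ) = -∫ p, hLap ω b v p * conj (v p) := by
    rw [Complex.ofReal_sum, Finset.sum_congr rfl fun i _ => h1 i, Finset.sum_neg_distrib,
      ← integral_finsetSum _ fun i _ => SchwartzMap.integrable_mul_conj volume _ _]
    simp_rw [hLap, sum_apply, Finset.sum_mul]
  have h3 : ∑ i, sqInt (hX ω (b i) v) ≤ ∫ p, ‖hLap ω b v p * conj (v p)‖ := by
    have := congrArg norm h2
    rw [norm_neg, Complex.norm_real, Real.norm_eq_abs,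
      abs_of_nonneg (Finset.sum_nonneg fun i _ => sqInt_nonneg _)] at this
    rw [this]
    exact norm_integral_le_integral_norm _
  refine h3.trans ?_
  rw [sqInt, sqInt,
    ← integral_add (integrable_norm_sq_schwartz v) (integrable_norm_sq_schwartz _)]
  refine integral_mono (SchwartzMap.integrable_mul_conj volume _ _).norm
    ((integrable_norm_sq_schwartz v).add (integrable_norm_sq_schwartz _)) fun p => ?_
  simp only [norm_mul, RCLike.norm_conj]
  nlinarith [sq_nonneg (‖v p‖ - ‖hLap ω b v p‖), norm_nonneg (v p), norm_nonneg (hLap ω b v p)]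

lemma osc_sum {δ r : ℝ} (s : Finset ι) {g : ι → ℝ → Z → ℂ} (hg : ∀ i, RapidFamily δ (g i))
    (t : ℝ) (z : Z) :
    osc δ (fun l z => ∑ i ∈ s, g i l z) r t z = ∑ i ∈ s, osc δ (g i) r t z := by
  simp only [osc, Finset.mul_sum]
  exact intervalIntegral.integral_finsetSum fun i _ => (hg i).intervalIntegrable t r z δ r

lemma sum_oscEnergy_le {δ ε : ℝ} (hδ : 0 < δ) (hε : 0 < ε) {d : ℕ}
    (hZ : Module.finrank ℝ Z = 2 * d) (ω : Z →L[ℝ] Z →L[ℝ] ℝ) (b : ι → Z) (v : 𝓢(Z × ℝ, ℂ)) :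
    ∑ i, oscEnergy d δ (tilX δ ω (b i) v) ≤
      4 * Real.pi * (inner ℂ (oscOp d hδ hε v) (oscOp d hδ hε (Complex.I • hLap ω b v))).re +
        ε * (δ⁻¹ / 2 * (sqInt v + sqInt (hLap ω b v))) := by
  have h := Finset.sum_le_sum fun i (_ : i ∈ Finset.univ) =>
    oscEnergy_tilX_le hδ hε hZ ω (b i) v
  rw [Finset.sum_add_distrib, ← Finset.mul_sum, ← Finset.mul_sum, ← Finset.mul_sum,
    ← Complex.re_sum, ← Finset.mul_sum, ← integral_finsetSum _ fun i _ =>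
      integrable_oscPair d hδ hε (rapidFamily_til hδ _) (rapidFamily_til hδ v)] at h
  have e : ∀ p, ∑ i, oscPair d δ ε (til δ (hX ω (b i) (hX ω (b i) v))) (til δ v) p =
      oscPair d δ ε (til δ (hLap ω b v)) (til δ v) p := by
    intro p
    have : til δ (hLap ω b v) = fun l z => ∑ i, til δ (hX ω (b i) (hX ω (b i) v)) l z := by
      ext l z; exact til_sum δ _ _ l z
    simp only [oscPair]
    rw [this, osc_sum _ fun i => rapidFamily_til hδ _, Finset.sum_mul, Finset.mul_sum]
  simp_rw [e] at h
  rw [map_smul, inner_smul_right, inner_oscOp]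
  have := sum_sqInt_hX_le ω b v
  refine h.trans ?_
  gcongr

end OscOp

section Uncertainty

variable {Z : Type*} [NormedAddCommGroup Z] [NormedSpace ℝ Z] [FiniteDimensional ℝ Z]
  [MeasureSpace Z] [BorelSpace Z] [(volume : Measure Z).IsAddHaarMeasure]

lemma RapidFun.integrable_mul_conj {f g : Z → ℂ} (hf : RapidFun f) (hg : RapidFun g) :
    Integrable (fun z => f z * conj (g z)) := (hf.mul_conj hg).integrable

lemma norm_integral_mul_conj_le {f g : Z → ℂ} (hf : RapidFun f) (hg : RapidFun g) :
    2 * ‖∫ z, f z * conj (g z)‖ ≤ (∫ z, ‖f z‖ ^ 2) + ∫ z, ‖g z‖ ^ 2 := by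
  rw [← integral_add hf.integrable_norm_sq hg.integrable_norm_sq]
  calc _ ≤ 2 * ∫ z, ‖f z * conj (g z)‖ := by
        gcongr; exact norm_integral_le_integral_norm _
    _ = ∫ z, 2 * ‖f z * conj (g z)‖ := (integral_const_mul _ _).symm
    _ ≤ _ := by
        refine integral_mono ((hf.integrable_mul_conj hg).norm.const_mul 2)
          (hf.integrable_norm_sq.add hg.integrable_norm_sq) fun z => ?_
        simp only [norm_mul, RCLike.norm_conj]
        nlinarith [sq_nonneg (‖f z‖ - ‖g z‖)]

lemma uncertainty_osc_til {δ r : ℝ} (hδ : 0 < δ) (hr : δ ≤ r) (ω : Z →L[ℝ] Z →L[ℝ] ℝ)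
    (hω : ∀ ξ η, ω ξ η = -ω η ξ) (ξ η : Z) (v : 𝓢(Z × ℝ, ℂ)) :
    8 * Real.pi * |ω ξ η| * ∫ z, ‖osc δ (til δ v) r 0 z‖ ^ 2 ≤
      (∫ z, ‖osc δ (tilX δ ω ξ v) r 0 z‖ ^ 2) + ∫ z, ‖osc δ (tilX δ ω η v) r 0 z‖ ^ 2 := by
  have hY := rapidFamily_til hδ v
  have hA := rapidFamily_tilX hδ ω ξ v
  have hE := rapidFamily_tilX hδ ω η v
  have hXE := (rapidFamily_tilX hδ ω ξ (hX ω η v)).rtc_inv_mul hδ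
  have hEX := (rapidFamily_tilX hδ ω η (hX ω ξ v)).rtc_inv_mul hδ
  have R : ∀ {g : ℝ → Z → ℂ}, RapidFamily δ g → RapidFun (osc δ g r 0) := fun hg =>
    (hg.osc hδ 0).rapidFun hr
  have t1 := TwistedDeriv.osc (δ := δ) hY.cont hA.cont (twistedDeriv_til hδ ω ξ v) r 0
  have t2 := TwistedDeriv.osc (δ := δ) hY.cont hE.cont (twistedDeriv_til hδ ω η v) r 0
  have t3 := TwistedDeriv.osc (δ := δ) hE.cont hXE.cont
    (fun l => (twistedDeriv_til hδ ω ξ (hX ω η v) l).const_mul ((rtc δ l)⁻¹ : ℂ)) r 0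
  have t4 := TwistedDeriv.osc (δ := δ) hA.cont hEX.cont
    (fun l => (twistedDeriv_til hδ ω η (hX ω ξ v) l).const_mul ((rtc δ l)⁻¹ : ℂ)) r 0
  have e1 := integral_twistedDeriv_mul_conj (R hE) (R hXE) (R hY) (R hA) t3 t1
  have e2 := integral_twistedDeriv_mul_conj (R hA) (R hEX) (R hY) (R hE) t4 t2
  have hcomm : ∀ z, osc δ (fun l z => ((rtc δ l)⁻¹ : ℂ) * tilX δ ω ξ (hX ω η v) l z) r 0 z -
      osc δ (fun l z => ((rtc δ l)⁻¹ : ℂ) * tilX δ ω η (hX ω ξ v) l z) r 0 z =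
      -(8 * Real.pi * Complex.I * ω ξ η) * osc δ (til δ v) r 0 z := by
    intro z
    rw [sub_eq_iff_eq_add, ← osc_const_mul, ← osc_add ?_ hEX]
    · refine osc_congr hr 0 z fun l hl => ?_
      have h := til_add δ ((-4 * ω ξ η : ℂ) • vT v) (hX ω η (hX ω ξ v)) l z
      rw [← hX_comm ω hω, sub_add_cancel, hX_comm ω hω, til_smul, til_vT, max_eq_right hl] at h
      have h0 : (rtc δ l : ℂ) ≠ 0 := by exact_mod_cast (rtc_pos hδ l).ne'
      have h2 : (l : ℂ) = (rtc δ l : ℂ) ^ 2 := by exact_mod_cast (rtc_sq_of_le hδ hl).symm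
      simp only [tilX]
      rw [h, h2]
      field_simp
      ring
    · have := ((rapidFamily_til hδ ((-(8 * Real.pi * Complex.I * ω ξ η)) • v)))
      have h2 : til δ ((-(8 * Real.pi * Complex.I * ω ξ η)) • v) =
        fun l z => -(8 * Real.pi * Complex.I * ω ξ η) * til δ v l z := by
        ext l z; exact til_smul _ _ _ _ _
      rwa [h2] at this
  have e3 : -(8 * Real.pi * Complex.I * ω ξ η) * (∫ z, ‖osc δ (til δ v) r 0 z‖ ^ 2 : ℝ) =
      -(∫ z, osc δ (tilX δ ω η v) r 0 z * conj (osc δ (tilX δ ω ξ v) r 0 z)) +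
      ∫ z, osc δ (tilX δ ω ξ v) r 0 z * conj (osc δ (tilX δ ω η v) r 0 z) := by
    rw [← e1, ← neg_neg (∫ z, osc δ (tilX δ ω ξ v) r 0 z * conj (osc δ (tilX δ ω η v) r 0 z)),
      ← e2, ← sub_eq_add_neg, ← integral_sub ((R hXE).integrable_mul_conj (R hY))
      ((R hEX).integrable_mul_conj (R hY)), ← integral_complex_ofReal, ← integral_const_mul]
    refine integral_congr_ae (.of_forall fun z => ?_)
    simp only
    rw [← sub_mul, hcomm, Complex.ofReal_pow, ← Complex.mul_conj']
    ring
  have h1 := norm_integral_mul_conj_le (R hE) (R hA)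
  have h2 := norm_integral_mul_conj_le (R hA) (R hE)
  have e4 := congrArg norm e3
  have e5 := norm_add_le (-(∫ z, osc δ (tilX δ ω η v) r 0 z * conj (osc δ (tilX δ ω ξ v) r 0 z)))
    (∫ z, osc δ (tilX δ ω ξ v) r 0 z * conj (osc δ (tilX δ ω η v) r 0 z))
  rw [← e4, norm_neg, norm_mul, norm_neg, norm_mul, norm_mul, norm_mul, Complex.norm_real,
    Complex.norm_real, Complex.norm_real, Complex.norm_I, Real.norm_eq_abs, Real.norm_eq_abs,
    Real.norm_eq_abs, abs_of_pos Real.pi_pos,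
    abs_of_nonneg (integral_nonneg fun z => by positivity), mul_one] at e5
  norm_num at e5
  linarith

lemma integrable_radial_oscEnergy (d : ℕ) {δ : ℝ} (hδ : 0 < δ) {g : ℝ → Z → ℂ}
    (hg : RapidFamily δ g) :
    IntegrableOn (fun r => radialWeight d r * ∫ z, ‖osc δ g r 0 z‖ ^ 2) (Set.Ioi δ) := by
  have h := integrable_oscEnergy d hδ hg
  unfold radMeasure at h
  have := h.integral_prod_left
  simp_rw [integral_const_mul] at this
  exact this

lemma oscEnergy_eq (d : ℕ) {δ : ℝ} (hδ : 0 < δ) {g : ℝ → Z → ℂ} (hg : RapidFamily δ g) :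
    oscEnergy d δ g = ∫ r in Set.Ioi δ, radialWeight d r * ∫ z, ‖osc δ g r 0 z‖ ^ 2 := by
  have h := integrable_oscEnergy d hδ hg
  unfold oscEnergy radMeasure at *
  rw [integral_prod _ h]
  simp_rw [integral_const_mul]

lemma oscEnergy_til_le (d : ℕ) {δ : ℝ} (hδ : 0 < δ) (ω : Z →L[ℝ] Z →L[ℝ] ℝ)
    (hω : ∀ ξ η, ω ξ η = -ω η ξ) (ξ η : Z) (v : 𝓢(Z × ℝ, ℂ)) :
    8 * Real.pi * |ω ξ η| * oscEnergy d δ (til δ v) ≤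
      oscEnergy d δ (tilX δ ω ξ v) + oscEnergy d δ (tilX δ ω η v) := by
  have hY := rapidFamily_til hδ v
  have hA := rapidFamily_tilX hδ ω ξ v
  have hE := rapidFamily_tilX hδ ω η v
  rw [oscEnergy_eq d hδ hY, oscEnergy_eq d hδ hA, oscEnergy_eq d hδ hE, ← integral_const_mul,
    ← integral_add (integrable_radial_oscEnergy d hδ hA) (integrable_radial_oscEnergy d hδ hE)]
  refine setIntegral_mono_on ((integrable_radial_oscEnergy d hδ hY).const_mul _)
    ((integrable_radial_oscEnergy d hδ hA).add (integrable_radial_oscEnergy d hδ hE))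
    measurableSet_Ioi fun r hr => ?_
  have h := mul_le_mul_of_nonneg_left (uncertainty_osc_til hδ (le_of_lt hr) ω hω ξ η v)
    (radialWeight_nonneg d (hδ.trans hr))
  linarith

end Uncertainty

section HighFrequency

variable {Z : Type*} [NormedAddCommGroup Z] [NormedSpace ℝ Z] [FiniteDimensional ℝ Z]
  [MeasureSpace Z] [BorelSpace Z] [(volume : Measure Z).IsAddHaarMeasure]

lemma abs_inv_pow_le {δ l : ℝ} (hδ : 0 < δ) (hl : δ < l) (d : ℕ) : |(l ^ d)⁻¹| ≤ (δ ^ d)⁻¹ := by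
  have := hδ.trans hl
  rw [abs_of_pos (by positivity)]
  gcongr

lemma integrable_norm_sq_div {δ : ℝ} (hδ : 0 < δ) (d : ℕ) {h : ℝ → Z → ℂ}
    (hh : RapidFamily δ h) :
    Integrable (fun p : ℝ × Z => (p.1 ^ d)⁻¹ * ‖h p.1 p.2‖ ^ 2) (radMeasure Z δ) := by
  have := hh.integrable_mul_conj hδ hh (k := fun l => (l ^ d)⁻¹) (by fun_prop)
    fun r hr => abs_inv_pow_le hδ hr d
  refine this.re.congr (.of_forall fun p => ?_)
  simp only [Complex.mul_conj', ← Complex.ofReal_pow, ← Complex.ofReal_mul]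
  rfl

lemma integral_norm_sq_til_div_le {δ : ℝ} (hδ : 0 < δ) {d : ℕ}
    (hZ : Module.finrank ℝ Z = 2 * d) (w : 𝓢(Z × ℝ, ℂ)) :
    ∫ p : ℝ × Z, (p.1 ^ d)⁻¹ * ‖til δ w p.1 p.2‖ ^ 2 ∂(radMeasure Z δ) ≤ sqInt w := by
  have h := lintegral_til_le hδ hZ w (g := til δ w) zero_le_one fun l _ z => (one_mul _).ge
  have hi := (integrable_norm_sq_div hδ d (rapidFamily_til hδ w)).const_mul 2⁻¹
  have hc : Measurable fun p : ℝ × Z => til δ w p.1 p.2 := (continuous_til hδ w).measurable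
  have h2 : ENNReal.ofReal (∫ p : ℝ × Z, 2⁻¹ * ((p.1 ^ d)⁻¹ * ‖til δ w p.1 p.2‖ ^ 2)
      ∂(radMeasure Z δ)) ≤ ENNReal.ofReal (1 / 2 * sqInt w) := by
    rw [ofReal_integral_eq_lintegral_ofReal hi]
    · refine le_trans (le_of_eq ?_) h
      unfold radMeasure
      rw [lintegral_prod _ (by fun_prop)]
      refine lintegral_congr fun l => lintegral_congr fun z => ?_
      congr 1
      ring
    · filter_upwards [ae_radMeasure δ] with p hp
      have := hδ.trans hp
      positivity
  have h3 := (ENNReal.ofReal_le_ofReal_iff (mul_nonneg (by norm_num) (sqInt_nonneg w))).1 h2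
  rw [integral_const_mul] at h3
  linarith

lemma norm_integral_osc_mul_conj_le {δ K : ℝ} (hδ : 0 < δ) (hK : 0 < K) (d : ℕ)
    {g h : ℝ → Z → ℂ} (hg : RapidFamily δ g) (hh : RapidFamily δ h) {k : ℝ → ℝ}
    (hk2 : ∀ l, δ < l → k l ^ 2 ≤ radialWeight d l * (l ^ d)⁻¹) :
    2 * ‖∫ p : ℝ × Z, (k p.1 : ℂ) * (osc δ g p.1 0 p.2 * conj (h p.1 p.2)) ∂(radMeasure Z δ)‖ ≤
      K * oscEnergy d δ g + K⁻¹ * ∫ p : ℝ × Z, (p.1 ^ d)⁻¹ * ‖h p.1 p.2‖ ^ 2 ∂(radMeasure Z δ) := by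
  have i1 := (integrable_oscEnergy d hδ hg).const_mul (K / 2)
  have i2 := (integrable_norm_sq_div hδ d hh).const_mul (K⁻¹ / 2)
  have := norm_integral_le_of_norm_le (f := fun p : ℝ × Z =>
    (k p.1 : ℂ) * (osc δ g p.1 0 p.2 * conj (h p.1 p.2))) (i1.add i2) (by
    filter_upwards [ae_radMeasure δ] with p hp
    have hp0 := hδ.trans hp
    rw [norm_mul, norm_mul, RCLike.norm_conj, Complex.norm_real, Real.norm_eq_abs]
    have ha := radialWeight_nonneg d hp0
    have hc : 0 ≤ (p.1 ^ d)⁻¹ := by positivity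
    set a := radialWeight d p.1
    set c := (p.1 ^ d)⁻¹
    set x := ‖osc δ g p.1 0 p.2‖
    set y := ‖h p.1 p.2‖
    have h1 : |k p.1| ≤ √a * √c := by
      rw [← Real.sqrt_mul ha]
      exact Real.abs_le_sqrt (hk2 _ hp)
    have h2 := Real.sq_sqrt ha
    have h3 := Real.sq_sqrt hc
    have h4 : K⁻¹ = (√K)⁻¹ ^ 2 := by rw [inv_pow, Real.sq_sqrt hK.le]
    have h5 : K = √K ^ 2 := (Real.sq_sqrt hK.le).symm
    have h6 : √K * (√K)⁻¹ = 1 := mul_inv_cancel₀ (Real.sqrt_pos.2 hK).ne'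
    calc _ ≤ (√a * √c) * (x * y) := by gcongr
      _ = (√K * √a * x) * ((√K)⁻¹ * √c * y) := by linear_combination (-√a * √c * x * y) * h6
      _ ≤ ((√K * √a * x) ^ 2 + ((√K)⁻¹ * √c * y) ^ 2) / 2 := by
          linarith [two_mul_le_add_sq (√K * √a * x) ((√K)⁻¹ * √c * y)]
      _ = ((√K ^ 2) * (√a ^ 2 * x ^ 2) + ((√K)⁻¹ ^ 2) * (√c ^ 2 * y ^ 2)) / 2 := by ring
      _ = K / 2 * (a * x ^ 2) + K⁻¹ / 2 * (c * y ^ 2) := by rw [h2, h3, ← h4, ← h5]; ring)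
  simp only [Pi.add_apply] at this
  rw [integral_add i1 i2, integral_const_mul, integral_const_mul] at this
  unfold oscEnergy
  linarith

lemma integral_radial_by_parts {ι : Type*} [Fintype ι] {δ : ℝ} (hδ : 0 < δ) {d : ℕ}
    (hι : Fintype.card ι = 2 * d) (ω : Z →L[ℝ] Z →L[ℝ] ℝ) (hω : ∀ ξ η, ω ξ η = -ω η ξ)
    (b : Module.Basis ι ℝ Z) (v w : 𝓢(Z × ℝ, ℂ)) :
    ∫ p : ℝ × Z, (((p.1 ^ d)⁻¹ : ℝ) : ℂ) * (til δ v p.1 p.2 * conj (til δ w p.1 p.2))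
      ∂(radMeasure Z δ) =
    ∫ p : ℝ × Z, (((p.1 ^ d)⁻¹ : ℝ) : ℂ) * (osc δ (til δ v) p.1 0 p.2 *
        conj (til δ (w + (2 * Real.pi * Complex.I) • mulT w) p.1 p.2)) ∂(radMeasure Z δ) +
    ∫ p : ℝ × Z, (((p.1 ^ d)⁻¹ * (2 * p.1)⁻¹ : ℝ) : ℂ) * (osc δ (til δ v) p.1 0 p.2 *
        conj (til δ (hDiv ω b w) p.1 p.2)) ∂(radMeasure Z δ) := by
  have hv := rapidFamily_til hδ v
  have hY := hv.osc hδ 0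
  have hw := rapidFamily_til hδ w
  have hk : ∀ l, δ < l → |(l ^ d)⁻¹ * (2 * l)⁻¹| ≤ (δ ^ d)⁻¹ * (2 * δ)⁻¹ := fun l hl => by
    have h1 := abs_inv_pow_le hδ hl d
    have := hδ.trans hl
    rw [abs_mul]
    gcongr
    rw [abs_of_pos (by positivity)]
    gcongr
  have i1 := hv.integrable_mul_conj hδ hw (k := fun l => (l ^ d)⁻¹) (by fun_prop)
    fun r hr => abs_inv_pow_le hδ hr d
  have i2 := hY.integrable_mul_conj hδ
    (rapidFamily_til hδ (w + (2 * Real.pi * Complex.I) • mulT w))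
    (k := fun l => (l ^ d)⁻¹) (by fun_prop) fun r hr => abs_inv_pow_le hδ hr d
  have i3 := hY.integrable_mul_conj hδ (rapidFamily_til hδ (hDiv ω b w))
    (k := fun l => (l ^ d)⁻¹ * (2 * l)⁻¹) (by fun_prop) hk
  have i23 : Integrable (fun p : ℝ × Z => (((p.1 ^ d)⁻¹ : ℝ) : ℂ) * (osc δ (til δ v) p.1 0 p.2 *
        conj (til δ (w + (2 * Real.pi * Complex.I) • mulT w) p.1 p.2)) +
      (((p.1 ^ d)⁻¹ * (2 * p.1)⁻¹ : ℝ) : ℂ) * (osc δ (til δ v) p.1 0 p.2 *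
        conj (til δ (hDiv ω b w) p.1 p.2))) (radMeasure Z δ) := i2.add i3
  have i4 : Integrable (fun p : ℝ × Z =>
      (((p.1 ^ d)⁻¹ : ℝ) : ℂ) * (til δ v p.1 p.2 * conj (til δ w p.1 p.2)) -
      ((((p.1 ^ d)⁻¹ : ℝ) : ℂ) * (osc δ (til δ v) p.1 0 p.2 *
        conj (til δ (w + (2 * Real.pi * Complex.I) • mulT w) p.1 p.2)) +
      (((p.1 ^ d)⁻¹ * (2 * p.1)⁻¹ : ℝ) : ℂ) * (osc δ (til δ v) p.1 0 p.2 *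
        conj (til δ (hDiv ω b w) p.1 p.2)))) (radMeasure Z δ) := i1.sub i23
  rw [← integral_add i2 i3, ← sub_eq_zero, ← integral_sub i1 i23]
  unfold radMeasure at i4 ⊢
  rw [integral_prod_symm _ i4]
  refine integral_eq_zero_of_ae ?_
  filter_upwards [i4.prod_left_ae] with z hz
  set G : ℝ → ℂ := fun l => (((l ^ d)⁻¹ : ℝ) : ℂ) * (osc δ (til δ v) l 0 z * conj (til δ w l z))
    with hG
  have hYc : Continuous fun l => osc δ (til δ v) l 0 z :=
    (continuous_osc (δ := δ) hv.cont).comp (f := fun l : ℝ => (l, (0 : ℝ), z)) (by fun_prop)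
  have hwc : Continuous fun l => conj (til δ w l z) :=
    Complex.continuous_conj.comp (hw.cont.comp (f := fun l : ℝ => (l, z)) (by fun_prop))
  have hcont : ContinuousWithinAt G (Set.Ici δ) δ := by
    refine ContinuousAt.continuousWithinAt ?_
    refine ContinuousAt.mul ?_ (hYc.mul hwc).continuousAt
    refine Complex.continuous_ofReal.continuousAt.comp ?_
    exact ContinuousAt.inv₀ (by fun_prop) (by positivity)
  have hlim : Filter.Tendsto G Filter.atTop (nhds 0) := by
    obtain ⟨C, hC0, hC⟩ := hY.decay 0 0
    obtain ⟨D, hD0, hD⟩ := hw.decay 0 1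
    have h0 : Filter.Tendsto (fun l : ℝ => ((δ ^ d)⁻¹ * C * D) * (1 + l)⁻¹) Filter.atTop
        (nhds 0) := by
      rw [← mul_zero ((δ ^ d)⁻¹ * C * D)]
      exact (tendsto_inv_atTop_zero.comp
        (Filter.tendsto_atTop_add_const_left _ 1 Filter.tendsto_id)).const_mul _
    refine squeeze_zero_norm' ?_ h0
    filter_upwards [Filter.eventually_gt_atTop δ] with l hl
    have h1 := hC l hl.le z
    have h2 := hD l hl.le z
    have h3 := abs_inv_pow_le hδ hl d
    rw [pow_zero, pow_zero, inv_one, mul_one, mul_one] at h1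
    rw [pow_zero, pow_one, inv_one, mul_one] at h2
    rw [hG, norm_mul, norm_mul, RCLike.norm_conj, Complex.norm_real, Real.norm_eq_abs]
    calc _ ≤ (δ ^ d)⁻¹ * (C * (D * (1 + l)⁻¹)) := by gcongr
      _ = _ := by ring
  have hderiv : ∀ l ∈ Set.Ioi δ, HasDerivAt G
      ((((l ^ d)⁻¹ : ℝ) : ℂ) * (til δ v l z * conj (til δ w l z)) -
        ((((l ^ d)⁻¹ : ℝ) : ℂ) * (osc δ (til δ v) l 0 z *
          conj (til δ (w + (2 * Real.pi * Complex.I) • mulT w) l z)) +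
        (((l ^ d)⁻¹ * (2 * l)⁻¹ : ℝ) : ℂ) * (osc δ (til δ v) l 0 z *
          conj (til δ (hDiv ω b w) l z)))) l := by
    intro l hl
    have hl0 : 0 < l := hδ.trans hl
    have h1 : HasDerivAt (fun l : ℝ => (l ^ d)⁻¹) (-(d * l⁻¹ * (l ^ d)⁻¹)) l := by
      refine ((hasDerivAt_pow d l).fun_inv (by positivity)).congr_deriv ?_
      rcases d with _ | d
      · simp
      · simp only [Nat.add_sub_cancel]
        field_simp
        ring
    have h2 := hasDerivAt_osc_radius (δ := δ) hv.cont l 0 z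
    have h3 : HasDerivAt (fun l => conj (til δ w l z)) _ l :=
      (hasDerivAt_til hδ hl ω hω b w z).star
    refine (h1.ofReal_comp.fun_mul (h2.fun_mul h3)).congr_deriv ?_
    rw [mul_zero, unitPhase_zero, til_add, til_smul, til_smul, hι]
    simp only [← starRingEnd_apply, map_mul, map_sub, map_add, map_neg, map_inv₀,
      Complex.conj_I, Complex.conj_ofReal, map_ofNat, map_natCast]
    have : (l : ℂ) ≠ 0 := by exact_mod_cast hl0.ne'
    push_cast
    field_simp
    ring
  have := integral_Ioi_of_hasDerivAt_of_tendsto hcont hderiv hz hlim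
  rw [this, hG]
  simp [osc_self]

end HighFrequency

section HighFrequencyBound

variable {Z : Type*} [NormedAddCommGroup Z] [NormedSpace ℝ Z] [FiniteDimensional ℝ Z]
  [MeasureSpace Z] [BorelSpace Z] [(volume : Measure Z).IsAddHaarMeasure]

/-- The radial weight of the lower-order terms in the radial integration by parts. -/
def lowerWeight (d : ℕ) (δ l : ℝ) : ℝ := (l ^ d)⁻¹ * (2 * l)⁻¹ * rtc δ l

lemma measurable_lowerWeight (d : ℕ) (δ : ℝ) : Measurable (lowerWeight d δ) := by
  unfold lowerWeight
  have := (continuous_rtc δ).measurable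
  fun_prop

lemma lowerWeight_sq {δ l : ℝ} (hδ : 0 < δ) (hl : δ < l) (d : ℕ) :
    lowerWeight d δ l ^ 2 = (l ^ d)⁻¹ ^ 2 * (4 * l)⁻¹ := by
  have := hδ.trans hl
  rw [lowerWeight, mul_pow, rtc_sq_of_le hδ hl.le]
  field_simp
  norm_num

lemma lowerWeight_sq_le {δ l : ℝ} (hδ : 0 < δ) (hl : δ < l) {d : ℕ} (hd : 1 ≤ d) :
    lowerWeight d δ l ^ 2 ≤ radialWeight d l * (l ^ d)⁻¹ := by
  have := hδ.trans hl
  have hd' : (1 : ℝ) ≤ d := by exact_mod_cast hd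
  rw [lowerWeight_sq hδ hl, radialWeight]
  have h : (4 * l)⁻¹ ≤ 1 + d / (2 * l) := by
    rw [← sub_nonneg]
    have : 1 + d / (2 * l) - (4 * l)⁻¹ = 1 + (2 * d - 1) / (4 * l) := by field_simp; ring
    rw [this]
    have : 0 ≤ 2 * (d : ℝ) - 1 := by linarith
    positivity
  calc _ ≤ (l ^ d)⁻¹ ^ 2 * (1 + d / (2 * l)) := by gcongr
    _ = _ := by ring

lemma abs_lowerWeight_le {δ l : ℝ} (hδ : 0 < δ) (hl : δ < l) (d : ℕ) :
    |lowerWeight d δ l| ≤ √((δ ^ d)⁻¹ ^ 2 * (4 * δ)⁻¹) := by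
  refine Real.abs_le_sqrt ?_
  have := hδ.trans hl
  rw [lowerWeight_sq hδ hl]
  gcongr

lemma inv_pow_sq_le_radialWeight {l : ℝ} (hl : 0 < l) (d : ℕ) :
    (l ^ d)⁻¹ ^ 2 ≤ radialWeight d l * (l ^ d)⁻¹ := by
  have h : 1 ≤ 1 + d / (2 * l) := le_add_of_nonneg_right (by positivity)
  calc (l ^ d)⁻¹ ^ 2 = (l ^ d)⁻¹ ^ 2 * 1 := (mul_one _).symm
    _ ≤ (l ^ d)⁻¹ ^ 2 * (1 + d / (2 * l)) := by gcongr
    _ = _ := by rw [radialWeight]; ring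

lemma integral_osc_til_hX {δ : ℝ} (hδ : 0 < δ) (ω : Z →L[ℝ] Z →L[ℝ] ℝ) (ξ : Z)
    (v w : 𝓢(Z × ℝ, ℂ)) {l : ℝ} (hl : δ < l) :
    ∫ z, osc δ (til δ v) l 0 z * conj (til δ (hX ω ξ w) l z) =
      -∫ z, (rtc δ l : ℂ) * (osc δ (tilX δ ω ξ v) l 0 z * conj (til δ w l z)) := by
  have hv := rapidFamily_til hδ v
  have hvX := rapidFamily_tilX hδ ω ξ v
  have hw := rapidFamily_til hδ w
  have := integral_twistedDeriv_mul_conj (ω := ω) (ξ := ξ)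
    ((hv.osc hδ 0).rapidFun hl.le) ((hvX.osc hδ 0).rapidFun hl.le)
    ((hw.rtc_mul hδ).rapidFun hl.le) ((rapidFamily_til hδ (hX ω ξ w)).rapidFun hl.le)
    (TwistedDeriv.osc (δ := δ) hv.cont hvX.cont (fun l => twistedDeriv_til hδ ω ξ v l) l 0)
    (twistedDeriv_rtc_mul_til hδ ω ξ w l)
  rw [← neg_eq_iff_eq_neg] at this
  rw [← this]
  congr 1
  refine integral_congr_ae (.of_forall fun z => ?_)
  simp only [map_mul, Complex.conj_ofReal]
  ring

lemma integral_osc_til_hDiv {ι : Type*} [Fintype ι] {δ : ℝ} (hδ : 0 < δ) (d : ℕ)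
    (ω : Z →L[ℝ] Z →L[ℝ] ℝ) (b : Module.Basis ι ℝ Z) (v w : 𝓢(Z × ℝ, ℂ)) :
    ∫ p : ℝ × Z, (((p.1 ^ d)⁻¹ * (2 * p.1)⁻¹ : ℝ) : ℂ) * (osc δ (til δ v) p.1 0 p.2 *
        conj (til δ (hDiv ω b w) p.1 p.2)) ∂(radMeasure Z δ) =
      -∑ i, ∫ p : ℝ × Z, (lowerWeight d δ p.1 : ℂ) * (osc δ (tilX δ ω (b i) v) p.1 0 p.2 *
        conj (til δ (mulZ (crd b i) w) p.1 p.2)) ∂(radMeasure Z δ) := by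
  have hY := (rapidFamily_til hδ v).osc hδ 0
  have hk : ∀ l, δ < l → |(l ^ d)⁻¹ * (2 * l)⁻¹| ≤ (δ ^ d)⁻¹ * (2 * δ)⁻¹ := fun l hl => by
    have h1 := abs_inv_pow_le hδ hl d
    have := hδ.trans hl
    rw [abs_mul]
    gcongr
    rw [abs_of_pos (by positivity)]
    gcongr
  have i1 : ∀ i, Integrable (fun p : ℝ × Z => (((p.1 ^ d)⁻¹ * (2 * p.1)⁻¹ : ℝ) : ℂ) *
      (osc δ (til δ v) p.1 0 p.2 * conj (til δ (hX ω (b i) (mulZ (crd b i) w)) p.1 p.2)))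
      (radMeasure Z δ) := fun i =>
    hY.integrable_mul_conj hδ (rapidFamily_til hδ _) (k := fun l => (l ^ d)⁻¹ * (2 * l)⁻¹)
      (by fun_prop) hk
  have i2 : ∀ i, Integrable (fun p : ℝ × Z => (lowerWeight d δ p.1 : ℂ) *
      (osc δ (tilX δ ω (b i) v) p.1 0 p.2 * conj (til δ (mulZ (crd b i) w) p.1 p.2)))
      (radMeasure Z δ) := fun i =>
    ((rapidFamily_tilX hδ ω (b i) v).osc hδ 0).integrable_mul_conj hδ (rapidFamily_til hδ _)
      (measurable_lowerWeight d δ) fun l hl => abs_lowerWeight_le hδ hl d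
  simp only [hDiv, til_sum, map_sum, Finset.mul_sum]
  rw [integral_finsetSum _ fun i _ => i1 i, ← Finset.sum_neg_distrib]
  refine Finset.sum_congr rfl fun i _ => ?_
  have j1 := i1 i
  have j2 := i2 i
  unfold radMeasure at j1 j2 ⊢
  rw [integral_prod _ j1, integral_prod _ j2, ← integral_neg]
  refine setIntegral_congr_fun measurableSet_Ioi fun l hl => ?_
  simp only
  rw [integral_const_mul, integral_osc_til_hX hδ ω (b i) v _ hl, ← integral_neg,
    ← integral_const_mul, ← integral_neg]
  refine integral_congr_ae (.of_forall fun z => ?_)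
  simp only [lowerWeight]
  push_cast
  ring

lemma integral_radial_til_mul_conj {δ : ℝ} (hδ : 0 < δ) {d : ℕ}
    (hZ : Module.finrank ℝ Z = 2 * d) (v w : 𝓢(Z × ℝ, ℂ)) :
    ∫ l in Set.Ioi δ, ∫ z, pft v z l * conj (pft w z l) =
      ∫ p : ℝ × Z, (((p.1 ^ d)⁻¹ : ℝ) : ℂ) * (til δ v p.1 p.2 * conj (til δ w p.1 p.2))
        ∂(radMeasure Z δ) := by
  have i1 := (rapidFamily_til hδ v).integrable_mul_conj hδ (rapidFamily_til hδ w)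
    (k := fun l => (l ^ d)⁻¹) (by fun_prop) fun r hr => abs_inv_pow_le hδ hr d
  unfold radMeasure at i1 ⊢
  rw [integral_prod _ i1]
  refine setIntegral_congr_fun measurableSet_Ioi fun l hl => ?_
  have hl0 : (l : ℂ) ≠ 0 := by exact_mod_cast (hδ.trans hl).ne'
  simp only
  rw [integral_const_mul, integral_til_mul_conj hδ (le_of_lt hl) hZ]
  push_cast
  field_simp

lemma norm_integral_high_le {ι : Type*} [Fintype ι] {δ K : ℝ} (hδ : 0 < δ) (hK : 0 < K) {d : ℕ}
    (hd : 1 ≤ d) (hZ : Module.finrank ℝ Z = 2 * d)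
    (ω : Z →L[ℝ] Z →L[ℝ] ℝ) (hω : ∀ ξ η, ω ξ η = -ω η ξ)
    (b : Module.Basis ι ℝ Z) (v w : 𝓢(Z × ℝ, ℂ)) :
    2 * ‖∫ l in Set.Ioi δ, ∫ z, pft v z l * conj (pft w z l)‖ ≤
      K * (oscEnergy d δ (til δ v) + ∑ i, oscEnergy d δ (tilX δ ω (b i) v)) +
      K⁻¹ * (sqInt (w + (2 * Real.pi * Complex.I) • mulT w) +
        ∑ i, sqInt (mulZ (crd b i) w)) := by
  have hι : Fintype.card ι = 2 * d := by rw [← hZ, Module.finrank_eq_card_basis b]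
  rw [integral_radial_til_mul_conj hδ hZ, integral_radial_by_parts hδ hι ω hω b,
    integral_osc_til_hDiv hδ d ω b v w]
  have hK' := inv_pos.2 hK
  have h1 := (norm_integral_osc_mul_conj_le hδ hK d (rapidFamily_til hδ v)
    (rapidFamily_til hδ (w + (2 * Real.pi * Complex.I) • mulT w)) (k := fun l => (l ^ d)⁻¹)
    fun l hl => inv_pow_sq_le_radialWeight (hδ.trans hl) d).trans
    (add_le_add le_rfl (mul_le_mul_of_nonneg_left (integral_norm_sq_til_div_le hδ hZ _) hK'.le))
  have h2 := fun i => (norm_integral_osc_mul_conj_le hδ hK d (rapidFamily_tilX hδ ω (b i) v)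
    (rapidFamily_til hδ (mulZ (crd b i) w)) (k := lowerWeight d δ)
    fun l hl => lowerWeight_sq_le hδ hl hd).trans
    (add_le_add le_rfl (mul_le_mul_of_nonneg_left (integral_norm_sq_til_div_le hδ hZ _) hK'.le))
  have h3 := Finset.sum_le_sum fun i (_ : i ∈ Finset.univ) => h2 i
  rw [← Finset.mul_sum, Finset.sum_add_distrib, ← Finset.mul_sum, ← Finset.mul_sum] at h3
  refine (mul_le_mul_of_nonneg_left ((norm_add_le _ _).trans (add_le_add le_rfl
    ((norm_neg _).trans_le (norm_sum_le _ _)))) two_pos.le).trans ?_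
  linarith

end HighFrequencyBound

section Reflection

variable {Z : Type*} [NormedAddCommGroup Z] [NormedSpace ℝ Z]

/-- The reflection `(z, t) ↦ (z, -t)`. -/
def reflEquiv (Z : Type*) [NormedAddCommGroup Z] [NormedSpace ℝ Z] : (Z × ℝ) ≃L[ℝ] (Z × ℝ) :=
  (ContinuousLinearEquiv.refl ℝ Z).prodCongr (ContinuousLinearEquiv.neg ℝ)

/-- Composition of a Schwartz function with the reflection `(z, t) ↦ (z, -t)`. -/
def reflT : 𝓢(Z × ℝ, ℂ) →L[ℂ] 𝓢(Z × ℝ, ℂ) :=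
  compCLMOfContinuousLinearEquiv ℂ (reflEquiv Z)

lemma reflT_apply (v : 𝓢(Z × ℝ, ℂ)) (p : Z × ℝ) : reflT v p = v (p.1, -p.2) := rfl

lemma pft_reflT (v : 𝓢(Z × ℝ, ℂ)) (z : Z) (l : ℝ) : pft (reflT v) z l = pft v z (-l) := by
  rw [pft, ← integral_neg_eq_self]
  simp [pft, reflT_apply]

lemma hX_reflT (ω : Z →L[ℝ] Z →L[ℝ] ℝ) (ξ : Z) (v : 𝓢(Z × ℝ, ℂ)) :
    hX (-ω) ξ (reflT v) = reflT (hX ω ξ v) := by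
  ext p
  rw [hX_apply, reflT_apply, hX_apply]
  have : HasFDerivAt (reflT v) ((fderiv ℝ v (p.1, -p.2)).comp
      (reflEquiv Z : (Z × ℝ) →L[ℝ] (Z × ℝ))) p :=
    HasFDerivAt.comp (g := v) (f := reflEquiv Z) p
      (v.differentiableAt (x := (p.1, -p.2))).hasFDerivAt (reflEquiv Z).hasFDerivAt
  rw [this.fderiv]
  simp [reflEquiv]

lemma hLap_reflT {ι : Type*} [Fintype ι] (ω : Z →L[ℝ] Z →L[ℝ] ℝ) (b : ι → Z)
    (v : 𝓢(Z × ℝ, ℂ)) : hLap (-ω) b (reflT v) = reflT (hLap ω b v) := by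
  simp only [hLap, hX_reflT, map_sum]

end Reflection

section ReflectionIntegral

variable {Z : Type*} [NormedAddCommGroup Z] [NormedSpace ℝ Z] [FiniteDimensional ℝ Z]
  [MeasureSpace Z] [BorelSpace Z] [(volume : Measure Z).IsAddHaarMeasure]

lemma integral_comp_reflT {F : Type*} [NormedAddCommGroup F] [NormedSpace ℝ F]
    (f : Z × ℝ → F) : ∫ p : Z × ℝ, f (p.1, -p.2) = ∫ p, f p := by
  have h : MeasurePreserving (fun p : Z × ℝ => (p.1, -p.2)) volume volume :=
    (MeasurePreserving.id volume).prod (Measure.measurePreserving_neg volume)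
  exact h.integral_comp
    (reflEquiv Z).toHomeomorph.measurableEmbedding f

lemma sqInt_reflT (v : 𝓢(Z × ℝ, ℂ)) : sqInt (reflT v) = sqInt v :=
  integral_comp_reflT fun p => ‖v p‖ ^ 2

lemma integrable_pft_mul_conj (v w : 𝓢(Z × ℝ, ℂ)) :
    Integrable (fun q : Z × ℝ => pft v q.1 q.2 * conj (pft w q.1 q.2)) := by
  obtain ⟨C, hC0, hC⟩ := pft_decay v (Module.finrank ℝ Z + 1) (Module.finrank ℝ ℝ + 1)
  obtain ⟨D, hD0, hD⟩ := pft_decay w 0 0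
  have h := (integrable_one_add_norm_pow_inv (Z := Z)).mul_prod
    (integrable_one_add_norm_pow_inv (Z := ℝ))
  refine (h.const_mul (C * D)).mono' ?_ (.of_forall fun q => ?_)
  · exact ((continuous_pft v).mul (Complex.continuous_conj.comp (continuous_pft w))).aestronglyMeasurable
  · have h1 := hC q.1 q.2
    have h2 := hD q.1 q.2
    rw [pow_zero, pow_zero, inv_one, mul_one, mul_one] at h2
    rw [norm_mul, RCLike.norm_conj]
    simp only [Real.norm_eq_abs]
    calc _ ≤ (C * ((1 + ‖q.1‖) ^ (Module.finrank ℝ Z + 1))⁻¹ *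
          ((1 + |q.2|) ^ (Module.finrank ℝ ℝ + 1))⁻¹) * D := by gcongr
      _ = _ := by ring

lemma integral_mul_conj_eq_pft (v w : 𝓢(Z × ℝ, ℂ)) :
    ∫ p, v p * conj (w p) = ∫ l, ∫ z, pft v z l * conj (pft w z l) := by
  have h := integrable_pft_mul_conj v w
  rw [integral_integral_swap (f := fun l z => pft v z l * conj (pft w z l)) h.swap]
  simp only [integral_pft_mul_conj]
  exact integral_prod _ (SchwartzMap.integrable_mul_conj _ v w)

lemma integral_mul_conj_split {δ : ℝ} (hδ : 0 < δ) (v w : 𝓢(Z × ℝ, ℂ)) :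
    ∫ p, v p * conj (w p) = (∫ l in Set.Ioi δ, ∫ z, pft v z l * conj (pft w z l)) +
      (∫ l in Set.Ioi δ, ∫ z, pft (reflT v) z l * conj (pft (reflT w) z l)) +
      ∫ l in Set.Ioc (-δ) δ, ∫ z, pft v z l * conj (pft w z l) := by
  have hi := (integrable_pft_mul_conj v w).integral_prod_right
  rw [integral_mul_conj_eq_pft]
  simp only [pft_reflT]
  set G : ℝ → ℂ := fun l => ∫ z, pft v z l * conj (pft w z l) with hG
  have h1 : ∫ l in Set.Ioi δ, ∫ z, pft v z (-l) * conj (pft w z (-l)) =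
      ∫ l in Set.Iic (-δ), G l := integral_comp_neg_Ioi δ G
  have h2 := integral_add_compl (measurableSet_Ioi (a := δ)) hi
  have h3 := setIntegral_union (Set.Iic_disjoint_Ioc (le_refl (-δ)) (c := δ)) measurableSet_Ioc
    hi.integrableOn hi.integrableOn
  rw [Set.Iic_union_Ioc_eq_Iic (by linarith)] at h3
  rw [Set.compl_Ioi, h3] at h2
  rw [h1, ← h2]
  ring

end ReflectionIntegral

section WeightedBound

variable {Z : Type*} [NormedAddCommGroup Z] [NormedSpace ℝ Z] [FiniteDimensional ℝ Z]
  {ι : Type*} [Fintype ι]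

/-- The weight `(1 + |z|² + t²)⁻¹`, with `|z|` computed in the coordinates of the basis `b`. -/
def localWeight (b : Module.Basis ι ℝ Z) (p : Z × ℝ) : ℝ :=
  (1 + ∑ i, crd b i p.1 ^ 2 + p.2 ^ 2)⁻¹

lemma localWeight_pos (b : Module.Basis ι ℝ Z) (p : Z × ℝ) : 0 < localWeight b p := by
  have : 0 ≤ ∑ i, crd b i p.1 ^ 2 := Finset.sum_nonneg fun i _ => sq_nonneg _
  unfold localWeight
  positivity

lemma localWeight_le (b : Module.Basis ι ℝ Z) (p : Z × ℝ) :
    localWeight b p ≤ (1 + p.2 ^ 2)⁻¹ := by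
  have : 0 ≤ ∑ i, crd b i p.1 ^ 2 := Finset.sum_nonneg fun i _ => sq_nonneg _
  unfold localWeight
  gcongr
  linarith

variable [MeasureSpace Z] [BorelSpace Z] [(volume : Measure Z).IsAddHaarMeasure]

/-- The weighted squared `L²` norm. -/
def localMass (b : Module.Basis ι ℝ Z) (v : 𝓢(Z × ℝ, ℂ)) : ℝ :=
  ∫ p, localWeight b p * ‖v p‖ ^ 2

lemma localMass_nonneg (b : Module.Basis ι ℝ Z) (v : 𝓢(Z × ℝ, ℂ)) : 0 ≤ localMass b v :=
  integral_nonneg fun p => mul_nonneg (localWeight_pos b p).le (by positivity)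

lemma localMass_reflT (b : Module.Basis ι ℝ Z) (v : 𝓢(Z × ℝ, ℂ)) :
    localMass b (reflT v) = localMass b v := by
  rw [localMass, localMass, ← integral_comp_reflT]
  simp [localWeight, reflT_apply]

variable {b : Module.Basis ι ℝ Z} {v w : 𝓢(Z × ℝ, ℂ)}

lemma localWeight_mul_norm_sq (hw : ∀ p, w p = (localWeight b p : ℂ) * v p) (p : Z × ℝ) :
    localWeight b p * ‖v p‖ ^ 2 = ‖v p‖ * ‖w p‖ := by
  rw [hw, norm_mul, Complex.norm_real, Real.norm_of_nonneg (localWeight_pos b p).le]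
  ring

lemma integrable_localWeight_mul (hw : ∀ p, w p = (localWeight b p : ℂ) * v p) :
    Integrable (fun p => localWeight b p * ‖v p‖ ^ 2) := by
  refine (SchwartzMap.integrable_mul_conj volume v w).norm.congr (.of_forall fun p => ?_)
  simp only [norm_mul, RCLike.norm_conj, localWeight_mul_norm_sq hw]

lemma localMass_eq (hw : ∀ p, w p = (localWeight b p : ℂ) * v p) :
    (localMass b v : ℂ) = ∫ p, v p * conj (w p) := by
  rw [localMass, ← integral_complex_ofReal]
  refine integral_congr_ae (.of_forall fun p => ?_)
  simp only [hw, map_mul, Complex.conj_ofReal]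
  push_cast
  rw [← Complex.mul_conj']
  ring

lemma sqInt_add_sum_le (hw : ∀ p, w p = (localWeight b p : ℂ) * v p) :
    sqInt w + sqInt (mulT w) + ∑ i, sqInt (mulZ (crd b i) w) ≤ localMass b v := by
  refine le_of_eq ?_
  have i1 : Integrable (fun p => ‖w p‖ ^ 2 + ‖mulT w p‖ ^ 2) :=
    (integrable_norm_sq_schwartz _).add (integrable_norm_sq_schwartz _)
  unfold sqInt
  rw [← integral_finsetSum _ fun i _ => integrable_norm_sq_schwartz _,
    ← integral_add (integrable_norm_sq_schwartz _) (integrable_norm_sq_schwartz _),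
    ← integral_add i1 (integrable_finsetSum _ fun i _ => integrable_norm_sq_schwartz _)]
  refine integral_congr_ae (.of_forall fun p => ?_)
  have h := localWeight_pos b p
  have h1 : localWeight b p * (1 + ∑ i, crd b i p.1 ^ 2 + p.2 ^ 2) = 1 := by
    rw [localWeight] at h ⊢
    exact inv_mul_cancel₀ (inv_pos.1 h).ne'
  simp only [mulT_apply, mulZ_apply, norm_mul, mul_pow, Complex.norm_real, Real.norm_eq_abs,
    sq_abs, ← Finset.sum_mul, hw]
  linear_combination (localWeight b p * ‖v p‖ ^ 2) * h1

lemma sqInt_add_le (v w : 𝓢(Z × ℝ, ℂ)) : sqInt (v + w) ≤ 2 * sqInt v + 2 * sqInt w := by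
  unfold sqInt
  rw [← integral_const_mul, ← integral_const_mul, ← integral_add
    ((integrable_norm_sq_schwartz _).const_mul _) ((integrable_norm_sq_schwartz _).const_mul _)]
  refine integral_mono (integrable_norm_sq_schwartz _)
    (((integrable_norm_sq_schwartz _).const_mul _).add
      ((integrable_norm_sq_schwartz _).const_mul _)) fun p => ?_
  have h := norm_add_le (v p) (w p)
  simp only [add_apply]
  calc _ ≤ (‖v p‖ + ‖w p‖) ^ 2 := by gcongr
    _ ≤ _ := by linarith [sq_nonneg (‖v p‖ - ‖w p‖)]

lemma sqInt_smul (c : ℂ) (v : 𝓢(Z × ℝ, ℂ)) : sqInt (c • v) = ‖c‖ ^ 2 * sqInt v := by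
  unfold sqInt
  rw [← integral_const_mul]
  simp [mul_pow]

lemma sqInt_shift_add_sum_le (hw : ∀ p, w p = (localWeight b p : ℂ) * v p) :
    sqInt (w + (2 * Real.pi * Complex.I) • mulT w) + ∑ i, sqInt (mulZ (crd b i) w) ≤
      8 * Real.pi ^ 2 * localMass b v := by
  have h1 := sqInt_add_le w ((2 * Real.pi * Complex.I) • mulT w)
  have h2 := sqInt_add_sum_le hw
  have h3 := sqInt_nonneg w
  have h4 := sqInt_nonneg (mulT w)
  have h5 : 0 ≤ ∑ i, sqInt (mulZ (crd b i) w) := Finset.sum_nonneg fun i _ => sqInt_nonneg _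
  have h6 : ‖(2 * Real.pi * Complex.I : ℂ)‖ ^ 2 = 4 * Real.pi ^ 2 := by
    simp [mul_pow]
    norm_num
  rw [sqInt_smul, h6] at h1
  have hpi : 1 ≤ Real.pi ^ 2 := by nlinarith [Real.pi_gt_three]
  calc _ ≤ 2 * sqInt w + 8 * Real.pi ^ 2 * sqInt (mulT w) +
        ∑ i, sqInt (mulZ (crd b i) w) := by linarith
    _ ≤ 8 * Real.pi ^ 2 * (sqInt w + sqInt (mulT w) + ∑ i, sqInt (mulZ (crd b i) w)) := by
        nlinarith
    _ ≤ _ := by gcongr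

lemma norm_pft_mul_conj_le (hw : ∀ p, w p = (localWeight b p : ℂ) * v p) {κ : ℝ} (hκ : 0 < κ)
    (z : Z) (l : ℝ) :
    ‖pft v z l * conj (pft w z l)‖ ≤ κ * ‖pft v z l‖ ^ 2 +
      Real.pi / (4 * κ) * ∫ t, localWeight b (z, t) * ‖v (z, t)‖ ^ 2 := by
  set x := ‖pft v z l‖
  have hpi := Real.pi_pos
  have i1 : Integrable (fun t => localWeight b (z, t) * ‖v (z, t)‖ ^ 2) := by
    have := (SchwartzMap.integrable_mul_conj volume (vslice v z) (vslice w z)).norm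
    refine this.congr (.of_forall fun t => ?_)
    simp only [norm_mul, RCLike.norm_conj, vslice_apply]
    exact (localWeight_mul_norm_sq hw (z, t)).symm
  have h := norm_integral_le_of_norm_le (f := fun t => (x : ℂ) * (unitPhase (-(t * l)) * w (z, t)))
    ((integrable_inv_one_add_sq.const_mul (κ * x ^ 2 / Real.pi)).add
      (i1.const_mul (Real.pi / (4 * κ)))) (.of_forall fun t => by
        simp only [Pi.add_apply]
        rw [norm_mul, norm_mul, norm_unitPhase, one_mul, Complex.norm_real, hw, norm_mul,
          Complex.norm_real, Real.norm_of_nonneg (localWeight_pos b _).le,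
          Real.norm_of_nonneg (norm_nonneg _)]
        have h1 := localWeight_le b (z, t)
        have h2 := (localWeight_pos b (z, t)).le
        have h3 : x * ‖v (z, t)‖ ≤ κ * x ^ 2 / Real.pi + Real.pi / (4 * κ) * ‖v (z, t)‖ ^ 2 := by
          rw [← sub_nonneg]
          have : κ * x ^ 2 / Real.pi + Real.pi / (4 * κ) * ‖v (z, t)‖ ^ 2 - x * ‖v (z, t)‖ =
            (2 * κ * x - Real.pi * ‖v (z, t)‖) ^ 2 / (4 * κ * Real.pi) := by field_simp; ring
          rw [this]
          positivity
        calc _ = localWeight b (z, t) * (x * ‖v (z, t)‖) := by ring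
          _ ≤ localWeight b (z, t) *
              (κ * x ^ 2 / Real.pi + Real.pi / (4 * κ) * ‖v (z, t)‖ ^ 2) := by gcongr
          _ = κ * x ^ 2 / Real.pi * localWeight b (z, t) +
              Real.pi / (4 * κ) * (localWeight b (z, t) * ‖v (z, t)‖ ^ 2) := by ring
          _ ≤ _ := by gcongr)
  simp only [Pi.add_apply] at h
  rw [integral_const_mul, integral_add (integrable_inv_one_add_sq.const_mul _) (i1.const_mul _),
    integral_const_mul, integral_const_mul, integral_univ_inv_one_add_sq, norm_mul,
    Complex.norm_real, Real.norm_of_nonneg (norm_nonneg _), div_mul_cancel₀ _ hpi.ne'] at h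
  rw [norm_mul, RCLike.norm_conj]
  exact h

lemma norm_integral_low_le (hw : ∀ p, w p = (localWeight b p : ℂ) * v p) {δ : ℝ} (hδ : 0 < δ) :
    ‖∫ l in Set.Ioc (-δ) δ, ∫ z, pft v z l * conj (pft w z l)‖ ≤
      2 * Real.pi * δ * sqInt v + 4⁻¹ * localMass b v := by
  have hpi := Real.pi_pos
  have hκ : 0 < 2 * Real.pi * δ := by positivity
  have j1 : Integrable (fun q : Z × ℝ => ‖pft v q.1 q.2‖ ^ 2) := by
    refine (integrable_pft_mul_conj v v).re.congr (.of_forall fun p => ?_)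
    simp only [Complex.mul_conj', ← Complex.ofReal_pow]
    rfl
  have j2 := (integrable_localWeight_mul hw).integral_prod_left
  have j3 := (integrable_pft_mul_conj v w)
  have k1 : ∫ l, ∫ z, ‖pft v z l‖ ^ 2 = sqInt v := by
    rw [integral_integral_swap (f := fun l z => ‖pft v z l‖ ^ 2) j1.swap]
    simp only [integral_norm_sq_pft]
    exact (integral_prod _ (integrable_norm_sq_schwartz v)).symm
  have k2 : ∫ z, ∫ t, localWeight b (z, t) * ‖v (z, t)‖ ^ 2 = localMass b v :=
    (integral_prod _ (integrable_localWeight_mul hw)).symm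
  have m1 := j1.integral_prod_right
  have h1 : ∀ᵐ l : ℝ, ‖∫ z, pft v z l * conj (pft w z l)‖ ≤
      2 * Real.pi * δ * (∫ z, ‖pft v z l‖ ^ 2) + (8 * δ)⁻¹ * localMass b v := by
    filter_upwards [j1.prod_left_ae] with l hl
    have := norm_integral_le_of_norm_le (f := fun z => pft v z l * conj (pft w z l))
      ((hl.const_mul (2 * Real.pi * δ)).add (j2.const_mul (Real.pi / (4 * (2 * Real.pi * δ)))))
      (.of_forall fun z => norm_pft_mul_conj_le hw hκ z l)
    simp only [Pi.add_apply] at this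
    rw [integral_add (hl.const_mul _) (j2.const_mul _), integral_const_mul, integral_const_mul,
      k2] at this
    refine this.trans_eq ?_
    congr 2
    field_simp
    norm_num
  have hc : IntegrableOn (fun _ : ℝ => (8 * δ)⁻¹ * localMass b v) (Set.Ioc (-δ) δ) :=
    integrableOn_const measure_Ioc_lt_top.ne
  have h2 := norm_integral_le_of_norm_le
    (f := fun l => ∫ z, pft v z l * conj (pft w z l))
    ((m1.const_mul (2 * Real.pi * δ)).integrableOn.add hc) (ae_restrict_of_ae h1)
  simp only [Pi.add_apply] at h2
  rw [integral_add (m1.const_mul _).integrableOn hc, integral_const_mul, setIntegral_const] at h2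
  have h3 : ∫ l in Set.Ioc (-δ) δ, ∫ z, ‖pft v z l‖ ^ 2 ≤ sqInt v := by
    rw [← k1]
    exact setIntegral_le_integral m1 (.of_forall fun l => integral_nonneg fun z => by positivity)
  have h4 : (volume : Measure ℝ).real (Set.Ioc (-δ) δ) = 2 * δ := by
    rw [Real.volume_real_Ioc_of_le (by linarith)]; ring
  rw [h4, smul_eq_mul] at h2
  have h5 : 2 * δ * ((8 * δ)⁻¹ * localMass b v) = 4⁻¹ * localMass b v := by
    field_simp
    ring
  rw [h5] at h2
  refine h2.trans ?_
  gcongr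

end WeightedBound

section CoreEstimate

variable {Z : Type*} [NormedAddCommGroup Z] [NormedSpace ℝ Z] [FiniteDimensional ℝ Z]
  [MeasureSpace Z] [BorelSpace Z] [(volume : Measure Z).IsAddHaarMeasure]
  {ι : Type*} [Fintype ι] {b : Module.Basis ι ℝ Z} {v w : 𝓢(Z × ℝ, ℂ)}

lemma reflT_localWeight_mul (hw : ∀ p, w p = (localWeight b p : ℂ) * v p) (p : Z × ℝ) :
    reflT w p = (localWeight b p : ℂ) * reflT v p := by
  rw [reflT_apply, reflT_apply, hw]
  simp [localWeight]

lemma oscEnergy_til_le_sum {δ : ℝ} (hδ : 0 < δ) (d : ℕ) (ω : Z →L[ℝ] Z →L[ℝ] ℝ)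
    (hω : ∀ ξ η, ω ξ η = -ω η ξ) {i j : ι} (hij : i ≠ j) (h1 : |ω (b i) (b j)| = 1)
    (v : 𝓢(Z × ℝ, ℂ)) :
    oscEnergy d δ (til δ v) ≤ ∑ i, oscEnergy d δ (tilX δ ω (b i) v) := by
  classical
  have h := oscEnergy_til_le d hδ ω hω (b i) (b j) v
  have h0 : ∀ k, 0 ≤ oscEnergy d δ (tilX δ ω (b k) v) := fun k => oscEnergy_nonneg d hδ _
  have h2 : oscEnergy d δ (tilX δ ω (b i) v) + oscEnergy d δ (tilX δ ω (b j) v) ≤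
      ∑ i, oscEnergy d δ (tilX δ ω (b i) v) := by
    rw [← Finset.sum_pair (f := fun k => oscEnergy d δ (tilX δ ω (b k) v)) hij]
    exact Finset.sum_le_sum_of_subset_of_nonneg (Finset.subset_univ _) fun k _ _ => h0 k
  rw [h1, mul_one] at h
  have h3 := oscEnergy_nonneg d hδ (til δ v)
  nlinarith [Real.pi_gt_three]

lemma localMass_le_sum_oscEnergy {δ : ℝ} (hδ : 0 < δ) {d : ℕ} (hd : 1 ≤ d)
    (hZ : Module.finrank ℝ Z = 2 * d) (ω : Z →L[ℝ] Z →L[ℝ] ℝ) (hω : ∀ ξ η, ω ξ η = -ω η ξ)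
    {i j : ι} (hij : i ≠ j) (h1 : |ω (b i) (b j)| = 1)
    (hw : ∀ p, w p = (localWeight b p : ℂ) * v p) :
    localMass b v ≤ 64 * Real.pi ^ 2 * (∑ i, oscEnergy d δ (tilX δ ω (b i) v) +
      ∑ i, oscEnergy d δ (tilX δ (-ω) (b i) (reflT v))) + 4 * Real.pi * δ * sqInt v := by
  have hpi := Real.pi_pos
  have hK : 0 < 32 * Real.pi ^ 2 := by positivity
  have hω' : ∀ ξ η, (-ω) ξ η = -(-ω) η ξ := fun ξ η => by simp [hω ξ η]
  have e1 := oscEnergy_til_le_sum hδ d ω hω hij h1 v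
  have e2 := oscEnergy_til_le_sum (b := b) hδ d (-ω) hω' hij (by simpa using h1) (reflT v)
  have p1 := norm_integral_high_le hδ hK hd hZ ω hω b v w
  have p2 := norm_integral_high_le hδ hK hd hZ (-ω) hω' b (reflT v) (reflT w)
  have p3 := norm_integral_low_le hw hδ
  have s1 := sqInt_shift_add_sum_le hw
  have s2 := sqInt_shift_add_sum_le (reflT_localWeight_mul hw)
  rw [localMass_reflT] at s2
  have n : ‖(localMass b v : ℂ)‖ ≤ _ :=
    (congrArg norm ((localMass_eq hw).trans (integral_mul_conj_split hδ v w))).trans_le norm_add₃_le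
  rw [Complex.norm_real, Real.norm_of_nonneg (localMass_nonneg b v)] at n
  have s1' := mul_le_mul_of_nonneg_left s1 (inv_pos.2 hK).le
  have s2' := mul_le_mul_of_nonneg_left s2 (inv_pos.2 hK).le
  have hc : (32 * Real.pi ^ 2)⁻¹ * (8 * Real.pi ^ 2 * localMass b v) = 4⁻¹ * localMass b v := by
    field_simp
    ring
  rw [hc] at s1' s2'
  have e1' := mul_le_mul_of_nonneg_left e1 hK.le
  have e2' := mul_le_mul_of_nonneg_left e2 hK.le
  linarith

theorem localMass_le {δ ε : ℝ} (hδ : 0 < δ) (hε : 0 < ε) {d : ℕ} (hd : 1 ≤ d)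
    (hZ : Module.finrank ℝ Z = 2 * d) (ω : Z →L[ℝ] Z →L[ℝ] ℝ) (hω : ∀ ξ η, ω ξ η = -ω η ξ)
    {i j : ι} (hij : i ≠ j) (h1 : |ω (b i) (b j)| = 1)
    (hw : ∀ p, w p = (localWeight b p : ℂ) * v p) :
    localMass b v ≤ 256 * Real.pi ^ 3 *
      ((inner ℂ (oscOp d hδ hε v) (oscOp d hδ hε (Complex.I • hLap ω b v))).re +
        (inner ℂ (oscOp d hδ hε (reflT v))
          (oscOp d hδ hε (reflT (Complex.I • hLap ω b v)))).re) +
      4 * Real.pi * δ * sqInt v +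
      ε * (64 * Real.pi ^ 2 * δ⁻¹ * (sqInt v + sqInt (hLap ω b v))) := by
  have h := localMass_le_sum_oscEnergy hδ hd hZ ω hω hij h1 hw
  have a1 := sum_oscEnergy_le hδ hε hZ ω b v
  have a2 := sum_oscEnergy_le hδ hε hZ (-ω) b (reflT v)
  rw [hLap_reflT, sqInt_reflT, sqInt_reflT, ← map_smul] at a2
  have hpi : 0 ≤ 64 * Real.pi ^ 2 := by positivity
  have := mul_le_mul_of_nonneg_left (add_le_add a1 a2) hpi
  refine h.trans ((add_le_add this le_rfl).trans_eq ?_)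
  ring

end CoreEstimate

section WeightOperator

variable {Z : Type*} [NormedAddCommGroup Z] [NormedSpace ℝ Z] [FiniteDimensional ℝ Z]
  {ι : Type*} [Fintype ι]

/-- The coordinates of `(z, t)` as a Euclidean vector. -/
def coordMap (b : Module.Basis ι ℝ Z) : Z × ℝ →L[ℝ] EuclideanSpace ℝ (Option ι) :=
  ((EuclideanSpace.equiv (Option ι) ℝ).symm : (Option ι → ℝ) →L[ℝ] _).comp
    (ContinuousLinearMap.pi fun o => o.elim (ContinuousLinearMap.snd ℝ Z ℝ)
      fun i => (crd b i).comp (ContinuousLinearMap.fst ℝ Z ℝ))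

lemma localWeight_eq (b : Module.Basis ι ℝ Z) (p : Z × ℝ) :
    localWeight b p = (1 + ‖coordMap b p‖ ^ 2) ^ (-1 : ℝ) := by
  rw [Real.rpow_neg_one, localWeight, EuclideanSpace.norm_sq_eq, Fintype.sum_option]
  simp [coordMap]
  ring

lemma hasTemperateGrowth_localWeight (b : Module.Basis ι ℝ Z) :
    (fun p => (localWeight b p : ℂ)).HasTemperateGrowth := by
  have h := (Function.hasTemperateGrowth_one_add_norm_sq_rpow
    (EuclideanSpace ℝ (Option ι)) (-1)).comp (coordMap b).hasTemperateGrowth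
  refine Complex.ofRealCLM.hasTemperateGrowth.comp (f := localWeight b) ?_
  rw [show localWeight b = (fun x => (1 + ‖x‖ ^ 2) ^ (-1 : ℝ)) ∘ coordMap b from
    funext (localWeight_eq b)]
  exact h

/-- Multiplication by `localWeight b`. -/
def mulWeight (b : Module.Basis ι ℝ Z) : 𝓢(Z × ℝ, ℂ) →L[ℂ] 𝓢(Z × ℝ, ℂ) :=
  smulLeftCLM ℂ fun p => (localWeight b p : ℂ)

lemma mulWeight_apply (b : Module.Basis ι ℝ Z) (v : 𝓢(Z × ℝ, ℂ)) (p : Z × ℝ) :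
    mulWeight b v p = (localWeight b p : ℂ) * v p :=
  smulLeftCLM_apply_apply (hasTemperateGrowth_localWeight b) v p

end WeightOperator

section AbstractDerivative

variable {E H F : Type*} [AddCommGroup E] [Module ℂ E]
  [NormedAddCommGroup H] [NormedSpace ℂ H] [NormedSpace ℝ H] [IsScalarTower ℝ ℂ H]

lemma HasDerivAt.map_of_norm_le [NormedAddCommGroup F] [NormedSpace ℂ F] [NormedSpace ℝ F]
    [IsScalarTower ℝ ℂ F] (J : E →ₗ[ℂ] H) (A : E →ₗ[ℂ] F) {c : ℝ}
    (h : ∀ v, ‖A v‖ ≤ c * ‖J v‖) {u : ℝ → E} {w : E} {τ : ℝ}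
    (hu : HasDerivAt (fun s => J (u s)) (J w) τ) : HasDerivAt (fun s => A (u s)) (A w) τ := by
  rw [hasDerivAt_iff_isLittleO] at hu ⊢
  refine Asymptotics.IsBigO.trans_isLittleO (Asymptotics.IsBigO.of_bound c
    (.of_forall fun s => ?_)) hu
  have := h (u s - u τ - ((s - τ : ℝ) : ℂ) • w)
  simp only [map_sub, map_smul] at this
  rwa [← Complex.coe_algebraMap, algebraMap_smul, algebraMap_smul] at this

end AbstractDerivative

lemma hasDerivAt_norm_sq_complex {H : Type*} [NormedAddCommGroup H] [InnerProductSpace ℂ H]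
    [NormedSpace ℝ H] [IsScalarTower ℝ ℂ H] {f : ℝ → H} {f' : H} {τ : ℝ}
    (hf : HasDerivAt f f' τ) :
    HasDerivAt (fun s => ‖f s‖ ^ 2) (2 * (inner ℂ (f τ) f').re) τ := by
  have h := Complex.reCLM.hasFDerivAt.comp_hasDerivAt τ (hf.inner ℂ hf)
  refine (h.congr_deriv ?_).congr_of_eventuallyEq (.of_forall fun s => ?_)
  · have := inner_re_symm (𝕜 := ℂ) f' (f τ)
    simp only [RCLike.re_to_complex] at this
    simp [two_mul, this]
  · exact (inner_self_eq_norm_sq (𝕜 := ℂ) (f s)).symm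

section TimeEvolution

variable {Z : Type*} [NormedAddCommGroup Z] [NormedSpace ℝ Z] [FiniteDimensional ℝ Z]
  [MeasureSpace Z] [BorelSpace Z] [(volume : Measure Z).IsAddHaarMeasure]
  {ι : Type*} [Fintype ι]

lemma integral_hLap_mul_conj (ω : Z →L[ℝ] Z →L[ℝ] ℝ) (b : ι → Z) (v : 𝓢(Z × ℝ, ℂ)) :
    ∫ p, hLap ω b v p * conj (v p) = ((-∑ i, sqInt (hX ω (b i) v) : ℝ) : ℂ) := by
  simp only [hLap, sum_apply, Finset.sum_mul]
  rw [integral_finsetSum _ fun i _ => SchwartzMap.integrable_mul_conj _ _ _]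
  rw [← Finset.sum_neg_distrib, Complex.ofReal_sum]
  refine Finset.sum_congr rfl fun i _ => ?_
  rw [integral_hX_mul_conj, Complex.ofReal_neg, sqInt, ← integral_complex_ofReal]
  simp only [Complex.mul_conj', Complex.ofReal_pow]

variable {H : Type*} [NormedAddCommGroup H] [InnerProductSpace ℂ H]
  [NormedSpace ℝ H] [IsScalarTower ℝ ℂ H] {J : 𝓢(Z × ℝ, ℂ) →ₗ[ℂ] H}

lemma norm_sq_eq_sqInt (hJ : ∀ v w, inner ℂ (J v) (J w) = ∫ p, w p * conj (v p))
    (v : 𝓢(Z × ℝ, ℂ)) : ‖J v‖ ^ 2 = sqInt v := by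
  rw [← @inner_self_eq_norm_sq ℂ, hJ, sqInt]
  simp only [Complex.mul_conj', ← Complex.ofReal_pow]
  rw [integral_complex_ofReal]
  rfl

lemma sqInt_mulWeight_le (b : Module.Basis ι ℝ Z) (v : 𝓢(Z × ℝ, ℂ)) :
    sqInt (mulWeight b v) ≤ sqInt v := by
  refine integral_mono (integrable_norm_sq_schwartz _) (integrable_norm_sq_schwartz _) fun p => ?_
  have h1 := localWeight_pos b p
  have h2 : localWeight b p ≤ 1 :=
    (localWeight_le b p).trans (inv_le_one_of_one_le₀ (by nlinarith [sq_nonneg p.2]))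
  simp only [mulWeight_apply, norm_mul, Complex.norm_real, Real.norm_of_nonneg h1.le]
  gcongr
  exact mul_le_of_le_one_left (norm_nonneg _) h2

variable {u : ℝ → 𝓢(Z × ℝ, ℂ)} {ω : Z →L[ℝ] Z →L[ℝ] ℝ} {b : Module.Basis ι ℝ Z}

lemma sqInt_eq_of_hasDerivAt (hJ : ∀ v w, inner ℂ (J v) (J w) = ∫ p, w p * conj (v p))
    (hu : ∀ τ, HasDerivAt (fun s => J (u s)) (J (Complex.I • hLap ω b (u τ))) τ) (τ : ℝ) :
    sqInt (u τ) = sqInt (u 0) := by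
  have h : ∀ τ, HasDerivAt (fun s => sqInt (u s)) 0 τ := fun τ => by
    have := hasDerivAt_norm_sq_complex (hu τ)
    simp only [norm_sq_eq_sqInt hJ] at this
    refine this.congr_deriv ?_
    rw [hJ]
    simp only [smul_apply, smul_eq_mul, mul_assoc]
    rw [integral_const_mul, integral_hLap_mul_conj]
    simp
  exact is_const_of_deriv_eq_zero (fun τ => (h τ).differentiableAt) (fun τ => (h τ).deriv) τ 0

lemma continuous_localMass (hJ : ∀ v w, inner ℂ (J v) (J w) = ∫ p, w p * conj (v p))
    (hu : Continuous fun τ => J (u τ)) : Continuous fun τ => localMass b (u τ) := by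
  have h1 : Continuous fun τ => J (mulWeight b (u τ)) := by
    refine continuous_iff_continuousAt.2 fun τ => ?_
    rw [ContinuousAt, tendsto_iff_norm_sub_tendsto_zero]
    refine squeeze_zero (fun _ => norm_nonneg _) (fun s => ?_)
      (tendsto_iff_norm_sub_tendsto_zero.1 (hu.tendsto τ))
    rw [← map_sub, ← map_sub, ← map_sub]
    refine (sq_le_sq₀ (norm_nonneg _) (norm_nonneg _)).1 ?_
    rw [norm_sq_eq_sqInt hJ, norm_sq_eq_sqInt hJ]
    exact sqInt_mulWeight_le b _
  have h2 : ∀ τ, localMass b (u τ) = (inner ℂ (J (mulWeight b (u τ))) (J (u τ))).re := fun τ => by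
    rw [hJ, ← localMass_eq (mulWeight_apply b (u τ)), Complex.ofReal_re]
  simp only [h2]
  exact Complex.continuous_re.comp (h1.inner hu)

theorem integral_localMass_le (hJ : ∀ v w, inner ℂ (J v) (J w) = ∫ p, w p * conj (v p))
    {d : ℕ} (hd : 1 ≤ d) (hZ : Module.finrank ℝ Z = 2 * d)
    (hω : ∀ ξ η, ω ξ η = -ω η ξ) {i j : ι} (hij : i ≠ j) (h1 : |ω (b i) (b j)| = 1)
    (hu : ∀ τ, HasDerivAt (fun s => J (u s)) (J (Complex.I • hLap ω b (u τ))) τ)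
    (hcont : Continuous fun τ => J (Complex.I • hLap ω b (u τ))) {T : ℝ} (hT : 0 ≤ T) :
    ∫ τ in (-T)..T, localMass b (u τ) ≤ 128 * Real.pi ^ 3 * sqInt (u 0) := by
  obtain ⟨M, hM⟩ := isCompact_Icc.exists_bound_of_continuousOn (s := Set.Icc (-T) T)
    hcont.continuousOn
  have hM' : ∀ τ ∈ Set.Icc (-T) T, sqInt (hLap ω b (u τ)) ≤ M ^ 2 := fun τ hτ => by
    have : sqInt (hLap ω b (u τ)) = sqInt (Complex.I • hLap ω b (u τ)) := by simp [sqInt_smul]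
    rw [this, ← norm_sq_eq_sqInt hJ]
    gcongr
    exact hM τ hτ
  have hS := sqInt_nonneg (u 0)
  have hpi := Real.pi_pos
  set S := sqInt (u 0)
  set B := 4 * Real.pi * S + 64 * Real.pi ^ 2 * (S + M ^ 2) with hB
  have hB0 : 0 ≤ B := by positivity
  have hmassc := continuous_localMass (b := b) hJ
    (continuous_iff_continuousAt.2 fun τ => (hu τ).continuousAt)
  have key : ∀ δ : ℝ, 0 < δ →
      ∫ τ in (-T)..T, localMass b (u τ) ≤ 128 * Real.pi ^ 3 * S + δ * (2 * T * B) := by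
    intro δ hδ
    have hε : 0 < δ ^ 2 := by positivity
    set A₁ : 𝓢(Z × ℝ, ℂ) →ₗ[ℂ] _ := oscOp d hδ hε
    set A₂ : 𝓢(Z × ℝ, ℂ) →ₗ[ℂ] _ := A₁.comp (reflT (Z := Z)).toLinearMap
    have hA₁ : ∀ v, ‖A₁ v‖ ^ 2 ≤ 2⁻¹ * sqInt v := norm_sq_oscOp_le hδ hε hZ
    have hA₂ : ∀ v, ‖A₂ v‖ ^ 2 ≤ 2⁻¹ * sqInt v := fun v =>
      (hA₁ (reflT v)).trans_eq (by rw [sqInt_reflT])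
    have bd : ∀ A : 𝓢(Z × ℝ, ℂ) →ₗ[ℂ] Lp ℂ 2 (oscMeasure Z δ),
        (∀ v, ‖A v‖ ^ 2 ≤ 2⁻¹ * sqInt v) → ∀ v, ‖A v‖ ≤ 1 * ‖J v‖ := fun A hA v => by
      rw [one_mul]
      refine (sq_le_sq₀ (norm_nonneg _) (norm_nonneg _)).1 ((hA v).trans ?_)
      rw [norm_sq_eq_sqInt hJ]
      linarith [sqInt_nonneg v]
    have d₁ := fun τ => hasDerivAt_norm_sq_complex (HasDerivAt.map_of_norm_le J A₁ (bd A₁ hA₁) (hu τ))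
    have d₂ := fun τ => hasDerivAt_norm_sq_complex (HasDerivAt.map_of_norm_le J A₂ (bd A₂ hA₂) (hu τ))
    have dG := fun τ => (((d₁ τ).add (d₂ τ)).const_mul (128 * Real.pi ^ 3)).add
      ((hasDerivAt_id τ).const_mul (δ * B))
    have h := intervalIntegral.integral_le_sub_of_hasDeriv_right_of_le (a := -T) (b := T)
      (by linarith) (fun τ _ => (dG τ).continuousAt.continuousWithinAt)
      (fun τ _ => (dG τ).hasDerivWithinAt) hmassc.continuousOn.integrableOn_Icc
      fun τ hτ => by
        have hl := localMass_le hδ hε hd hZ ω hω hij h1 (mulWeight_apply b (u τ))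
        have hm := hM' τ (Set.Ioo_subset_Icc_self hτ)
        rw [sqInt_eq_of_hasDerivAt hJ hu τ] at hl
        have hm' : δ ^ 2 * (64 * Real.pi ^ 2 * δ⁻¹ * (S + sqInt (hLap ω b (u τ)))) ≤
            δ * (64 * Real.pi ^ 2 * (S + M ^ 2)) := by
          calc _ = δ * (64 * Real.pi ^ 2 * (S + sqInt (hLap ω b (u τ)))) := by field_simp
            _ ≤ _ := by gcongr
        refine (hl.trans (add_le_add le_rfl hm')).trans_eq ?_
        simp only [A₂, A₁, hB, LinearMap.comp_apply, ContinuousLinearMap.coe_coe]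
        ring
    refine h.trans ?_
    have e₁ := hA₁ (u T)
    have e₂ := hA₂ (u T)
    rw [sqInt_eq_of_hasDerivAt hJ hu T] at e₁ e₂
    have e₃ : 0 ≤ ‖A₁ (u (-T))‖ ^ 2 + ‖A₂ (u (-T))‖ ^ 2 := by positivity
    have e₄ := mul_le_mul_of_nonneg_left (add_le_add e₁ e₂)
      (show 0 ≤ 128 * Real.pi ^ 3 by positivity)
    have e₅ := mul_nonneg (show 0 ≤ 128 * Real.pi ^ 3 by positivity) e₃
    simp only [Pi.add_apply, id]
    linarith
  refine le_of_forall_pos_le_add fun ε hε => (key (ε / (2 * T * B + 1)) (by positivity)).trans ?_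
  gcongr
  rw [div_mul_eq_mul_div, div_le_iff₀ (by positivity)]
  nlinarith

end TimeEvolution

section Transport

variable (d : ℕ)

/-- The horizontal space `ℝ^d × ℝ^d`. -/
abbrev Horiz : Type := EuclideanSpace ℝ (Fin d) × EuclideanSpace ℝ (Fin d)

instance isAddHaarMeasure_volume_horiz : (volume : Measure (Horiz d)).IsAddHaarMeasure :=
  inferInstanceAs ((volume : Measure (EuclideanSpace ℝ (Fin d))).prod volume).IsAddHaarMeasure

instance isAddHaarMeasure_volume_hd : (volume : Measure (Hd d)).IsAddHaarMeasure :=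
  Measure.prod.instIsAddHaarMeasure (volume : Measure (EuclideanSpace ℝ (Fin d)))
    (volume : Measure (EuclideanSpace ℝ (Fin d) × ℝ))

/-- The standard basis of `Horiz d`. -/
def horizBasis : Module.Basis (Fin d ⊕ Fin d) ℝ (Horiz d) :=
  (EuclideanSpace.basisFun (Fin d) ℝ).toBasis.prod (EuclideanSpace.basisFun (Fin d) ℝ).toBasis

lemma horizBasis_inl (j : Fin d) : horizBasis d (.inl j) = (EuclideanSpace.single j 1, 0) := by
  simp [horizBasis]

lemma horizBasis_inr (j : Fin d) : horizBasis d (.inr j) = (0, EuclideanSpace.single j 1) := by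
  simp [horizBasis]

lemma localWeight_horizBasis (p : Horiz d × ℝ) :
    localWeight (horizBasis d) p = (1 + (‖p.1.1‖ ^ 2 + ‖p.1.2‖ ^ 2) + p.2 ^ 2)⁻¹ := by
  simp [localWeight, crd, horizBasis, EuclideanSpace.norm_sq_eq]

/-- The symplectic form `(ξ, z) ↦ ξ₁ ⬝ z₂ - ξ₂ ⬝ z₁`. -/
def sympl : Horiz d →L[ℝ] Horiz d →L[ℝ] ℝ :=
  let B := innerSL ℝ (E := EuclideanSpace ℝ (Fin d))
  let fst := ContinuousLinearMap.fst ℝ (EuclideanSpace ℝ (Fin d)) (EuclideanSpace ℝ (Fin d))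
  let snd := ContinuousLinearMap.snd ℝ (EuclideanSpace ℝ (Fin d)) (EuclideanSpace ℝ (Fin d))
  B.bilinearComp fst snd - B.bilinearComp snd fst

lemma sympl_apply (ξ z : Horiz d) : sympl d ξ z = inner ℝ ξ.1 z.2 - inner ℝ ξ.2 z.1 := by
  simp [sympl]

/-- Regrouping of the coordinates. -/
def regroup : (Horiz d × ℝ) ≃L[ℝ] Hd d :=
  ContinuousLinearEquiv.prodAssoc ℝ (EuclideanSpace ℝ (Fin d)) (EuclideanSpace ℝ (Fin d)) ℝ

lemma regroup_apply (p : Horiz d × ℝ) : regroup d p = (p.1.1, p.1.2, p.2) := rfl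

lemma measurePreserving_regroup : MeasurePreserving (regroup d) :=
  volume_preserving_prodAssoc

lemma measurableEmbedding_regroup : MeasurableEmbedding (regroup d) :=
  MeasurableEquiv.prodAssoc.measurableEmbedding

/-- A function on `Hd d` read in regrouped coordinates. -/
def pullback : 𝓢(Hd d, ℂ) →L[ℂ] 𝓢(Horiz d × ℝ, ℂ) :=
  compCLMOfContinuousLinearEquiv ℂ (regroup d)

lemma pullback_apply (f : 𝓢(Hd d, ℂ)) (p : Horiz d × ℝ) :
    pullback d f p = f (regroup d p) := rfl

lemma fderiv_comp_regroup {f : Hd d → ℂ} (p m : Horiz d × ℝ) :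
    fderiv ℝ (f ∘ regroup d) p m = fderiv ℝ f (regroup d p) (regroup d m) := by
  rw [(regroup d).comp_right_fderiv]
  rfl

lemma hX_inl_of_eq_comp (j : Fin d) {f : Hd d → ℂ} {v : 𝓢(Horiz d × ℝ, ℂ)}
    (h : ⇑v = f ∘ regroup d) :
    ⇑(hX (sympl d) (horizBasis d (.inl j)) v) = Xop d j f ∘ regroup d := by
  ext p
  rw [hX_apply, h, fderiv_comp_regroup, horizBasis_inl, sympl_apply]
  simp [Xop, regroup_apply, EuclideanSpace.inner_single_left]

lemma hX_inr_of_eq_comp (j : Fin d) {f : Hd d → ℂ} {v : 𝓢(Horiz d × ℝ, ℂ)}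
    (h : ⇑v = f ∘ regroup d) :
    ⇑(hX (sympl d) (horizBasis d (.inr j)) v) = Yop d j f ∘ regroup d := by
  ext p
  rw [hX_apply, h, fderiv_comp_regroup, horizBasis_inr, sympl_apply]
  simp [Yop, regroup_apply, EuclideanSpace.inner_single_left]

lemma hLap_pullback (f : 𝓢(Hd d, ℂ)) (p : Horiz d × ℝ) :
    hLap (sympl d) (horizBasis d) (pullback d f) p = subLap d f (regroup d p) := by
  have h : ⇑(pullback d f) = f ∘ regroup d := rfl
  rw [hLap, sum_apply, Fintype.sum_sum_type, subLap, Finset.sum_add_distrib]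
  congr 1
  · exact Finset.sum_congr rfl fun j _ =>
      congr_fun (hX_inl_of_eq_comp d j (hX_inl_of_eq_comp d j h)) p
  · exact Finset.sum_congr rfl fun j _ =>
      congr_fun (hX_inr_of_eq_comp d j (hX_inr_of_eq_comp d j h)) p

/-- A Schwartz function in regrouped coordinates as an element of `L²(Hd d)`. -/
def regroupLp : 𝓢(Horiz d × ℝ, ℂ) →ₗ[ℂ] Lp ℂ 2 (volume : Measure (Hd d)) :=
  ((toLpCLM ℂ ℂ 2 volume).comp
    (compCLMOfContinuousLinearEquiv ℂ (regroup d).symm)).toLinearMap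

lemma regroupLp_coeFn (v : 𝓢(Horiz d × ℝ, ℂ)) :
    regroupLp d v =ᵐ[volume] fun p => v ((regroup d).symm p) :=
  SchwartzMap.coeFn_toLp (compCLMOfContinuousLinearEquiv ℂ (regroup d).symm v) 2 volume

lemma inner_regroupLp (v w : 𝓢(Horiz d × ℝ, ℂ)) :
    inner ℂ (regroupLp d v) (regroupLp d w) = ∫ p, w p * conj (v p) := by
  rw [L2.inner_def, ← (measurePreserving_regroup d).integral_comp (measurableEmbedding_regroup d)]
  refine integral_congr_ae ?_
  have h := (measurePreserving_regroup d).quasiMeasurePreserving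
  filter_upwards [h.ae (regroupLp_coeFn d v), h.ae (regroupLp_coeFn d w)] with p hv hw
  rw [hv, hw]
  simp

lemma w1_sq_le (p : Horiz d × ℝ) :
    w1 d (regroup d p) ^ 2 ≤ localWeight (horizBasis d) p := by
  rw [localWeight_horizBasis]
  set s := ‖p.1.1‖ ^ 2 + ‖p.1.2‖ ^ 2 with hs
  have hs0 : 0 ≤ s := by positivity
  have hzn : zn d (regroup d p) ^ 2 = s := Real.sq_sqrt hs0
  have hzn4 : zn d (regroup d p) ^ 4 = s ^ 2 := by rw [← hzn]; ring
  have hr : s ≤ √(s ^ 2 + p.2 ^ 2) := Real.le_sqrt_of_sq_le (by nlinarith [sq_nonneg p.2])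
  have hr2 : √(s ^ 2 + p.2 ^ 2) ^ 2 = s ^ 2 + p.2 ^ 2 := Real.sq_sqrt (by positivity)
  rw [w1, hzn, hzn4, div_pow, div_pow, hzn, Real.sq_sqrt (by positivity)]
  change s / (1 + s) / (1 + √(s ^ 2 + p.2 ^ 2)) ^ 2 ≤ _
  rw [inv_eq_one_div]
  gcongr
  · exact div_le_one_of_le₀ (by linarith) (by linarith)
  · nlinarith

lemma lintegral_norm_sq (f : 𝓢(Hd d, ℂ)) :
    ∫⁻ p, ENNReal.ofReal (‖f p‖ ^ 2) = ENNReal.ofReal (sqInt (pullback d f)) := by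
  rw [← (measurePreserving_regroup d).lintegral_comp_emb (measurableEmbedding_regroup d), sqInt,
    ofReal_integral_eq_lintegral_ofReal (integrable_norm_sq_schwartz _)
      (.of_forall fun p => by positivity)]
  rfl

lemma lintegral_w1_le (f : 𝓢(Hd d, ℂ)) :
    ∫⁻ p, ENNReal.ofReal (w1 d p ^ 2 * ‖f p‖ ^ 2) ≤
      ENNReal.ofReal (localMass (horizBasis d) (pullback d f)) := by
  rw [← (measurePreserving_regroup d).lintegral_comp_emb (measurableEmbedding_regroup d), localMass,
    ofReal_integral_eq_lintegral_ofReal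
      (integrable_localWeight_mul (mulWeight_apply (horizBasis d) (pullback d f)))
      (.of_forall fun p => mul_nonneg (localWeight_pos _ p).le (by positivity))]
  refine lintegral_mono fun p => ENNReal.ofReal_le_ofReal ?_
  exact mul_le_mul_of_nonneg_right (w1_sq_le d p) (by positivity)

end Transport

lemma regroupLp_pullback (d : ℕ) {f : SchwartzMap (Hd d) ℂ}
    {F : Lp ℂ 2 (volume : Measure (Hd d))} (h : F =ᵐ[volume] f) :
    regroupLp d (pullback d f) = F := by
  refine Lp.ext ((regroupLp_coeFn d _).trans ?_)
  refine Filter.EventuallyEq.trans (.of_forall fun p => ?_) h.symm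
  beta_reduce
  rw [pullback_apply, ContinuousLinearEquiv.apply_symm_apply]

lemma regroupLp_hLap_pullback (d : ℕ) {f : SchwartzMap (Hd d) ℂ}
    {F : Lp ℂ 2 (volume : Measure (Hd d))}
    (h : (fun p => Complex.I * F p) =ᵐ[volume] fun p => -subLap d f p) :
    regroupLp d (Complex.I • hLap (sympl d) (horizBasis d) (pullback d f)) = F := by
  refine Lp.ext ((regroupLp_coeFn d _).trans ?_)
  filter_upwards [h] with p hp
  rw [smul_apply, hLap_pullback, ContinuousLinearEquiv.apply_symm_apply, smul_eq_mul,
    ← neg_eq_iff_eq_neg.2 hp, mul_neg, ← mul_assoc, Complex.I_mul_I]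
  ring

lemma lintegral_le_of_forall_Icc {f : ℝ → ℝ≥0∞} {c : ℝ≥0∞}
    (h : ∀ T : ℝ, 0 ≤ T → ∫⁻ τ in Set.Icc (-T) T, f τ ≤ c) : ∫⁻ τ, f τ ≤ c := by
  have hmono : Monotone fun n : ℕ => Set.Icc (-(n : ℝ)) n := fun m n hmn =>
    Set.Icc_subset_Icc (by simpa using hmn) (by simpa using hmn)
  have hU : ⋃ n : ℕ, Set.Icc (-(n : ℝ)) n = Set.univ := Set.eq_univ_of_forall fun x => by
    obtain ⟨n, hn⟩ := exists_nat_ge |x|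
    exact Set.mem_iUnion.2 ⟨n, abs_le.1 hn⟩
  rw [← setLIntegral_univ, ← hU, setLIntegral_iUnion_of_directed f hmono.directed_le]
  exact iSup_le fun n => h n n.cast_nonneg

/-- Kato-type local smoothing for the Schrödinger flow of the sublaplacian,
with weight `w₁`: if `u(τ,·)` is Schwartz for every `τ`, the map `τ ↦ u(τ,·)` is continuously
differentiable as an `L²`-valued map (witnessed by `U` and its derivative `V`), and
`i ∂_τ u = -Δ_H u`, then the space-time weighted `L²` norm of `u` is controlled by the
`L²` norm of the initial datum `u(0,·)`. -/
theorem kato_smoothing_w1 (d : ℕ) (hd : 1 ≤ d) :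
    ∃ C : ℝ, 0 < C ∧
      ∀ (u : ℝ → SchwartzMap (Hd d) ℂ)
        (U V : ℝ → Lp ℂ 2 (volume : Measure (Hd d))),
        (∀ τ : ℝ, (U τ : Hd d → ℂ) =ᵐ[volume] (fun p => u τ p)) →
        (∀ τ : ℝ, HasDerivAt U (V τ) τ) →
        Continuous V →
        (∀ τ : ℝ, (fun p => Complex.I * (V τ : Hd d → ℂ) p)
            =ᵐ[volume] (fun p => -(subLap d (⇑(u τ)) p))) →
        ∫⁻ τ : ℝ, ∫⁻ p, ENNReal.ofReal (w1 d p ^ 2 * ‖u τ p‖ ^ 2) ≤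
          ENNReal.ofReal C * ∫⁻ p, ENNReal.ofReal (‖u 0 p‖ ^ 2) := by
  refine ⟨128 * Real.pi ^ 3, by positivity, fun u U V hU hd' hV heq => ?_⟩
  have hUv : (fun τ => regroupLp d (pullback d (u τ))) = U :=
    funext fun τ => regroupLp_pullback d (hU τ)
  have hVv : ∀ τ, regroupLp d (Complex.I • hLap (sympl d) (horizBasis d) (pullback d (u τ))) =
      V τ := fun τ => regroupLp_hLap_pullback d (heq τ)
  have hu : ∀ τ, HasDerivAt (fun s => regroupLp d (pullback d (u s)))
      (regroupLp d (Complex.I • hLap (sympl d) (horizBasis d) (pullback d (u τ)))) τ :=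
    fun τ => by
      rw [hUv, hVv]
      exact hd' τ
  have hcont : Continuous fun τ => localMass (horizBasis d) (pullback d (u τ)) :=
    continuous_localMass (inner_regroupLp d) <|
      continuous_iff_continuousAt.2 fun τ => (hu τ).continuousAt
  have hsympl : ∀ ξ η, sympl d ξ η = -sympl d η ξ := fun ξ η => by
    rw [sympl_apply, sympl_apply, real_inner_comm, real_inner_comm ξ.2]
    ring
  have hone : |sympl d (horizBasis d (.inl ⟨0, hd⟩)) (horizBasis d (.inr ⟨0, hd⟩))| = 1 := by
    rw [sympl_apply, horizBasis_inl, horizBasis_inr]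
    simp
  rw [lintegral_norm_sq, ← ENNReal.ofReal_mul (by positivity)]
  refine lintegral_le_of_forall_Icc fun T hT =>
    (lintegral_mono fun τ => lintegral_w1_le d (u τ)).trans ?_
  rw [← ofReal_integral_eq_lintegral_ofReal hcont.continuousOn.integrableOn_Icc
    (.of_forall fun τ => localMass_nonneg _ _), integral_Icc_eq_integral_Ioc,
    ← intervalIntegral.integral_of_le (by linarith)]
  exact ENNReal.ofReal_le_ofReal <| integral_localMass_le (inner_regroupLp d) hd
    (by simp [two_mul]) hsympl Sum.inl_ne_inr hone hu (by simpa only [hVv] using hV) hT
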